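/- Let G be an arc-connected digraph that is (≤7)-half-reconstructible. Then G is NOT (≤6)-half-reconstructible if and only if G satisfies condition L1 or condition L2. -/

import Mathlib

universe u v

/-- A digraph: an irreflexive binary relation on a vertex type. -/
structure Dgraph (V : Type u) where
  Arc : V → V → Prop
  irrefl : ∀ x, ¬ Arc x x

namespace Dgraph

variable {V : Type u} {W : Type v}

/-- The dual digraph. -/
def dual (G : Dgraph V) : Dgraph V :=
  ⟨fun x y => G.Arc y x, fun x h => G.irrefl x h⟩

/-- Subdigraph induced by a set of vertices. -/
def ind (G : Dgraph V) (X : Set V) : Dgraph X :=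
  ⟨fun x y => G.Arc x y, fun x h => G.irrefl x h⟩

/-- Isomorphism of digraphs. -/
def Iso (G : Dgraph V) (G' : Dgraph W) : Prop :=
  ∃ e : V ≃ W, ∀ x y, G.Arc x y ↔ G'.Arc (e x) (e y)

/-- `G` and `G'` are hemimorphic: `G'` is isomorphic to `G` or to its dual. -/
def Hemi (G : Dgraph V) (G' : Dgraph W) : Prop :=
  Iso G G' ∨ Iso G.dual G'

/-- Self-dual digraph. -/
def SelfDual (G : Dgraph V) : Prop := Iso G G.dual

/-- `{x,y}` is a directed pair. -/
def Dir (G : Dgraph V) (x y : V) : Prop :=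
  (G.Arc x y ∧ ¬ G.Arc y x) ∨ (G.Arc y x ∧ ¬ G.Arc x y)

/-- `{x,y}` is a neutral pair (full or void). -/
def Neutral (G : Dgraph V) (x y : V) : Prop :=
  x ≠ y ∧ ¬ G.Dir x y

/-- Interval of a digraph. -/
def IsInterval (G : Dgraph V) (I : Set V) : Prop :=
  ∀ x ∉ I,
    (∀ y ∈ I, G.Arc x y ∧ ¬ G.Arc y x) ∨ (∀ y ∈ I, G.Arc y x ∧ ¬ G.Arc x y) ∨
    (∀ y ∈ I, G.Arc x y ∧ G.Arc y x) ∨ (∀ y ∈ I, ¬ G.Arc x y ∧ ¬ G.Arc y x)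

/-- The arc-connectivity equivalence relation. -/
def ACRel (G : Dgraph V) : V → V → Prop := Relation.ReflTransGen G.Dir

/-- Arc-connected components. -/
def IsACComponent (G : Dgraph V) (D : Set V) : Prop :=
  ∃ x, D = {y | G.ACRel x y}

/-- Arc-connected digraph (at most one arc-connected component). -/
def ArcConnected (G : Dgraph V) : Prop := ∀ x y, G.ACRel x y

/-- Tournament. -/
def IsTournament (G : Dgraph V) : Prop := ∀ x y, x ≠ y → G.Dir x y

/-- Chain (transitive tournament). -/
def IsChainD (G : Dgraph V) : Prop :=
  G.IsTournament ∧ ∀ x y z, G.Arc x y → G.Arc y z → G.Arc x z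

/-- Dgraph from a relation, with forced irreflexivity. -/
def ofRel (r : V → V → Prop) : Dgraph V := ⟨fun x y => x ≠ y ∧ r x y, fun x h => h.1 rfl⟩

/-- The model flag. -/
def flagD : Dgraph (Fin 3) :=
  ofRel (fun x y => (x = 0 ∧ y = 1) ∨ (x = 1 ∧ y = 2) ∨ (x = 2 ∧ y = 1))

/-- First model peak. -/
def peakD1 : Dgraph (Fin 3) :=
  ofRel (fun x y => (x = 0 ∧ y = 1) ∨ (x = 0 ∧ y = 2) ∨ (x = 1 ∧ y = 2) ∨ (x = 2 ∧ y = 1))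

/-- Second model peak. -/
def peakD2 : Dgraph (Fin 3) :=
  ofRel (fun x y => (x = 0 ∧ y = 1) ∨ (x = 0 ∧ y = 2))

/-- The model diamond. -/
def diamondD : Dgraph (Fin 4) :=
  ofRel (fun x y => (x = 0 ∧ y = 1) ∨ (x = 0 ∧ y = 2) ∨ (x = 0 ∧ y = 3) ∨
    (x = 1 ∧ y = 2) ∨ (x = 2 ∧ y = 3) ∨ (x = 3 ∧ y = 1))

/-- A flag is a digraph hemimorphic to the model flag. -/
def IsFlag (G : Dgraph V) : Prop := Hemi G flagD

/-- A peak is a digraph hemimorphic to one of the two model peaks. -/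
def IsPeak (G : Dgraph V) : Prop := Hemi G peakD1 ∨ Hemi G peakD2

/-- A diamond is a digraph hemimorphic to the model diamond. -/
def IsDiamond (G : Dgraph V) : Prop := Hemi G diamondD

/-- Prechain: embeds no peak, no diamond, no two adjacent neutral pairs. -/
def IsPrechain (G : Dgraph V) : Prop :=
  (∀ X : Set V, ¬ IsPeak (G.ind X)) ∧ (∀ X : Set V, ¬ IsDiamond (G.ind X)) ∧
  ¬ ∃ x y z : V, y ≠ z ∧ G.Neutral x y ∧ G.Neutral x z

/-- Proper prechain: a prechain which is not a chain. -/
def ProperPrechain (G : Dgraph V) : Prop := G.IsPrechain ∧ ¬ G.IsChainD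

/-- Diamond-free tournament. -/
def DiamondFreeTournament (G : Dgraph V) : Prop :=
  G.IsTournament ∧ ∀ X : Set V, ¬ IsDiamond (G.ind X)

/-- Non-tournament prechain. -/
def NonTournamentPrechain (G : Dgraph V) : Prop := G.IsPrechain ∧ ¬ G.IsTournament

/-- Model finite consecutivity on `n` vertices (`full` decides whether the
non-consecutive pairs are all full or all void). -/
def consecFin (n : ℕ) (full : Bool) : Dgraph (Fin n) :=
  ofRel (fun i j => i.1 + 1 = j.1 ∨ (full = true ∧ (i.1 + 1 < j.1 ∨ j.1 + 1 < i.1)))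

/-- Model consecutivity of type ω. -/
def consecNat (full : Bool) : Dgraph ℕ :=
  ofRel (fun i j => i + 1 = j ∨ (full = true ∧ (i + 1 < j ∨ j + 1 < i)))

/-- Model consecutivity of type ω*+ω. -/
def consecInt (full : Bool) : Dgraph ℤ :=
  ofRel (fun i j => i + 1 = j ∨ (full = true ∧ (i + 1 < j ∨ j + 1 < i)))

/-- One-end infinite consecutivity (obtained from ω or ω*). -/
def OneEndInfiniteConsecutivity (G : Dgraph V) : Prop :=
  ∃ full, Iso G (consecNat full) ∨ Iso G (consecNat full).dual

/-- Consecutivity. -/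
def IsConsecutivity (G : Dgraph V) : Prop :=
  (∃ n, 3 ≤ n ∧ ∃ full, Iso G (consecFin n full)) ∨
  G.OneEndInfiniteConsecutivity ∨ (∃ full, Iso G (consecInt full))

/-- Model cycle on `n ≥ 3` vertices obtained from the finite consecutivity by
replacing the neutral pair `{0, n-1}` by the arc `(n-1, 0)`. -/
def cycleD (n : ℕ) (full : Bool) : Dgraph (Fin n) :=
  ofRel (fun i j => i.1 + 1 = j.1 ∨ (i.1 = n - 1 ∧ j.1 = 0) ∨
    (full = true ∧ (i.1 + 1 < j.1 ∨ j.1 + 1 < i.1) ∧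
      ¬ (i.1 = 0 ∧ j.1 = n - 1) ∧ ¬ (i.1 = n - 1 ∧ j.1 = 0)))

/-- Cycle. -/
def IsCycle (G : Dgraph V) : Prop := ∃ n, 3 ≤ n ∧ ∃ full, Iso G (cycleD n full)

/-- Near-chain: obtained from a chain by exchanging the directed pair formed
by its extremities. -/
def IsNearChain (G : Dgraph V) : Prop :=
  ∃ (H : Dgraph V) (m M : V), H.IsChainD ∧ m ≠ M ∧
    (∀ x, x ≠ m → H.Arc m x) ∧ (∀ x, x ≠ M → H.Arc x M) ∧
    (∀ x y, G.Arc x y ↔ ((H.Arc x y ∧ ¬ (x = m ∧ y = M)) ∨ (x = M ∧ y = m)))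

/-- `{k}`-hypomorphy. -/
def KHypo (k : ℕ) (G G' : Dgraph V) : Prop :=
  ∀ X : Set V, X.Finite → X.ncard = k → Iso (G.ind X) (G'.ind X)

/-- `(≤ k)`-hypomorphy. -/
def LeHypo (k : ℕ) (G G' : Dgraph V) : Prop :=
  ∀ j, 1 ≤ j → j ≤ k → KHypo j G G'

/-- `{k}`-hemimorphy. -/
def KHemi (k : ℕ) (G G' : Dgraph V) : Prop :=
  ∀ X : Set V, X.Finite → X.ncard = k → Hemi (G.ind X) (G'.ind X)

/-- `(≤ k)`-hemimorphy. -/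
def LeHemi (k : ℕ) (G G' : Dgraph V) : Prop :=
  ∀ j, 1 ≤ j → j ≤ k → KHemi j G G'

/-- `(≤ k)`-half-reconstructibility. -/
def HalfRecon (k : ℕ) (G : Dgraph V) : Prop :=
  ∀ G' : Dgraph V, LeHemi k G G' → Hemi G G'

/-- One step of the difference relation. -/
def DiffStep (G G' : Dgraph V) (x y : V) : Prop := G.Arc x y ↔ ¬ G'.Arc x y

/-- The difference relation `𝔇_{G,G'}`. -/
def DiffRel (G G' : Dgraph V) (x y : V) : Prop :=
  x = y ∨ Relation.TransGen (DiffStep G G') x y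

/-- Difference classes: `C ∈ D_{G,G'}`. -/
def DiffClass (G G' : Dgraph V) (C : Set V) : Prop :=
  ∃ x, C = {y | DiffRel G G' x y}

/-- The difference relation has at least two equivalence classes. -/
def AtLeastTwoDiffClasses (G G' : Dgraph V) : Prop :=
  ∃ C₁ C₂ : Set V, DiffClass G G' C₁ ∧ DiffClass G G' C₂ ∧ C₁ ≠ C₂

/-- `C_dual(G)`: the smallest cardinality of a finite set of vertices inducing a
non-self-dual subdigraph (`⊤` if there is none). -/
noncomputable def Cdual (G : Dgraph V) : ℕ∞ :=
  sInf {n : ℕ∞ | ∃ X : Set V, X.Finite ∧ ¬ SelfDual (G.ind X) ∧ n = (X.ncard : ℕ∞)}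

/-- The contracted digraph `G_I` (the vertex `none` plays the role of `I`). -/
def contract (G : Dgraph V) (I : Set V) : Dgraph (Option {x : V // x ∉ I}) where
  Arc := fun a b =>
    match a, b with
    | some x, some y => G.Arc x.1 y.1
    | some x, none => ∃ z ∈ I, G.Arc x.1 z
    | none, some y => ∃ z ∈ I, G.Arc z y.1
    | none, none => False
  irrefl := by
    rintro (_ | ⟨x, hx⟩)
    · simp
    · exact G.irrefl x

/-- There is an isomorphism `f` from `G_I` onto `G'_I` with `f(I) = I`. -/
def ContractIsoFix (G G' : Dgraph V) (I : Set V) : Prop :=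
  ∃ e : Option {x : V // x ∉ I} ≃ Option {x : V // x ∉ I},
    e none = none ∧ ∀ a b, (G.contract I).Arc a b ↔ (G'.contract I).Arc (e a) (e b)

/-- `D` is disjoint from every flag of `G`. -/
def FlagDisjoint (G : Dgraph V) (D : Set V) : Prop :=
  ∀ F : Set V, IsFlag (G.ind F) → D ∩ F = ∅

/-- `D` contains a vertex `a` of a flag `{a,b,c}` of `G` with `b, c ∉ D` and
`{b,c}` the directed pair of the flag. -/
def FlagVertexCond (G : Dgraph V) (D : Set V) : Prop :=
  ∃ a ∈ D, ∃ b c : V, b ∉ D ∧ c ∉ D ∧ IsFlag (G.ind {a, b, c}) ∧ G.Dir b c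

/-- Condition `C_∞`. -/
def CondCinf (G : Dgraph V) : Prop :=
  (∃ I : Set V, I.Infinite ∧ G.IsInterval I ∧ (G.ind I).IsChainD) ∨
  (∃ I J : Set V, I ≠ J ∧ G.IsInterval I ∧ G.IsInterval J ∧
     (G.ind I).OneEndInfiniteConsecutivity ∧ (G.ind J).OneEndInfiniteConsecutivity) ∨
  (∃ I : Set V, G.IsInterval I ∧ (G.ind I).OneEndInfiniteConsecutivity ∧
     (∀ J : Set V, G.IsInterval J → (G.ind J).OneEndInfiniteConsecutivity → J = I) ∧
     ¬ ContractIsoFix G G.dual I)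

/-- The kind of component occurring in conditions `K1` and `K2`. -/
def K12Kind (G : Dgraph V) (D : Set V) : Prop :=
  DiamondFreeTournament (G.ind D) ∨ (NonTournamentPrechain (G.ind D) ∧ G.FlagDisjoint D)

/-- Condition `K1`. -/
def CondK1 (G : Dgraph V) : Prop :=
  G.Cdual = 3 ∧ ∃ D₁ D₂ : Set V, D₁ ≠ D₂ ∧
    (G.IsACComponent D₁ ∧ ¬ SelfDual (G.ind D₁) ∧ G.IsInterval D₁ ∧ G.K12Kind D₁) ∧
    (G.IsACComponent D₂ ∧ ¬ SelfDual (G.ind D₂) ∧ G.IsInterval D₂ ∧ G.K12Kind D₂)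

/-- Condition `K2`. -/
def CondK2 (G : Dgraph V) : Prop :=
  G.Cdual = 3 ∧ ∃ D₀ : Set V, G.IsACComponent D₀ ∧ ¬ SelfDual (G.ind D₀) ∧
    (∀ D, G.IsACComponent D → ¬ SelfDual (G.ind D) → D = D₀) ∧
    G.K12Kind D₀ ∧ ¬ ContractIsoFix G G.dual D₀

/-- Condition `K3`. -/
def CondK3 (G : Dgraph V) : Prop :=
  G.Cdual = 4 ∧ ∃ D₁ D₂ : Set V, D₁ ≠ D₂ ∧
    (G.IsACComponent D₁ ∧ ¬ SelfDual (G.ind D₁) ∧ G.IsInterval D₁) ∧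
    (G.IsACComponent D₂ ∧ ¬ SelfDual (G.ind D₂) ∧ G.IsInterval D₂)

/-- Condition `K4`. -/
def CondK4 (G : Dgraph V) : Prop :=
  G.Cdual = 5 ∧ ∃ D₁ D₂ : Set V, D₁ ≠ D₂ ∧
    (G.IsACComponent D₁ ∧ ¬ SelfDual (G.ind D₁) ∧ G.IsInterval D₁ ∧ IsPrechain (G.ind D₁)) ∧
    (G.IsACComponent D₂ ∧ ¬ SelfDual (G.ind D₂) ∧ G.IsInterval D₂ ∧ IsPrechain (G.ind D₂))

/-- Condition `K5`. -/
def CondK5 (G : Dgraph V) : Prop :=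
  G.Cdual = 6 ∧ ∃ D₁ D₂ : Set V, D₁ ≠ D₂ ∧
    (G.IsACComponent D₁ ∧ ¬ SelfDual (G.ind D₁) ∧ G.IsInterval D₁ ∧
      DiamondFreeTournament (G.ind D₁)) ∧
    (G.IsACComponent D₂ ∧ ¬ SelfDual (G.ind D₂) ∧ G.IsInterval D₂ ∧
      DiamondFreeTournament (G.ind D₂))

/-- The kind of interval occurring in conditions `L1` and `L2`. -/
def L12Int (G : Dgraph V) (I : Set V) : Prop :=
  G.IsInterval I ∧ DiamondFreeTournament (G.ind I) ∧ ¬ SelfDual (G.ind I) ∧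
    ¬ G.IsACComponent I

/-- Condition `L1`. -/
def CondL1 (G : Dgraph V) : Prop :=
  ∃ I₁ I₂ : Set V, I₁ ≠ I₂ ∧ G.L12Int I₁ ∧ G.L12Int I₂

/-- Condition `L2`. -/
def CondL2 (G : Dgraph V) : Prop :=
  ∃ I₀ : Set V, G.L12Int I₀ ∧ (∀ I, G.L12Int I → I = I₀) ∧ ¬ ContractIsoFix G G.dual I₀

/-- Condition `L3`. -/
def CondL3 (G : Dgraph V) : Prop :=
  G.Cdual = 3 ∧ ∃ D₁ D₂ : Set V, D₁ ≠ D₂ ∧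
    (G.IsACComponent D₁ ∧ ¬ SelfDual (G.ind D₁) ∧ G.IsInterval D₁) ∧
    (G.IsACComponent D₂ ∧ ¬ SelfDual (G.ind D₂) ∧ G.IsInterval D₂) ∧
    ((G.FlagDisjoint D₁ ∧ Cdual (G.ind D₁) = 4 ∧ G.FlagDisjoint D₂ ∧ Cdual (G.ind D₂) = 4) ∨
     (NonTournamentPrechain (G.ind D₁) ∧ G.FlagVertexCond D₁ ∧
      NonTournamentPrechain (G.ind D₂) ∧ G.FlagVertexCond D₂))

/-- Condition `L4`. -/
def CondL4 (G : Dgraph V) : Prop :=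
  G.Cdual = 3 ∧ ∃ D₀ : Set V, G.IsACComponent D₀ ∧ ¬ SelfDual (G.ind D₀) ∧
    (∀ D, G.IsACComponent D → ¬ SelfDual (G.ind D) → D = D₀) ∧
    G.IsInterval D₀ ∧
    ((G.FlagDisjoint D₀ ∧ Cdual (G.ind D₀) = 4) ∨
     (NonTournamentPrechain (G.ind D₀) ∧ G.FlagVertexCond D₀)) ∧
    ¬ ContractIsoFix G G.dual D₀

end Dgraph

open Dgraph

namespace Dgraph

variable {V : Type u}

/-! Isomorphisms between induced subdigraphs of digraphs on a common vertex type. -/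

/-- `G[X]` is isomorphic to `H[Y]`, witnessed by a map defined on all vertices. -/
def IsoOn (G H : Dgraph V) (X Y : Set V) : Prop :=
  ∃ f : V → V, Set.BijOn f X Y ∧ ∀ x ∈ X, ∀ y ∈ X, (G.Arc x y ↔ H.Arc (f x) (f y))

theorem isoOn_iff_iso {G H : Dgraph V} {X Y : Set V} :
    IsoOn G H X Y ↔ Iso (G.ind X) (H.ind Y) := by
  classical
  constructor
  · rintro ⟨f, hf, h⟩
    exact ⟨hf.equiv f, fun x y => h x x.2 y y.2⟩
  · rintro ⟨e, he⟩
    refine ⟨fun x => if hx : x ∈ X then (e ⟨x, hx⟩ : V) else x, ⟨?_, ?_, ?_⟩, ?_⟩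
    · intro x hx
      simp [hx]
    · intro x hx y hy hxy
      simp only [hx, hy, dif_pos] at hxy
      have := e.injective (Subtype.ext hxy)
      exact congrArg Subtype.val this
    · intro y hy
      refine ⟨(e.symm ⟨y, hy⟩ : X), (e.symm ⟨y, hy⟩).2, ?_⟩
      simp
    · intro x hx y hy
      simp only [hx, hy, dif_pos]
      exact he ⟨x, hx⟩ ⟨y, hy⟩

theorem isoOn_univ_iff {G H : Dgraph V} : IsoOn G H Set.univ Set.univ ↔ Iso G H := by
  constructor
  · rintro ⟨f, hf, h⟩
    refine ⟨Equiv.ofBijective f (Set.bijOn_univ.1 hf), fun x y => h x trivial y trivial⟩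
  · rintro ⟨e, he⟩
    exact ⟨e, Set.bijOn_univ.2 e.bijective, fun x _ y _ => he x y⟩

theorem IsoOn.of_eq {G H : Dgraph V} {X : Set V}
    (h : ∀ x ∈ X, ∀ y ∈ X, (G.Arc x y ↔ H.Arc x y)) : IsoOn G H X X :=
  ⟨id, Set.bijOn_id X, h⟩

theorem IsoOn.symm {G H : Dgraph V} {X Y : Set V} (h : IsoOn G H X Y) : IsoOn H G Y X := by
  rw [isoOn_iff_iso] at *
  obtain ⟨e, he⟩ := h
  exact ⟨e.symm, fun x y => by simpa using (he (e.symm x) (e.symm y)).symm⟩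

theorem IsoOn.trans {G H K : Dgraph V} {X Y Z : Set V} (h : IsoOn G H X Y)
    (h' : IsoOn H K Y Z) : IsoOn G K X Z := by
  rw [isoOn_iff_iso] at *
  obtain ⟨e, he⟩ := h
  obtain ⟨e', he'⟩ := h'
  exact ⟨e.trans e', fun x y => (he x y).trans (he' _ _)⟩

theorem IsoOn.dual {G H : Dgraph V} {X Y : Set V} (h : IsoOn G H X Y) :
    IsoOn G.dual H.dual X Y := by
  obtain ⟨f, hf, h⟩ := h
  exact ⟨f, hf, fun x hx y hy => h y hy x hx⟩

theorem Iso.refl {V : Type*} (G : Dgraph V) : Iso G G := ⟨Equiv.refl V, fun _ _ => Iff.rfl⟩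

theorem Iso.symm {V W : Type*} {G : Dgraph V} {H : Dgraph W} (h : Iso G H) : Iso H G := by
  obtain ⟨e, he⟩ := h
  exact ⟨e.symm, fun x y => by simpa using (he (e.symm x) (e.symm y)).symm⟩

theorem Iso.trans {V W U : Type*} {G : Dgraph V} {H : Dgraph W} {K : Dgraph U} (h : Iso G H)
    (h' : Iso H K) : Iso G K := by
  obtain ⟨e, he⟩ := h
  obtain ⟨e', he'⟩ := h'
  exact ⟨e.trans e', fun x y => (he x y).trans (he' _ _)⟩

theorem Iso.dual {V W : Type*} {G : Dgraph V} {H : Dgraph W} (h : Iso G H) :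
    Iso G.dual H.dual := by
  obtain ⟨e, he⟩ := h
  exact ⟨e, fun x y => he y x⟩

theorem Hemi.symm {V W : Type*} {G : Dgraph V} {H : Dgraph W} (h : Hemi G H) : Hemi H G :=
  h.elim (fun h => .inl h.symm) (fun h => .inr (Iso.symm h).dual.symm.symm)

theorem Hemi.trans {V W U : Type*} {G : Dgraph V} {H : Dgraph W} {K : Dgraph U} (h : Hemi G H)
    (h' : Hemi H K) : Hemi G K := by
  rcases h with h | h <;> rcases h' with h' | h'
  · exact .inl (h.trans h')
  · exact .inr (h.dual.trans h')
  · exact .inr (h.trans h')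
  · exact .inl (Iso.trans h.dual h')

theorem Hemi.dual_right {V W : Type*} {G : Dgraph V} {H : Dgraph W} (h : Hemi G H) :
    Hemi G H.dual :=
  h.elim (fun h => .inr h.dual) (fun h => .inl h.dual)

theorem LeHemi.of_isoOn {G H : Dgraph V} (k : ℕ)
    (h : ∀ X : Set V, X.Finite → IsoOn G H X X) : LeHemi k G H :=
  fun _ _ _ X hX _ => .inl (isoOn_iff_iso.1 (h X hX))

/-- Isomorphisms between the traces of the classes of an equivalence relation may be glued. -/
theorem IsoOn.glue {G H : Dgraph V} {X : Set V} (r : V → V → Prop) (hr : Equivalence r)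
    (hin : ∀ x ∈ X, IsoOn G H (X ∩ {y | r x y}) (X ∩ {y | r x y}))
    (hout : ∀ x ∈ X, ∀ y ∈ X, ∀ x' ∈ X, ∀ y' ∈ X, ¬ r x y → r x x' → r y y' →
      (G.Arc x y ↔ H.Arc x' y')) : IsoOn G H X X := by
  classical
  let S : Setoid V := ⟨r, hr⟩
  have hcls : ∀ q : Quotient S, ∃ f : V → V,
      Set.BijOn f (X ∩ {y | (⟦y⟧ : Quotient S) = q}) (X ∩ {y | (⟦y⟧ : Quotient S) = q}) ∧
      ∀ x ∈ X ∩ {y | (⟦y⟧ : Quotient S) = q}, ∀ y ∈ X ∩ {y | (⟦y⟧ : Quotient S) = q},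
        (G.Arc x y ↔ H.Arc (f x) (f y)) := by
    intro q
    by_cases hq : ∃ x ∈ X, (⟦x⟧ : Quotient S) = q
    · obtain ⟨x, hx, rfl⟩ := hq
      have : {y | (⟦y⟧ : Quotient S) = ⟦x⟧} = {y | r x y} := by
        ext y
        simp only [Set.mem_ofPred_eq]
        exact Quotient.eq.trans ⟨fun h => hr.symm h, fun h => hr.symm h⟩
      rw [this]
      exact hin x hx
    · have : X ∩ {y | (⟦y⟧ : Quotient S) = q} = ∅ := by
        ext y
        simp only [Set.mem_inter_iff, Set.mem_ofPred_eq, Set.mem_empty_iff_false, iff_false]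
        exact fun h => hq ⟨y, h.1, h.2⟩
      rw [this]
      exact ⟨id, Set.bijOn_empty _, by simp⟩
  choose f hf hfa using hcls
  have hmem : ∀ x ∈ X, f ⟦x⟧ x ∈ X ∧ (⟦f ⟦x⟧ x⟧ : Quotient S) = ⟦x⟧ :=
    fun x hx => (hf ⟦x⟧).mapsTo ⟨hx, rfl⟩
  refine ⟨fun x => f ⟦x⟧ x, ⟨fun x hx => (hmem x hx).1, ?_, ?_⟩, ?_⟩
  · intro x hx y hy hxy
    have hq : (⟦x⟧ : Quotient S) = ⟦y⟧ := by
      rw [← (hmem x hx).2, ← (hmem y hy).2]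
      exact congrArg _ hxy
    have hxy' : f ⟦x⟧ x = f ⟦x⟧ y := by
      have : f ⟦x⟧ x = f ⟦y⟧ y := hxy
      rwa [← hq] at this
    exact (hf ⟦x⟧).injOn ⟨hx, rfl⟩ ⟨hy, hq.symm⟩ hxy'
  · intro y hy
    obtain ⟨x, hx, hxy⟩ := (hf ⟦y⟧).surjOn (show y ∈ _ from ⟨hy, rfl⟩)
    refine ⟨x, hx.1, ?_⟩
    have : (⟦x⟧ : Quotient S) = ⟦y⟧ := hx.2
    simp only [this, hxy]
  · intro x hx y hy
    by_cases hxy : (⟦x⟧ : Quotient S) = ⟦y⟧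
    · simp only [← hxy]
      exact hfa ⟦x⟧ x ⟨hx, rfl⟩ y ⟨hy, hxy.symm⟩
    · refine hout x hx y hy _ (hmem x hx).1 _ (hmem y hy).1 (fun h => hxy (Quotient.sound h)) ?_ ?_
      · exact hr.symm (Quotient.exact (hmem x hx).2)
      · exact hr.symm (Quotient.exact (hmem y hy).2)

/-! Backtracking search for permutations of an initial segment of `ℕ`. -/

/-- Bounded existential quantification, as a Boolean. -/
def anyLT : ℕ → (ℕ → Bool) → Bool
  | 0, _ => false
  | n + 1, p => p n || anyLT n p

/-- Bounded universal quantification, as a Boolean. -/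
def allLT : ℕ → (ℕ → Bool) → Bool
  | 0, _ => true
  | n + 1, p => p n && allLT n p

theorem anyLT_iff {n : ℕ} {p : ℕ → Bool} : anyLT n p = true ↔ ∃ i < n, p i = true := by
  induction n with
  | zero => simp [anyLT]
  | succ n ih =>
    simp only [anyLT, Bool.or_eq_true, ih]
    constructor
    · rintro (h | ⟨i, hi, h⟩)
      · exact ⟨n, by omega, h⟩
      · exact ⟨i, by omega, h⟩
    · rintro ⟨i, hi, h⟩
      rcases Nat.lt_succ_iff_lt_or_eq.1 hi with hi | rfl
      · exact .inr ⟨i, hi, h⟩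
      · exact .inl h

theorem allLT_iff {n : ℕ} {p : ℕ → Bool} : allLT n p = true ↔ ∀ i < n, p i = true := by
  induction n with
  | zero => simp [allLT]
  | succ n ih =>
    simp only [allLT, Bool.and_eq_true, ih]
    constructor
    · rintro ⟨h, h'⟩ i hi
      rcases Nat.lt_succ_iff_lt_or_eq.1 hi with hi | rfl
      · exact h' i hi
      · exact h
    · intro h
      exact ⟨h n (by omega), fun i hi => h i (by omega)⟩

/-- Extends the partial injection `a`, defined below `i`, to `n` more arguments. -/
def permSearch (P : ℕ → ℕ → ℕ → ℕ → Bool) (k : ℕ) : ℕ → ℕ → (ℕ → ℕ) → Bool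
  | 0, _, _ => true
  | n + 1, i, a => anyLT k fun x =>
      allLT i (fun j => !(Nat.beq (a j) x) && P i j x (a j)) &&
      permSearch P k n (i + 1) (fun j => bif Nat.beq j i then x else a j)

theorem natBeq_eq_false_iff {a b : ℕ} : Nat.beq a b = false ↔ a ≠ b := by
  rw [← Bool.not_eq_true, Nat.beq_eq]

theorem permSearch_iff_aux {P : ℕ → ℕ → ℕ → ℕ → Bool} {k : ℕ} (n i : ℕ) (a : ℕ → ℕ) :
    permSearch P k n i a = true ↔ ∃ f : ℕ → ℕ, (∀ j < i, f j = a j) ∧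
      ∀ j, i ≤ j → j < i + n →
        f j < k ∧ ∀ l < j, f l ≠ f j ∧ P j l (f j) (f l) = true := by
  induction n generalizing i a with
  | zero => exact ⟨fun _ => ⟨a, fun _ _ => rfl, fun j h h' => by omega⟩, fun _ => rfl⟩
  | succ n ih =>
    simp only [permSearch, anyLT_iff, Bool.and_eq_true, allLT_iff, ih]
    constructor
    · rintro ⟨x, hx, h1, f, hf, h2⟩
      have hfi : f i = x := by simpa using hf i (by omega)
      have hfj : ∀ j < i, f j = a j := fun j hj => by
        have := hf j (by omega)
        have hne : Nat.beq j i = false := by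
          rw [natBeq_eq_false_iff]; omega
        simpa [hne] using this
      refine ⟨f, hfj, fun j hj hj' => ?_⟩
      rcases hj.eq_or_lt with rfl | hlt
      · refine ⟨hfi ▸ hx, fun l hl => ?_⟩
        have := h1 l hl
        rw [hfi, hfj l hl]
        refine ⟨?_, this.2⟩
        have h3 := this.1
        simp only [Bool.not_eq_true', natBeq_eq_false_iff] at h3
        exact h3
      · exact h2 j (by omega) (by omega)
    · rintro ⟨f, hf, h⟩
      refine ⟨f i, (h i le_rfl (by omega)).1, fun j hj => ?_, f, fun j hj => ?_, fun j hj hj' => ?_⟩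
      · have := (h i le_rfl (by omega)).2 j hj
        rw [← hf j hj]
        refine ⟨?_, this.2⟩
        simp only [Bool.not_eq_true', natBeq_eq_false_iff]
        exact this.1
      · rcases Nat.lt_succ_iff_lt_or_eq.1 hj with hj | rfl
        · have hne : Nat.beq j i = false := by
            rw [natBeq_eq_false_iff]; omega
          simp [hne, hf j hj]
        · simp
      · exact h j (by omega) (by omega)

theorem permSearch_iff {P : ℕ → ℕ → ℕ → ℕ → Bool} {k : ℕ} :
    permSearch P k k 0 (fun _ => 0) = true ↔ ∃ f : ℕ → ℕ,
      ∀ j < k, f j < k ∧ ∀ l < j, f l ≠ f j ∧ P j l (f j) (f l) = true := by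
  rw [permSearch_iff_aux]
  simp


/-! The type of a pair of vertices in a pair of digraphs whose directed pairs coincide.

The types are `0` (void), `1` (full), `2` and `3` (directed forwards and backwards, in the same way
in both digraphs), `4` and `5` (directed forwards and backwards in the first digraph, reversed in
the second one). -/

/-- The type of the reversed pair. -/
def pairFlip : ℕ → ℕ
  | 2 => 3
  | 3 => 2
  | 4 => 5
  | 5 => 4
  | n => n

/-- The relation between two vertices in the first digraph. -/
def pairFst : ℕ → ℕ
  | 0 => 0
  | 1 => 3
  | 2 => 1
  | 3 => 2
  | 4 => 1
  | _ => 2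

/-- The relation between two vertices in the second digraph. -/
def pairSnd : ℕ → ℕ
  | 0 => 0
  | 1 => 3
  | 2 => 1
  | 3 => 2
  | 4 => 2
  | _ => 1

/-- Entry of a table given by its rows. -/
def entry (t : List (List ℕ)) (i j : ℕ) : ℕ := (t.getD i []).getD j 0

/-- Hemimorphy of the two digraphs encoded by a table of types on `k` vertices. -/
def hemiTest (k : ℕ) (T : ℕ → ℕ → ℕ) : Bool :=
  permSearch (fun i j x y => Nat.beq (pairFst (T i j)) (pairSnd (T x y))) k k 0 (fun _ => 0) ||
  permSearch (fun i j x y => Nat.beq (pairFst (T j i)) (pairSnd (T x y))) k k 0 (fun _ => 0)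

/-- Hemimorphy of all subdigraphs whose number of vertices belongs to `lv`. -/
def hemiLevels (lv : List ℕ) (t : List (List ℕ)) : Bool :=
  lv.all fun k => (List.sublistsLen k (List.range t.length)).all fun l =>
    hemiTest k (fun i j => entry t (l.getD i 0) (l.getD j 0))

/-- A system of pair types all of whose restrictions to at most six vertices are hemimorphic. -/
structure Good (c : V → V → ℕ) : Prop where
  flip : ∀ u v, c v u = pairFlip (c u v)
  diag : ∀ u, c u u = 0
  lt : ∀ u v, c u v < 6
  test : ∀ v : ℕ → V, ∀ k ≤ 6, (∀ i < k, ∀ j < i, v j ≠ v i) →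
    hemiTest k (fun i j => c (v i) (v j)) = true

open Classical in
/-- The type of a pair of vertices of two digraphs. -/
noncomputable def code (G H : Dgraph V) (u v : V) : ℕ :=
  if G.Arc u v then (if G.Arc v u then 1 else if H.Arc u v then 2 else 4)
  else if G.Arc v u then (if H.Arc v u then 3 else 5) else 0

theorem Iso.exists_index {G H : Dgraph V} {k : ℕ} {v : ℕ → V}
    (hv : ∀ i < k, ∀ j < i, v j ≠ v i)
    (h : IsoOn G H (v '' Set.Iio k) (v '' Set.Iio k)) :
    ∃ f : ℕ → ℕ, ∀ j < k, f j < k ∧ ∀ l < j, f l ≠ f j ∧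
      (G.Arc (v j) (v l) ↔ H.Arc (v (f j)) (v (f l))) ∧
      (G.Arc (v l) (v j) ↔ H.Arc (v (f l)) (v (f j))) := by
  obtain ⟨φ, hφ, ha⟩ := h
  have hm : ∀ j, ∃ i, j < k → i < k ∧ v i = φ (v j) := by
    intro j
    by_cases hj : j < k
    · obtain ⟨i, hi, he⟩ := hφ.mapsTo (Set.mem_image_of_mem v (show j ∈ Set.Iio k from hj))
      exact ⟨i, fun _ => ⟨hi, he⟩⟩
    · exact ⟨0, fun h => absurd h hj⟩
  choose f hf using hm
  refine ⟨f, fun j hj => ⟨(hf j hj).1, fun l hl => ?_⟩⟩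
  have hj' : v j ∈ v '' Set.Iio k := Set.mem_image_of_mem v hj
  have hl' : v l ∈ v '' Set.Iio k := Set.mem_image_of_mem v (show l < k by omega)
  refine ⟨fun he => hv j hj l hl ?_, ?_, ?_⟩
  · apply hφ.injOn hl' hj'
    rw [← (hf j hj).2, ← (hf l (by omega)).2, he]
  · rw [(hf j hj).2, (hf l (by omega)).2]
    exact ha _ hj' _ hl'
  · rw [(hf j hj).2, (hf l (by omega)).2]
    exact ha _ hl' _ hj'

theorem LeHemi.isoOn {k j : ℕ} {G H : Dgraph V} (h : LeHemi k G H) (hj : j ≤ k) {X : Set V}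
    (hX : X.Finite) (hXj : X.ncard = j) : IsoOn G H X X ∨ IsoOn G.dual H X X := by
  rcases Nat.eq_zero_or_pos j with rfl | hpos
  · rw [Set.ncard_eq_zero hX] at hXj
    subst hXj
    exact .inl ⟨id, Set.bijOn_empty _, by simp⟩
  · exact (h j hpos hj X hX hXj).imp isoOn_iff_iso.2 isoOn_iff_iso.2

theorem LeHemi.exists_index {m k : ℕ} {G H : Dgraph V} (h : LeHemi m G H) (hk : k ≤ m) {v : ℕ → V}
    (hv : ∀ i < k, ∀ j < i, v j ≠ v i) :
    ∃ f : ℕ → ℕ, (∀ j < k, f j < k ∧ ∀ l < j, f l ≠ f j) ∧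
      ((∀ j < k, ∀ l < j, (G.Arc (v j) (v l) ↔ H.Arc (v (f j)) (v (f l))) ∧
        (G.Arc (v l) (v j) ↔ H.Arc (v (f l)) (v (f j)))) ∨
      (∀ j < k, ∀ l < j, (G.Arc (v l) (v j) ↔ H.Arc (v (f j)) (v (f l))) ∧
        (G.Arc (v j) (v l) ↔ H.Arc (v (f l)) (v (f j))))) := by
  have hinj : Set.InjOn v (Set.Iio k) := by
    intro i hi j hj he
    rcases lt_trichotomy i j with hij | hij | hij
    · exact absurd he (hv j hj i hij)
    · exact hij
    · exact absurd he.symm (hv i hi j hij)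
  have hcard : (v '' Set.Iio k).ncard = k := by
    rw [hinj.ncard_image, ← Nat.card_coe_set_eq]
    simp
  rcases h.isoOn hk ((Set.finite_Iio k).image v) hcard with h | h
  · obtain ⟨f, hf⟩ := Iso.exists_index hv h
    exact ⟨f, fun j hj => ⟨(hf j hj).1, fun l hl => ((hf j hj).2 l hl).1⟩,
      .inl fun j hj l hl => ((hf j hj).2 l hl).2⟩
  · obtain ⟨f, hf⟩ := Iso.exists_index hv h
    exact ⟨f, fun j hj => ⟨(hf j hj).1, fun l hl => ((hf j hj).2 l hl).1⟩,
      .inr fun j hj l hl => ((hf j hj).2 l hl).2⟩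

theorem LeHemi.pair {m : ℕ} {G H : Dgraph V} (h : LeHemi m G H) (hm : 2 ≤ m) {x y : V}
    (hxy : x ≠ y) :
    ((G.Arc x y ∧ G.Arc y x) ↔ (H.Arc x y ∧ H.Arc y x)) ∧
    ((G.Arc x y ∨ G.Arc y x) ↔ (H.Arc x y ∨ H.Arc y x)) := by
  obtain ⟨f, hf, ha⟩ := h.exists_index (k := 2) hm (v := fun i => if i = 0 then x else y) (by
    intro i hi j hj
    have : i = 1 := by omega
    have : j = 0 := by omega
    subst_vars
    simpa using hxy)
  have h1 := hf 1 (by omega)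
  have h0 := hf 0 (by omega)
  have h2 := h1.2 0 (by omega)
  have h3 : (f 0 = 0 ∧ f 1 = 1) ∨ (f 0 = 1 ∧ f 1 = 0) := by omega
  rcases ha with ha | ha <;> have := ha 1 (by omega) 0 (by omega) <;>
    rcases h3 with ⟨h4, h5⟩ | ⟨h4, h5⟩ <;> simp only [h4, h5] at this <;>
    simp at this <;> tauto

theorem pairFst_code_eq (G H : Dgraph V) (u v : V) :
    (pairFst (code G H u v) = 0 ↔ ¬ G.Arc u v ∧ ¬ G.Arc v u) ∧
    (pairFst (code G H u v) = 1 ↔ G.Arc u v ∧ ¬ G.Arc v u) ∧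
    (pairFst (code G H u v) = 2 ↔ ¬ G.Arc u v ∧ G.Arc v u) ∧
    (pairFst (code G H u v) = 3 ↔ G.Arc u v ∧ G.Arc v u) := by
  unfold code
  split_ifs <;> simp_all [pairFst]

theorem pairSnd_code_eq {G H : Dgraph V} {m : ℕ} (h : LeHemi m G H) (hm : 2 ≤ m) {u v : V} :
    (pairSnd (code G H u v) = 0 ↔ ¬ H.Arc u v ∧ ¬ H.Arc v u) ∧
    (pairSnd (code G H u v) = 1 ↔ H.Arc u v ∧ ¬ H.Arc v u) ∧
    (pairSnd (code G H u v) = 2 ↔ ¬ H.Arc u v ∧ H.Arc v u) ∧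
    (pairSnd (code G H u v) = 3 ↔ H.Arc u v ∧ H.Arc v u) := by
  by_cases huv : u = v
  · subst huv
    have := H.irrefl u
    have := G.irrefl u
    simp_all [code, pairSnd]
  have := h.pair hm huv
  unfold code
  split_ifs <;> simp_all [pairSnd]

theorem code_lt (G H : Dgraph V) (u v : V) : code G H u v < 6 := by
  unfold code
  split_ifs <;> omega

theorem code_flip (G H : Dgraph V) (u v : V) : code G H v u = pairFlip (code G H u v) := by
  unfold code
  split_ifs <;> simp_all [pairFlip]

theorem pairFst_lt (n : ℕ) : pairFst n < 4 := by
  unfold pairFst; split <;> omega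

theorem pairFst_eq_pairSnd_of {G H : Dgraph V} (hp : LeHemi 6 G H) {a b x y : V}
    (h1 : G.Arc a b ↔ H.Arc x y) (h2 : G.Arc b a ↔ H.Arc y x) :
    pairFst (code G H a b) = pairSnd (code G H x y) := by
  have e := pairFst_code_eq G H a b
  have e' := pairSnd_code_eq hp (by omega) (u := x) (v := y)
  have hlt := pairFst_lt (code G H a b)
  rw [← h1, ← h2] at e'
  rcases (by omega : pairFst (code G H a b) = 0 ∨ pairFst (code G H a b) = 1 ∨
      pairFst (code G H a b) = 2 ∨ pairFst (code G H a b) = 3) with h | h | h | h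
  · rw [h, e'.1.2 (e.1.1 h)]
  · rw [h, e'.2.1.2 (e.2.1.1 h)]
  · rw [h, e'.2.2.1.2 (e.2.2.1.1 h)]
  · rw [h, e'.2.2.2.2 (e.2.2.2.1 h)]

theorem LeHemi.good {G H : Dgraph V} (h : LeHemi 6 G H) : Good (code G H) where
  flip u v := code_flip G H u v
  diag u := by simp [code, G.irrefl]
  lt := code_lt G H
  test v k hk hv := by
    obtain ⟨f, hf, ha⟩ := h.exists_index hk hv
    simp only [hemiTest, Bool.or_eq_true, permSearch_iff]
    refine ha.imp (fun ha => ⟨f, fun j hj => ⟨(hf j hj).1, fun l hl => ⟨(hf j hj).2 l hl, ?_⟩⟩⟩)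
      (fun ha => ⟨f, fun j hj => ⟨(hf j hj).1, fun l hl => ⟨(hf j hj).2 l hl, ?_⟩⟩⟩)
    · rw [Nat.beq_eq]
      exact pairFst_eq_pairSnd_of h (ha j hj l hl).1 (ha j hj l hl).2
    · rw [Nat.beq_eq]
      exact pairFst_eq_pairSnd_of h (ha j hj l hl).1 (ha j hj l hl).2

/-- Exchange of the pairs on which the two digraphs agree with those on which they differ. -/
def pairSwap : ℕ → ℕ
  | 2 => 4
  | 3 => 5
  | 4 => 2
  | 5 => 3
  | n => n

theorem Good.hemiLevels {c : V → V → ℕ} (hc : Good c) (lv : List ℕ) (vs : List V)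
    (hvs : vs.Nodup) (hlen : vs.length ≤ 6) :
    hemiLevels lv (vs.map fun u => vs.map (c u)) = true := by
  rcases vs with _ | ⟨a, t⟩
  · simp only [Dgraph.hemiLevels, List.all_eq_true, List.map_nil, List.length_nil, List.range_zero]
    intro k _ l hl
    rw [List.mem_sublistsLen] at hl
    obtain ⟨h1, rfl⟩ := hl
    rw [List.sublist_nil] at h1
    subst h1
    rfl
  set vs := a :: t
  simp only [Dgraph.hemiLevels, List.all_eq_true]
  intro k _ l hl
  rw [List.mem_sublistsLen, List.length_map] at hl
  obtain ⟨h1, hlk⟩ := hl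
  have hk : k ≤ vs.length := by
    have := h1.length_le
    rw [List.length_range] at this
    omega
  have hnd : l.Nodup := List.nodup_range.sublist h1
  have hmem : ∀ i < k, l.getD i 0 < vs.length := by
    intro i hi
    rw [List.getD_eq_getElem _ _ (by omega)]
    exact List.mem_range.1 (h1.subset (List.getElem_mem _))
  have ht := hc.test (fun i => vs.getD (l.getD i 0) a) k (by omega) (by
    intro i hi j hj he
    have hi' := hmem i hi
    have hj' := hmem j (by omega)
    simp only [List.getD_eq_getElem _ _ hi', List.getD_eq_getElem _ _ hj'] at he
    have := (List.Nodup.getElem_inj_iff hvs).1 he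
    rw [List.getD_eq_getElem _ _ (by omega), List.getD_eq_getElem _ _ (by omega)] at this
    have := (List.Nodup.getElem_inj_iff hnd).1 this
    omega)
  have key : ∀ i < k, ∀ j < k,
      entry (vs.map fun u => vs.map (c u)) (l.getD i 0) (l.getD j 0) =
        c (vs.getD (l.getD i 0) a) (vs.getD (l.getD j 0) a) := by
    intro i hi j hj
    have hi' := hmem i hi
    have hj' := hmem j hj
    have h1 : (vs.map fun u => vs.map (c u)).getD (l.getD i 0) [] =
        vs.map (c (vs.getD (l.getD i 0) a)) := by
      rw [List.getD_eq_getElem _ _ (by rw [List.length_map]; exact hi'), List.getElem_map,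
        List.getD_eq_getElem _ _ hi']
    rw [entry, h1, List.getD_eq_getElem _ _ (by rw [List.length_map]; exact hj'),
      List.getElem_map, List.getD_eq_getElem _ _ hj']
  simp only [hemiTest, Bool.or_eq_true, permSearch_iff] at ht ⊢
  refine ht.imp (fun ⟨f, hf⟩ => ⟨f, fun j hj => ⟨(hf j hj).1, fun l hl => ?_⟩⟩)
    (fun ⟨f, hf⟩ => ⟨f, fun j hj => ⟨(hf j hj).1, fun l hl => ?_⟩⟩)
  · rw [key j hj l (by omega), key (f j) (hf j hj).1 (f l) (hf l (by omega)).1]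
    exact (hf j hj).2 l hl
  · rw [key l (by omega) j hj, key (f j) (hf j hj).1 (f l) (hf l (by omega)).1]
    exact (hf j hj).2 l hl


/-! Constraints on small configurations. -/

/-- The table on three vertices with the given entries above the diagonal. -/
def table3 (x01 x02 x12 : ℕ) : List (List ℕ) :=
  [[0, x01, x02], [pairFlip x01, 0, x12], [pairFlip x02, pairFlip x12, 0]]

/-- The table on four vertices with the given entries above the diagonal. -/
def table4 (x01 x02 x03 x12 x13 x23 : ℕ) : List (List ℕ) :=
  [[0, x01, x02, x03], [pairFlip x01, 0, x12, x13], [pairFlip x02, pairFlip x12, 0, x23],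
    [pairFlip x03, pairFlip x13, pairFlip x23, 0]]

/-- The table on five vertices with the given entries above the diagonal. -/
def table5 (x01 x02 x03 x04 x12 x13 x14 x23 x24 x34 : ℕ) : List (List ℕ) :=
  [[0, x01, x02, x03, x04], [pairFlip x01, 0, x12, x13, x14],
    [pairFlip x02, pairFlip x12, 0, x23, x24], [pairFlip x03, pairFlip x13, pairFlip x23, 0, x34],
    [pairFlip x04, pairFlip x14, pairFlip x24, pairFlip x34, 0]]

/-- The table on six vertices with the given entries above the diagonal. -/
def table6 (x01 x02 x03 x04 x05 x12 x13 x14 x15 x23 x24 x25 x34 x35 x45 : ℕ) : List (List ℕ) :=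
  [[0, x01, x02, x03, x04, x05], [pairFlip x01, 0, x12, x13, x14, x15],
    [pairFlip x02, pairFlip x12, 0, x23, x24, x25],
    [pairFlip x03, pairFlip x13, pairFlip x23, 0, x34, x35],
    [pairFlip x04, pairFlip x14, pairFlip x24, pairFlip x34, 0, x45],
    [pairFlip x05, pairFlip x15, pairFlip x25, pairFlip x35, pairFlip x45, 0]]

theorem mem_neutral {n : ℕ} (h : n / 2 = 0) : n ∈ [0, 1] := by
  simp; omega

theorem mem_red {n : ℕ} (h : n / 2 = 1) : n ∈ [2, 3] := by
  simp; omega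

theorem mem_blue {n : ℕ} (h : n / 2 = 2) : n ∈ [4, 5] := by
  simp; omega

theorem mem_forward {n : ℕ} (h : n = 2 ∨ n = 4) : n ∈ [2, 4] := by
  simpa using h

section Good

variable {c : V → V → ℕ}

theorem Good.mem (hc : Good c) (u v : V) : c u v ∈ [0, 1, 2, 3, 4, 5] := by
  have := hc.lt u v
  simp; omega

theorem Good.mem_directed (hc : Good c) {u v : V} (h : c u v / 2 ≠ 0) : c u v ∈ [2, 3, 4, 5] := by
  have := hc.lt u v
  simp; omega

theorem Good.ne (hc : Good c) {u v : V} (h : c u v / 2 ≠ 0) : u ≠ v := by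
  rintro rfl
  rw [hc.diag] at h
  exact h rfl

theorem Good.table3 (hc : Good c) (lv : List ℕ) (x y z : V) (h : [x, y, z].Nodup) :
    Dgraph.hemiLevels lv (Dgraph.table3 (c x y) (c x z) (c y z)) = true := by
  have := hc.hemiLevels lv [x, y, z] h (by simp)
  simp only [Dgraph.table3, ← hc.flip]
  simpa only [List.map_cons, List.map_nil, hc.diag] using this

theorem Good.table4 (hc : Good c) (lv : List ℕ) (x y z t : V) (h : [x, y, z, t].Nodup) :
    Dgraph.hemiLevels lv (Dgraph.table4 (c x y) (c x z) (c x t) (c y z) (c y t) (c z t)) =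
      true := by
  have := hc.hemiLevels lv [x, y, z, t] h (by simp)
  simp only [Dgraph.table4, ← hc.flip]
  simpa only [List.map_cons, List.map_nil, hc.diag] using this

theorem Good.table5 (hc : Good c) (lv : List ℕ) (x y z t s : V) (h : [x, y, z, t, s].Nodup) :
    Dgraph.hemiLevels lv (Dgraph.table5 (c x y) (c x z) (c x t) (c x s) (c y z) (c y t) (c y s)
      (c z t) (c z s) (c t s)) = true := by
  have := hc.hemiLevels lv [x, y, z, t, s] h (by simp)
  simp only [Dgraph.table5, ← hc.flip]
  simpa only [List.map_cons, List.map_nil, hc.diag] using this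

theorem Good.table6 (hc : Good c) (lv : List ℕ) (x y z t s r : V)
    (h : [x, y, z, t, s, r].Nodup) :
    Dgraph.hemiLevels lv (Dgraph.table6 (c x y) (c x z) (c x t) (c x s) (c x r) (c y z) (c y t)
      (c y s) (c y r) (c z t) (c z s) (c z r) (c t s) (c t r) (c s r)) = true := by
  have := hc.hemiLevels lv [x, y, z, t, s, r] h (by simp)
  simp only [Dgraph.table6, ← hc.flip]
  simpa only [List.map_cons, List.map_nil, hc.diag] using this

theorem Good.flip_div (hc : Good c) (u v : V) : c v u / 2 = c u v / 2 := by
  rw [hc.flip u v]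
  have h : ∀ n < 6, pairFlip n / 2 = n / 2 := by decide
  exact h _ (hc.lt u v)

theorem Good.flip_eq (hc : Good c) (u v : V) :
    (c u v = 0 ∧ c v u = 0) ∨ (c u v = 1 ∧ c v u = 1) ∨ (c u v = 2 ∧ c v u = 3) ∨
    (c u v = 3 ∧ c v u = 2) ∨ (c u v = 4 ∧ c v u = 5) ∨ (c u v = 5 ∧ c v u = 4) := by
  rw [hc.flip u v]
  have h : ∀ n < 6, (n = 0 ∧ pairFlip n = 0) ∨ (n = 1 ∧ pairFlip n = 1) ∨
    (n = 2 ∧ pairFlip n = 3) ∨ (n = 3 ∧ pairFlip n = 2) ∨ (n = 4 ∧ pairFlip n = 5) ∨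
    (n = 5 ∧ pairFlip n = 4) := by decide
  exact h _ (hc.lt u v)

theorem Good.swap (hc : Good c) : Good (fun u v => pairSwap (c u v)) where
  flip u v := by
    have h : ∀ n < 6, pairSwap (pairFlip n) = pairFlip (pairSwap n) := by decide
    rw [hc.flip u v]
    exact h _ (hc.lt u v)
  diag u := by simp [hc.diag, pairSwap]
  lt u v := by
    have h : ∀ n < 6, pairSwap n < 6 := by decide
    exact h _ (hc.lt u v)
  test v k hk hv := by
    have key : ∀ m < 6, ∀ n < 6, Nat.beq (pairFst (pairSwap m)) (pairSnd (pairSwap n)) =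
        Nat.beq (pairFst (pairFlip m)) (pairSnd n) := by decide
    have key' : ∀ i j x y : V, Nat.beq (pairFst (pairSwap (c i j))) (pairSnd (pairSwap (c x y))) =
        Nat.beq (pairFst (c j i)) (pairSnd (c x y)) := by
      intro i j x y
      rw [hc.flip i j]
      exact key _ (hc.lt _ _) _ (hc.lt _ _)
    have := hc.test v k hk hv
    simp only [hemiTest, key'] at this ⊢
    rwa [Bool.or_comm] at this

theorem rainbow_aux : ∀ x ∈ [0, 1], ∀ y ∈ [2, 3], ∀ z ∈ [4, 5],
    hemiLevels [3] (table3 x z y) = true → False := by decide +kernel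

/-- A triangle is not three-coloured. -/
theorem Good.rainbow (hc : Good c) {x y z : V} (h1 : c x y / 2 = 0) (h2 : c y z / 2 = 1)
    (h3 : c x z / 2 = 2) : False := by
  have hxy : x ≠ y := by rintro rfl; omega
  refine rainbow_aux _ (mem_neutral h1) _ (mem_red h2) _ (mem_blue h3)
    (hc.table3 [3] x y z ?_)
  simp [hxy, hc.ne (u := x) (v := z) (by omega), hc.ne (u := y) (v := z) (by omega)]

theorem uniform_aux : ∀ x ∈ [2, 3, 4, 5], ∀ y ∈ [2, 3, 4, 5], y / 2 = x / 2 → ∀ z ∈ [2, 3, 4, 5],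
    z / 2 ≠ x / 2 → hemiLevels [3] (table3 x y z) = true → x = y := by decide +kernel

theorem Good.uniform (hc : Good c) {w y z : V} (h1 : 0 < c w y / 2) (h2 : c w z / 2 = c w y / 2)
    (h3 : 0 < c y z / 2) (h4 : c y z / 2 ≠ c w y / 2) : c w y = c w z := by
  refine uniform_aux _ (hc.mem_directed (by omega)) _ (hc.mem_directed (by omega)) h2 _ (hc.mem_directed (by omega))
    h4
    (hc.table3 [3] w y z ?_)
  simp [hc.ne (u := w) (v := y) (by omega), hc.ne (u := w) (v := z) (by omega),
    hc.ne (u := y) (v := z) (by omega)]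

theorem cycle_aux : ∀ x ∈ [2, 4], ∀ y ∈ [2, 4], ∀ z ∈ [2, 4],
    hemiLevels [3] (table3 x (pairFlip z) y) = true → x = y ∧ y = z := by decide +kernel

theorem Good.cycle (hc : Good c) {x y z : V} (h1 : c x y = 2 ∨ c x y = 4)
    (h2 : c y z = 2 ∨ c y z = 4) (h3 : c z x = 2 ∨ c z x = 4) :
    c x y = c y z ∧ c y z = c z x := by
  refine cycle_aux _ (mem_forward h1) _ (mem_forward h2) _ (mem_forward h3) ?_
  rw [← hc.flip]
  refine hc.table3 [3] x y z ?_
  simp [hc.ne (u := x) (v := y) (by omega), (hc.ne (u := z) (v := x) (by omega)).symm,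
    hc.ne (u := y) (v := z) (by omega)]

theorem neutral_eq_aux : ∀ w1 ∈ [2, 3], ∀ w2 ∈ [2, 3], ∀ x1 ∈ [0, 1],
    ∀ x2 ∈ [0, 1], ∀ y ∈ [4, 5], ∀ z ∈ [0, 1, 2, 3, 4, 5],
    hemiLevels [4] (table4 z w1 w2 x1 x2 y) = true → x1 = x2 := by decide +kernel

theorem Good.neutral_eq (hc : Good c) {w x y z : V} (h1 : c y z / 2 = 2) (h2 : c w y / 2 = 1)
    (h3 : c w z / 2 = 1) (h4 : c x y / 2 = 0) (h5 : c x z / 2 = 0) : c x y = c x z := by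
  have hxy : x ≠ y := by rintro rfl; omega
  have hxz : x ≠ z := by rintro rfl; rw [hc.flip_div] at h1; omega
  have hwx : w ≠ x := by rintro rfl; omega
  refine neutral_eq_aux _ (mem_red h2) _ (mem_red h3) _ (mem_neutral h4) _ (mem_neutral h5) _
    (mem_blue h1) _ (hc.mem w x) (hc.table4 [4] w x y z ?_)
  simp [hxy, hxz, hwx, hc.ne (u := w) (v := y) (by omega), hc.ne (u := w) (v := z) (by omega),
    hc.ne (u := y) (v := z) (by omega)]

theorem peak_aux : ∀ a ∈ [0, 1], ∀ v1 ∈ [2, 3], ∀ v2 ∈ [2, 3],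
    ∀ w1 ∈ [4, 5], ∀ w2 ∈ [4, 5], ∀ z ∈ [0, 1, 2, 3, 4, 5],
    hemiLevels [3, 4] (table4 z v1 v2 w1 w2 a) = true →
    (z / 2 = 1 ∧ v1 = v2 ∧ w1 ≠ w2) ∨ (z / 2 = 2 ∧ w1 = w2 ∧ v1 ≠ v2) := by decide +kernel

theorem Good.peak (hc : Good c) {a b v w : V} (hab : a ≠ b) (h : c a b / 2 = 0)
    (h1 : c v a / 2 = 1) (h2 : c v b / 2 = 1) (h3 : c w a / 2 = 2) (h4 : c w b / 2 = 2) :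
    (c v w / 2 = 1 ∧ c v a = c v b ∧ c w a ≠ c w b) ∨
    (c v w / 2 = 2 ∧ c w a = c w b ∧ c v a ≠ c v b) := by
  have hwx : v ≠ w := by rintro rfl; omega
  refine peak_aux _ (mem_neutral h) _ (mem_red h1) _ (mem_red h2) _ (mem_blue h3) _
    (mem_blue h4) _ (hc.mem v w) (hc.table4 [3, 4] v w a b ?_)
  simp [hab, hwx, hc.ne (u := v) (v := a) (by omega), hc.ne (u := v) (v := b) (by omega),
    hc.ne (u := w) (v := a) (by omega), hc.ne (u := w) (v := b) (by omega)]

theorem dominated_cycle_aux : ∀ x ∈ [2, 4], ∀ y ∈ [2, 4], ∀ z ∈ [2, 4], ∀ u ∈ [2, 4], ∀ v ∈ [2, 4], ∀ w ∈ [2, 4],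
    (hemiLevels [3, 4] (table4 u v w x (pairFlip z) y) = true → u = v ∧ v = w) ∧
    (hemiLevels [3, 4] (table4 (pairFlip u) (pairFlip v) (pairFlip w) x (pairFlip z) y) = true →
      u = v ∧ v = w) := by
  decide +kernel

theorem Good.dominating (hc : Good c) {x y z t : V} (h1 : c x y = 2 ∨ c x y = 4)
    (h2 : c y z = 2 ∨ c y z = 4) (h3 : c z x = 2 ∨ c z x = 4) (h4 : c t x = 2 ∨ c t x = 4)
    (h5 : c t y = 2 ∨ c t y = 4) (h6 : c t z = 2 ∨ c t z = 4) : c t x = c t y ∧ c t y = c t z := by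
  refine (dominated_cycle_aux _ (mem_forward h1) _ (mem_forward h2) _ (mem_forward h3) _
    (mem_forward h4) _ (mem_forward h5) _ (mem_forward h6)).1 ?_
  rw [← hc.flip]
  refine hc.table4 [3, 4] t x y z ?_
  simp [hc.ne (u := x) (v := y) (by omega), (hc.ne (u := z) (v := x) (by omega)).symm,
    hc.ne (u := y) (v := z) (by omega), hc.ne (u := t) (v := x) (by omega),
    hc.ne (u := t) (v := y) (by omega), hc.ne (u := t) (v := z) (by omega)]

theorem Good.dominated (hc : Good c) {x y z t : V} (h1 : c x y = 2 ∨ c x y = 4)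
    (h2 : c y z = 2 ∨ c y z = 4) (h3 : c z x = 2 ∨ c z x = 4) (h4 : c x t = 2 ∨ c x t = 4)
    (h5 : c y t = 2 ∨ c y t = 4) (h6 : c z t = 2 ∨ c z t = 4) : c x t = c y t ∧ c y t = c z t := by
  refine (dominated_cycle_aux _ (mem_forward h1) _ (mem_forward h2) _ (mem_forward h3) _
    (mem_forward h4) _ (mem_forward h5) _ (mem_forward h6)).2 ?_
  rw [← hc.flip, ← hc.flip, ← hc.flip, ← hc.flip]
  refine hc.table4 [3, 4] t x y z ?_
  simp [hc.ne (u := x) (v := y) (by omega), (hc.ne (u := z) (v := x) (by omega)).symm,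
    hc.ne (u := y) (v := z) (by omega), (hc.ne (u := x) (v := t) (by omega)).symm,
    (hc.ne (u := y) (v := t) (by omega)).symm, (hc.ne (u := z) (v := t) (by omega)).symm]

theorem red_cycle_aux : ∀ u ∈ [4, 5], ∀ v ∈ [2, 3, 4, 5], ∀ w ∈ [2, 3, 4, 5],
    hemiLevels [3, 4] (table4 u v w 2 3 2) = true →
    (v = u ∧ w = u) ∨ (v = 2 ∧ w = 3) := by
  decide +kernel

theorem Good.red_cycle (hc : Good c) {x y z t : V} (h1 : c x y = 2) (h2 : c y z = 2)
    (h3 : c z x = 2) (h4 : c t x / 2 = 2) (h5 : c t y / 2 ≠ 0) (h6 : c t z / 2 ≠ 0) :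
    (c t y = c t x ∧ c t z = c t x) ∨ (c t y = 2 ∧ c t z = 3) := by
  have h3' : c x z = 3 := by rw [hc.flip z x, h3]; rfl
  have hne : t ≠ y := hc.ne (by omega)
  have hne' : t ≠ z := hc.ne (by omega)
  refine red_cycle_aux _ (mem_blue h4) _ (hc.mem_directed h5) _ (hc.mem_directed h6) ?_
  have := hc.table4 [3, 4] t x y z (by
    simp [hne, hne', hc.ne (u := x) (v := y) (by omega), (hc.ne (u := z) (v := x) (by omega)).symm,
      hc.ne (u := y) (v := z) (by omega), hc.ne (u := t) (v := x) (by omega)])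
  rwa [h1, h2, h3'] at this

theorem two_uniform_aux : ∀ e ∈ [2, 4], ∀ p ∈ [2, 3], ∀ y ∈ [4, 5],
    ∀ z ∈ [0, 1, 2, 3, 4, 5], hemiLevels [5] (table5 z p p p y y y e (pairFlip e) e) = true → False := by
  decide +kernel

/-- No vertex dominates a cycle in a way shared by the two digraphs while another one does so in
a reversed way. -/
theorem Good.two_uniform (hc : Good c) {x y z p t : V} (h1 : c x y = 2 ∨ c x y = 4)
    (h2 : c y z = 2 ∨ c y z = 4) (h3 : c z x = 2 ∨ c z x = 4) (h4 : c p x / 2 = 1)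
    (h5 : c p y = c p x) (h6 : c p z = c p x) (h7 : c t x / 2 = 2) (h8 : c t y = c t x)
    (h9 : c t z = c t x) : False := by
  obtain ⟨e1, e2⟩ := hc.cycle h1 h2 h3
  refine two_uniform_aux _ (mem_forward h1) _ (mem_red h4) _ (mem_blue h7) _ (hc.mem p t) ?_
  have hpt : p ≠ t := by rintro rfl; omega
  have := hc.table5 [5] p t x y z (by
    simp [hpt, hc.ne (u := x) (v := y) (by omega), (hc.ne (u := z) (v := x) (by omega)).symm,
      hc.ne (u := y) (v := z) (by omega), hc.ne (u := p) (v := x) (by omega),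
      hc.ne (u := p) (v := y) (by omega), hc.ne (u := p) (v := z) (by omega),
      hc.ne (u := t) (v := x) (by omega), hc.ne (u := t) (v := y) (by omega),
      hc.ne (u := t) (v := z) (by omega)])
  rwa [h5, h6, h8, h9, hc.flip z x, ← e2, ← e1] at this

theorem star_aux : ∀ p ∈ [2, 3], ∀ x ∈ [4, 5], ∀ y ∈ [4, 5], ∀ z ∈ [4, 5], ∀ i ∈ [0, 1], ∀ j ∈ [0, 1], ∀ k ∈ [0, 1, 2, 3, 4, 5],
    hemiLevels [5] (table5 p p p p x y z i k j) = true → False := by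
  decide +kernel

theorem Good.star (hc : Good c) {w v x y z : V} (h1 : c w v / 2 = 1) (h2 : c w x = c w v)
    (h3 : c w y = c w v) (h4 : c w z = c w v) (h5 : c v x / 2 = 2) (h6 : c v y / 2 = 2)
    (h7 : c v z / 2 = 2) (h8 : c x y / 2 = 0) (h9 : c y z / 2 = 0) (hxy : x ≠ y) (hyz : y ≠ z)
    (hxz : x ≠ z) : False := by
  refine star_aux _ (mem_red h1) _ (mem_blue h5) _ (mem_blue h6) _ (mem_blue h7) _ (mem_neutral h8) _
    (mem_neutral h9) _ (hc.mem x z) ?_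
  have := hc.table5 [5] w v x y z (by
    simp [hxy, hyz, hxz, hc.ne (u := w) (v := v) (by omega), hc.ne (u := w) (v := x) (by omega),
      hc.ne (u := w) (v := y) (by omega), hc.ne (u := w) (v := z) (by omega),
      hc.ne (u := v) (v := x) (by omega), hc.ne (u := v) (v := y) (by omega),
      hc.ne (u := v) (v := z) (by omega)])
  rwa [h2, h3, h4] at this

theorem quadrangle_aux : ∀ w ∈ [2, 3], ∀ a ∈ [0, 1], ∀ r ∈ [2, 4],
    ∀ s ∈ [0, 1, 2, 3, 4, 5], ∀ t ∈ [0, 1, 2, 3, 4, 5],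
    hemiLevels [3, 5, 6] (table6 w w w w w a 4 4 5 5 5 4 r s t) = true →
    r = 4 ∧ ((t = 4 ∧ s = 5) ∨ (s = a ∧ t = 4) ∨ (t = a ∧ s = 5)) := by
  decide +kernel

theorem Good.quadrangle (hc : Good c) {w a b p q m : V} (hab : a ≠ b) (hpm : p ≠ m)
    (hqm : q ≠ m) (h1 : c w a / 2 = 1) (h2 : c w b = c w a)
    (h3 : c w p = c w a) (h4 : c w q = c w a) (h5 : c w m = c w a) (h6 : c a b / 2 = 0)
    (h7 : c a p = 4) (h8 : c p b = 4) (h9 : c a q = 4) (h10 : c q b = 4) (h11 : c b m = 4)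
    (h12 : c m a = 4) (h13 : c p q = 2 ∨ c p q = 4) :
    c p q = 4 ∧ ((c q m = 4 ∧ c m p = 4) ∨ (c p m = c a b ∧ c q m = 4) ∨
      (c q m = c a b ∧ c m p = 4)) := by
  have e1 : c b p = 5 := by rw [hc.flip p b, h8]; rfl
  have e2 : c b q = 5 := by rw [hc.flip q b, h10]; rfl
  have e3 : c a m = 5 := by rw [hc.flip m a, h12]; rfl
  have := hc.table6 [3, 5, 6] w a b p q m (by
    simp [hab, hpm, hqm, hc.ne (u := w) (v := a) (by omega), hc.ne (u := w) (v := b) (by omega),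
      hc.ne (u := w) (v := p) (by omega), hc.ne (u := w) (v := q) (by omega),
      hc.ne (u := w) (v := m) (by omega), hc.ne (u := a) (v := p) (by omega),
      hc.ne (u := a) (v := q) (by omega), hc.ne (u := a) (v := m) (by omega),
      hc.ne (u := b) (v := p) (by omega), hc.ne (u := b) (v := q) (by omega),
      hc.ne (u := b) (v := m) (by omega), hc.ne (u := p) (v := q) (by omega)])
  rw [h2, h3, h4, h5, h7, h9, e1, e2, e3, h11] at this
  have := quadrangle_aux _ (mem_red h1) _ (mem_neutral h6) _ (mem_forward h13) _ (hc.mem p m) _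
    (hc.mem q m) this
  have h := hc.flip_eq p m
  omega

end Good


/-! Connectedness of a set of vertices with respect to a symmetric relation. -/

/-- Every proper cut of `X` is crossed by `α`. -/
def Linked (α : V → V → Prop) (X : Set V) : Prop :=
  ∀ S ⊆ X, S.Nonempty → S ≠ X → ∃ x ∈ S, ∃ y ∈ X \ S, α x y

/-- Reachability along `α` inside `X`. -/
def Reach (α : V → V → Prop) (X : Set V) : V → V → Prop :=
  Relation.ReflTransGen fun u v => u ∈ X ∧ v ∈ X ∧ α u v

section Linked

variable {α : V → V → Prop} {X : Set V}

theorem Linked.induction (h : Linked α X) {P : V → Prop} {y : V} (hy : y ∈ X) (hP : P y)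
    (hstep : ∀ u ∈ X, ∀ v ∈ X, P u → α u v → P v) : ∀ z ∈ X, P z := by
  by_contra! hne
  obtain ⟨z, hz, hPz⟩ := hne
  obtain ⟨u, hu, v, hv, huv⟩ := h {z ∈ X | P z} (fun z hz => hz.1) ⟨y, hy, hP⟩
    (fun he => hPz ((he.symm ▸ hz : z ∈ {z ∈ X | P z}).2))
  exact hv.2 ⟨hv.1, hstep u hu.1 v hv.1 hu.2 huv⟩

theorem Linked.of_induction {y : V} (hsymm : ∀ u v, α u v → α v u)
    (h : ∀ P : V → Prop, P y → (∀ u ∈ X, ∀ v ∈ X, P u → α u v → P v) → ∀ z ∈ X, P z) :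
    Linked α X := by
  intro S hS hne hneX
  by_contra! hcon
  have hcon' : ∀ u ∈ X, ∀ v ∈ X, α u v → (u ∈ S ↔ v ∈ S) := by
    intro u hu v hv huv
    constructor
    · intro hus
      by_contra hvs
      exact hcon u hus v ⟨hv, hvs⟩ huv
    · intro hvs
      by_contra hus
      exact hcon v hvs u ⟨hu, hus⟩ (hsymm _ _ huv)
  have h1 := h (fun z => z ∈ S ↔ y ∈ S) Iff.rfl
    (fun u hu v hv hP huv => (hcon' u hu v hv huv).symm.trans hP)
  obtain ⟨s, hs⟩ := hne
  have hyS : y ∈ S := (h1 s (hS hs)).1 hs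
  exact hneX (hS.antisymm fun z hz => (h1 z hz).2 hyS)

theorem Linked.star {y : V} (hsymm : ∀ u v, α u v → α v u) (hy : y ∈ X)
    (h : ∀ u ∈ X, u = y ∨ α y u) : Linked α X := by
  refine Linked.of_induction (y := y) hsymm fun P hP hstep z hz => ?_
  rcases h z hz with rfl | hz'
  · exact hP
  · exact hstep y hy z hz hP hz'

theorem Linked.insert_vertex (hsymm : ∀ u v, α u v → α v u) (h : Linked α X) {u v : V} (hu : u ∈ X)
    (huv : α u v) : Linked α (insert v X) := by
  refine Linked.of_induction (y := u) hsymm fun P hP hstep => ?_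
  have h1 : ∀ z ∈ X, P z := h.induction hu hP fun a ha b hb =>
    hstep a (Set.mem_insert_of_mem _ ha) b (Set.mem_insert_of_mem _ hb)
  rintro z (rfl | hz)
  · exact hstep u (Set.mem_insert_of_mem _ hu) _ (Set.mem_insert _ _) hP huv
  · exact h1 z hz

theorem Linked.union (hsymm : ∀ u v, α u v → α v u) {Y : Set V} (h : Linked α X)
    (h' : Linked α Y) {y : V} (hX : y ∈ X) (hY : y ∈ Y) : Linked α (X ∪ Y) := by
  refine Linked.of_induction (y := y) hsymm fun P hP hstep => ?_
  rintro z (hz | hz)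
  · exact h.induction hX hP (fun a ha b hb => hstep a (.inl ha) b (.inl hb)) z hz
  · exact h'.induction hY hP (fun a ha b hb => hstep a (.inr ha) b (.inr hb)) z hz

theorem Linked.exists_finite (hsymm : ∀ u v, α u v → α v u) (h : Linked α X) {F : Set V}
    (hF : F.Finite) (hFX : F ⊆ X) : ∃ Y : Set V, Y.Finite ∧ F ⊆ Y ∧ Y ⊆ X ∧ Linked α Y := by
  rcases F.eq_empty_or_nonempty with rfl | ⟨y, hy⟩
  · exact ⟨∅, Set.finite_empty, le_rfl, hFX, fun S hS hne => by
      obtain ⟨s, hs⟩ := hne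
      exact absurd (hS hs) (by simp)⟩
  have h1 : ∀ z ∈ X, ∃ Y : Set V, Y.Finite ∧ y ∈ Y ∧ z ∈ Y ∧ Y ⊆ X ∧ Linked α Y := by
    refine h.induction (hFX hy) ⟨{y}, Set.finite_singleton y, rfl, rfl, by simpa using hFX hy,
      Linked.star hsymm rfl fun u hu => .inl hu⟩ ?_
    rintro u - v hv ⟨Y, hY, hyY, huY, hYX, hYl⟩ huv
    exact ⟨insert v Y, hY.insert v, .inr hyY, .inl rfl,
      Set.insert_subset hv hYX, hYl.insert_vertex hsymm huY huv⟩
  have h2 : ∃ Y : Set V, Y.Finite ∧ y ∈ Y ∧ F ⊆ Y ∧ Y ⊆ X ∧ Linked α Y := by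
    have hyX := hFX hy
    clear hy
    induction F, hF using Set.Finite.induction_on with
    | empty =>
      obtain ⟨Y, hY, hyY, -, hYX, hYl⟩ := h1 y hyX
      exact ⟨Y, hY, hyY, by simp, hYX, hYl⟩
    | insert _ _ ih =>
      rename_i a s _ _
      obtain ⟨Y, hY, hyY, hFY, hYX, hYl⟩ := ih ((Set.subset_insert _ _).trans hFX)
      obtain ⟨Z, hZ, hyZ, haZ, hZX, hZl⟩ := h1 a (hFX (Set.mem_insert _ _))
      exact ⟨Y ∪ Z, hY.union hZ, .inl hyY, Set.insert_subset (.inr haZ)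
        (hFY.trans Set.subset_union_left), Set.union_subset hYX hZX, hYl.union hsymm hZl hyY hyZ⟩
  obtain ⟨Y, hY, -, h⟩ := h2
  exact ⟨Y, hY, h⟩

theorem Reach.mem {u v : V} (hu : u ∈ X) (h : Reach α X u v) : v ∈ X := by
  induction h with
  | refl => exact hu
  | tail _ h _ => exact h.2.1

theorem Reach.equivalence (hsymm : ∀ u v, α u v → α v u) : Equivalence (Reach α X) where
  refl _ := .refl
  symm h := by
    induction h with
    | refl => exact .refl
    | tail _ h ih => exact Relation.ReflTransGen.head ⟨h.2.1, h.1, hsymm _ _ h.2.2⟩ ih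
  trans h h' := Relation.ReflTransGen.trans h h'

theorem Reach.step {u v : V} (hu : u ∈ X) (hv : v ∈ X) (h : α u v) : Reach α X u v :=
  .single ⟨hu, hv, h⟩

theorem linked_reach (hsymm : ∀ u v, α u v → α v u) (u : V) :
    Linked α {v | Reach α X u v} := by
  refine Linked.of_induction (y := u) hsymm fun P hP hstep z hz => ?_
  change Reach α X u z at hz
  induction hz with
  | refl => exact hP
  | tail h h' ih => exact hstep _ h _ (h.tail h') ih h'.2.2

theorem Linked.reach (h : Linked α X) {u v : V} (hu : u ∈ X) (hv : v ∈ X) : Reach α X u v :=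
  h.induction (P := fun v => Reach α X u v) hu .refl
    (fun _ ha _ hb hr hab => Relation.ReflTransGen.tail hr ⟨ha, hb, hab⟩) v hv

theorem linked_of_reach (hsymm : ∀ u v, α u v → α v u) {u : V} (h : ∀ v ∈ X, Reach α X u v) :
    Linked α X := by
  by_cases hu : u ∈ X
  · have : {v | Reach α X u v} = X := Set.Subset.antisymm (fun v hv => Reach.mem hu hv) h
    exact this ▸ linked_reach hsymm u
  · intro S hS hne
    obtain ⟨s, hs⟩ := hne
    have := h s (hS hs)
    rcases Relation.ReflTransGen.cases_head this with rfl | ⟨w, hw, -⟩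
    · exact absurd (hS hs) hu
    · exact absurd hw.1 hu

end Linked

/-! Symmetric three-colourings without three-coloured triangles. -/

/-- A symmetric colouring with colours `0`, `1`, `2` in which no triangle has three colours. -/
structure Gallai (c : V → V → ℕ) : Prop where
  symm : ∀ u v, c u v = c v u
  lt : ∀ u v, c u v < 3
  rainbow : ∀ x y z, c x y ≠ c y z → c y z ≠ c x z → c x y ≠ c x z → False

section Gallai

variable {c : V → V → ℕ}

/-- Being joined by a pair of colour `i`. -/
abbrev Joined (c : V → V → ℕ) (i : ℕ) (u v : V) : Prop := c u v = i

theorem Gallai.joined_symm (hc : Gallai c) (i : ℕ) (u v : V) (h : Joined c i u v) :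
    Joined c i v u := (hc.symm v u).trans h

theorem Gallai.mono (hc : Gallai c) {i : ℕ} {Z : Set V} (hZ : Linked (Joined c i) Z) {z y : V}
    (hz : ∀ u ∈ Z, c z u ≠ i) (hy : y ∈ Z) : ∀ u ∈ Z, c z u = c z y := by
  refine hZ.induction hy rfl fun u hu v hv hP huv => ?_
  have huv' : c u v = i := huv
  have h1 := hz u hu
  have h2 := hz v hv
  by_contra hne
  exact hc.rainbow z u v (by omega) (by omega) (by omega)

theorem Gallai.linked_diff (hc : Gallai c) {i j k : ℕ} (hij : i ≠ j) (hik : i ≠ k) (hjk : j ≠ k)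
    (hi3 : i < 3) (hj3 : j < 3) (hk3 : k < 3) {X : Set V} {v b : V} (hv : v ∈ X) (hb : b ∈ X)
    (hbv : b ≠ v) (hi : Linked (Joined c i) X) (hj : Linked (Joined c j) X)
    (hk : Linked (Joined c k) X) : Linked (Joined c i) (X \ {v}) := by
  have hne : ({v} : Set V) ≠ X := by
    rintro rfl
    exact hbv hb
  obtain ⟨v', rfl, y, ⟨hyX, hyv⟩, hvy⟩ := hj {v} (by simpa using hv) ⟨v, rfl⟩ hne
  obtain ⟨v, rfl, z, ⟨hzX, hzv⟩, hvz⟩ := hk {v'} (by simpa using hv) ⟨v', rfl⟩ hne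
  have hyX' : y ∈ X \ {v} := ⟨hyX, hyv⟩
  set S := {u | Reach (Joined c i) (X \ {v}) y u} with hS
  have hSX : ∀ u ∈ S, u ∈ X \ {v} := fun u hu => Reach.mem hyX' hu
  have hSl : Linked (Joined c i) S := linked_reach (hc.joined_symm i) y
  have hyS : y ∈ S := Relation.ReflTransGen.refl
  have hvS : v ∉ S := fun h => (hSX v h).2 rfl
  have hSout : ∀ u ∈ S, ∀ w ∈ X \ {v}, w ∉ S → c w u ≠ i := by
    intro u hu w hw hwS h
    exact hwS (Relation.ReflTransGen.tail hu ⟨hSX u hu, hw, (hc.symm u w).trans h⟩)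
  by_cases hall : ∀ w ∈ X \ {v}, w ∈ S
  · have : S = X \ {v} := Set.Subset.antisymm hSX hall
    rwa [← this]
  exfalso
  push Not at hall
  obtain ⟨w, hw, hwS⟩ := hall
  have hmono : ∀ w ∈ X \ {v}, w ∉ S → ∀ u ∈ S, c w u = c w y := fun w hw hwS =>
    hc.mono hSl (fun u hu => hSout u hu w hw hwS) hyS
  obtain ⟨y2, hy2, v2, ⟨hv2X, hv2S⟩, hv2⟩ := hi S (fun u hu => (hSX u hu).1) ⟨y, hyS⟩
    (fun h => hvS (h ▸ hv))
  have hv2v : v2 = v := by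
    by_contra hne
    exact hSout y2 hy2 v2 ⟨hv2X, hne⟩ hv2S ((hc.symm _ _).trans hv2)
  subst hv2v
  have hcol : ∀ w ∈ X \ {v2}, w ∉ S → c w y = j ∨ c w y = k := by
    intro w hw hwS
    have := hSout y hyS w hw hwS
    have := hc.lt w y
    omega
  have hvy' : c v2 y = j := hvy
  have hvz' : c v2 z = k := hvz
  have hcross : ∀ w ∈ X \ {v2}, w ∉ S → c w y = k → ∀ w' ∈ X \ {v2}, w' ∉ S → c w' y = j →
      c w w' ≠ i := by
    intro w _ _ h1 w' _ _ h2 h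
    have := hc.symm w' y
    exact hc.rainbow w w' y (by omega) (by omega) (by omega)
  have hnok : ∀ w ∈ X \ {v2}, w ∉ S → c w y = j := by
    intro w hw hwS
    refine (hcol w hw hwS).resolve_right fun hwk => ?_
    obtain ⟨r, ⟨hr, hrS, hrk⟩, t, ⟨htX, ht⟩, hrt⟩ := hi {w | w ∈ X \ {v2} ∧ w ∉ S ∧ c w y = k}
      (fun u hu => hu.1.1) ⟨w, hw, hwS, hwk⟩ (fun h => (h ▸ hv : v2 ∈ {w | _}).1.2 rfl)
    have hrt' : c r t = i := hrt
    by_cases htv : t = v2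
    · subst htv
      have h1 := hc.symm r t
      have h2 := hc.symm r y
      exact hc.rainbow t r y (by omega) (by omega) (by omega)
    · by_cases htS : t ∈ S
      · exact hSout t htS r hr hrS hrt'
      · rcases hcol t ⟨htX, htv⟩ htS with h | h
        · exact hcross r hr hrS hrk t ⟨htX, htv⟩ htS h hrt'
        · exact ht ⟨⟨htX, htv⟩, htS, h⟩
  have hy2' : c y2 v2 = i := hv2
  have hzS : z ∈ S := by
    by_contra hzS
    have h1 := hnok z ⟨hzX, hzv⟩ hzS
    have h2 := hmono z ⟨hzX, hzv⟩ hzS y2 hy2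
    have h3 := hc.symm y2 v2
    exact hc.rainbow v2 z y2 (by omega) (by omega) (by omega)
  obtain ⟨r, ⟨hr, hrS⟩, t, ⟨htX, ht⟩, hrt⟩ := hi {w | w ∈ X \ {v2} ∧ w ∉ S}
    (fun u hu => hu.1.1) ⟨w, hw, hwS⟩ (fun h => (h ▸ hv : v2 ∈ {w | _}).1.2 rfl)
  have hrt' : c r t = i := hrt
  by_cases htv : t = v2
  · subst htv
    have h1 := hnok r hr hrS
    have h2 := hmono r hr hrS z hzS
    have h3 := hc.symm r t
    exact hc.rainbow t r z (by omega) (by omega) (by omega)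
  · by_cases htS : t ∈ S
    · exact hSout t htS r hr hrS hrt'
    · exact ht ⟨⟨htX, htv⟩, htS⟩

/-- A finite set with at least two vertices is disconnected with respect to some colour. -/
theorem Gallai.not_linked (hc : Gallai c) {i j k : ℕ} (hij : i ≠ j) (hik : i ≠ k) (hjk : j ≠ k)
    (hi3 : i < 3) (hj3 : j < 3) (hk3 : k < 3) {X : Set V} (hX : X.Finite) (hX' : X.Nontrivial)
    (hi : Linked (Joined c i) X) (hj : Linked (Joined c j) X) (hk : Linked (Joined c k) X) :
    False := by
  induction hn : X.ncard using Nat.strong_induction_on generalizing X with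
  | _ n ih =>
  obtain ⟨v, hv, b, hb, hvb⟩ := hX'
  by_cases hnt : (X \ {v}).Nontrivial
  · refine ih _ ?_ (hX.sdiff) hnt
      (hc.linked_diff hij hik hjk hi3 hj3 hk3 hv hb hvb.symm hi hj hk)
      (hc.linked_diff hij.symm hjk hik hj3 hi3 hk3 hv hb hvb.symm hj hi hk)
      (hc.linked_diff hjk.symm hik.symm hij.symm hk3 hj3 hi3 hv hb hvb.symm hk hj hi) rfl
    rw [← hn]
    exact Set.ncard_sdiff_singleton_lt_of_mem hv hX
  · rw [Set.not_nontrivial_iff] at hnt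
    have hne : ({v} : Set V) ≠ X := by
      rintro rfl
      exact hvb hb.symm
    obtain ⟨v', rfl, y, hy, hvy⟩ := hj {v} (by simpa using hv) ⟨v, rfl⟩ hne
    obtain ⟨v, rfl, z, hz, hvz⟩ := hk {v'} (by simpa using hv) ⟨v', rfl⟩ hne
    have := hnt hy hz
    subst this
    exact hjk (Eq.trans (Eq.symm hvy) hvz)

theorem Gallai.exists_linked_superset (hc : Gallai c) {i j : ℕ}
    {F C : Set V} (hF : F.Finite) (hne : F.Nonempty) (hFC : F ⊆ C) (hi : Linked (Joined c i) F)
    (hj : Linked (Joined c j) C) (hno : ∀ y ∈ C, y ∉ F → ¬ ∀ f ∈ F, c y f = j) :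
    ∃ X : Set V, X.Finite ∧ F ⊆ X ∧ X ⊆ C ∧ Linked (Joined c i) X ∧ Linked (Joined c j) X := by
  obtain ⟨X, hX, hFX, hXC, hXl⟩ := hj.exists_finite (hc.joined_symm j) hF hFC
  refine ⟨X, hX, hFX, hXC, ?_, hXl⟩
  obtain ⟨f, hf⟩ := hne
  have hKF : ∀ g ∈ F, Reach (Joined c i) X f g := fun g hg =>
    Relation.ReflTransGen.mono (fun a b h => ⟨hFX h.1, hFX h.2.1, h.2.2⟩) _ _ (hi.reach hf hg)
  refine linked_of_reach (hc.joined_symm i) (u := f)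
    (hXl.induction (P := fun v => Reach (Joined c i) X f v) (hFX hf) .refl ?_)
  intro u hu v hv hr huv
  by_contra hvr
  have hnoi : ∀ w ∈ {w | Reach (Joined c i) X f w}, c v w ≠ i := fun w hw h =>
    hvr (Relation.ReflTransGen.tail hw ⟨Reach.mem (hFX hf) hw, hv, (hc.symm w v).trans h⟩)
  have hm := hc.mono (linked_reach (hc.joined_symm i) f) hnoi (show u ∈ _ from hr)
  refine hno v (hXC hv) (fun h => hvr (hKF v h)) fun g hg => ?_
  rw [hm g (hKF g hg), hc.symm]
  exact huv

theorem Gallai.exists_all_joined (hc : Gallai c) {i j k : ℕ} (hij : i ≠ j) (hik : i ≠ k)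
    (hjk : j ≠ k) (hi3 : i < 3) (hj3 : j < 3) (hk3 : k < 3) {a b : V} (hab : a ≠ b)
    (habk : c a b = k) {p : V → Prop}
    (hp : ∀ v w, c v a = i → c v b = i → c w a = j → c w b = j →
      (c v w = i ∧ p v ∧ ¬ p w) ∨ (c v w = j ∧ p w ∧ ¬ p v))
    (hj : Linked (Joined c j) Set.univ) {F : Set V} (hF : F.Finite) (haF : a ∈ F) (hbF : b ∈ F)
    (hFi : Linked (Joined c i) F) : ∃ y, ∀ f ∈ F, c y f = j := by
  by_contra! hno
  obtain ⟨X, hX, hFX, -, hXi, hXj⟩ := hc.exists_linked_superset hF ⟨a, haF⟩ (Set.subset_univ F)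
    hFi hj (fun y _ _ h => by
      obtain ⟨f, hf, hne⟩ := hno y
      exact hne (h f hf))
  have haX := hFX haF
  have hbX := hFX hbF
  have hnk : ¬ Linked (Joined c k) X := fun hXk =>
    hc.not_linked hij hik hjk hi3 hj3 hk3 hX ⟨a, haX, b, hbX, hab⟩ hXi hXj hXk
  set K := {u | Reach (Joined c k) X a u} with hK
  have hKX : K ⊆ X := fun u hu => Reach.mem haX hu
  have haK : a ∈ K := Relation.ReflTransGen.refl
  have hbK : b ∈ K := Reach.step haX hbX habk
  have hKne : K ≠ X := fun h => hnk (h ▸ linked_reach (hc.joined_symm k) a)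
  have hmono : ∀ z ∈ X, z ∉ K → ∀ u ∈ K, c z u = c z a := by
    intro z hz hzK
    refine hc.mono (linked_reach (hc.joined_symm k) a) (fun u hu h => hzK ?_) haK
    exact Relation.ReflTransGen.tail hu ⟨hKX hu, hz, (hc.symm u z).trans h⟩
  have hcol : ∀ z ∈ X, z ∉ K → c z a = i ∨ c z a = j := by
    intro z hz hzK
    have : c z a ≠ k := fun h => hzK (Reach.step haX hz ((hc.symm a z).trans h))
    have := hc.lt z a
    omega
  have hex : ∀ l, Linked (Joined c l) X → ∃ z ∈ X, z ∉ K ∧ c z a = l := by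
    intro l hl
    obtain ⟨x, hx, z, ⟨hzX, hzK⟩, hxz⟩ := hl K hKX ⟨a, haK⟩ hKne
    exact ⟨z, hzX, hzK, by rw [← hmono z hzX hzK x hx, hc.symm]; exact hxz⟩
  obtain ⟨v0, hv0X, hv0K, hv0⟩ := hex i hXi
  obtain ⟨w0, hw0X, hw0K, hw0⟩ := hex j hXj
  have hdich : ∀ v ∈ X, v ∉ K → c v a = i → ∀ w ∈ X, w ∉ K → c w a = j →
      (c v w = i ∧ p v ∧ ¬ p w) ∨ (c v w = j ∧ p w ∧ ¬ p v) := by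
    intro v hv hvK hva w hw hwK hwa
    exact hp v w hva ((hmono v hv hvK b hbK).trans hva) hwa ((hmono w hw hwK b hbK).trans hwa)
  have hpv : ∀ v ∈ X, v ∉ K → c v a = i → (p v ↔ p v0) := by
    intro v hv hvK hva
    have h1 := hdich v hv hvK hva w0 hw0X hw0K hw0
    have h2 := hdich v0 hv0X hv0K hv0 w0 hw0X hw0K hw0
    tauto
  have hcross : (∀ v ∈ X, v ∉ K → c v a = i → ∀ w ∈ X, w ∉ K → c w a = j → c v w = i) ∨
      (∀ v ∈ X, v ∉ K → c v a = i → ∀ w ∈ X, w ∉ K → c w a = j → c v w = j) := by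
    by_cases hp0 : p v0
    · refine .inl fun v hv hvK hva w hw hwK hwa => ?_
      have := (hpv v hv hvK hva).2 hp0
      have := hdich v hv hvK hva w hw hwK hwa
      tauto
    · refine .inr fun v hv hvK hva w hw hwK hwa => ?_
      have : ¬ p v := fun h => hp0 ((hpv v hv hvK hva).1 h)
      have := hdich v hv hvK hva w hw hwK hwa
      tauto
  rcases hcross with hcr | hcr
  · obtain ⟨x, ⟨hxX, hx⟩, z, ⟨hzX, hz⟩, hxz⟩ := hXj {x | x ∈ X ∧ (x ∈ K ∨ c x a = j)}
      (fun u hu => hu.1) ⟨a, haX, .inl haK⟩ (fun h => by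
        have := (h ▸ hv0X : v0 ∈ {x | _}).2
        rcases this with h | h
        · exact hv0K h
        · omega)
    have hzK : z ∉ K := fun h => hz ⟨hzX, .inl h⟩
    have hzj : c z a ≠ j := fun h => hz ⟨hzX, .inr h⟩
    have hzi := (hcol z hzX hzK).resolve_right hzj
    have hxz' : c x z = j := hxz
    by_cases hxK : x ∈ K
    · have := hmono z hzX hzK x hxK
      have := hc.symm x z
      omega
    · have := hcr z hzX hzK hzi x hxX hxK (hx.resolve_left hxK)
      have := hc.symm x z
      omega
  · obtain ⟨x, ⟨hxX, hx⟩, z, ⟨hzX, hz⟩, hxz⟩ := hXi {x | x ∈ X ∧ (x ∈ K ∨ c x a = i)}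
      (fun u hu => hu.1) ⟨a, haX, .inl haK⟩ (fun h => by
        have := (h ▸ hw0X : w0 ∈ {x | _}).2
        rcases this with h | h
        · exact hw0K h
        · omega)
    have hzK : z ∉ K := fun h => hz ⟨hzX, .inl h⟩
    have hzi : c z a ≠ i := fun h => hz ⟨hzX, .inr h⟩
    have hzj := (hcol z hzX hzK).resolve_left hzi
    have hxz' : c x z = i := hxz
    by_cases hxK : x ∈ K
    · have := hmono z hzX hzK x hxK
      have := hc.symm x z
      omega
    · have := hcr x hxX hxK (hx.resolve_left hxK) z hzX hzK hzj
      omega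

theorem Gallai.no_third (hc : Gallai c) {i j k : ℕ} (hij : i ≠ j) (hik : i ≠ k)
    (hjk : j ≠ k) (hi3 : i < 3) (hj3 : j < 3) (hk3 : k < 3) {a b : V} (hab : a ≠ b)
    (habk : c a b = k) {p : V → Prop}
    (hp : ∀ v w, c v a = i → c v b = i → c w a = j → c w b = j →
      (c v w = i ∧ p v ∧ ¬ p w) ∨ (c v w = j ∧ p w ∧ ¬ p v))
    (hi : Linked (Joined c i) Set.univ) (hj : Linked (Joined c j) Set.univ) : False := by
  have hp' : ∀ v w, c v a = j → c v b = j → c w a = i → c w b = i →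
      (c v w = j ∧ p v ∧ ¬ p w) ∨ (c v w = i ∧ p w ∧ ¬ p v) := by
    intro v w h1 h2 h3 h4
    have := hp w v h3 h4 h1 h2
    rw [hc.symm w v] at this
    tauto
  obtain ⟨F, hF, habF, -, hFl⟩ := hi.exists_finite (hc.joined_symm i)
    (F := {a, b}) (by simp) (Set.subset_univ _)
  obtain ⟨y1, hy1⟩ := hc.exists_all_joined hij hik hjk hi3 hj3 hk3 hab habk hp hj hF
    (habF (by simp)) (habF (by simp)) hFl
  have h1a := hy1 a (habF (by simp))
  have h1b := hy1 b (habF (by simp))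
  obtain ⟨y2, hy2⟩ := hc.exists_all_joined hij.symm hjk hik hj3 hi3 hk3 hab habk hp' hi
    (F := {a, b, y1}) (by simp) (by simp) (by simp)
    (Linked.star (hc.joined_symm j) (y := y1) (by simp) (by
      rintro u (rfl | rfl | rfl)
      exacts [.inr h1a, .inr h1b, .inl rfl]))
  have h2a := hy2 a (by simp)
  have h2b := hy2 b (by simp)
  obtain ⟨y3, hy3⟩ := hc.exists_all_joined hij hik hjk hi3 hj3 hk3 hab habk hp hj
    (F := {a, b, y2}) (by simp) (by simp) (by simp)
    (Linked.star (hc.joined_symm i) (y := y2) (by simp) (by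
      rintro u (rfl | rfl | rfl)
      exacts [.inr h2a, .inr h2b, .inl rfl]))
  have e1 := hp y2 y1 h2a h2b h1a h1b
  have e2 := hp y2 y3 h2a h2b (hy3 a (by simp)) (hy3 b (by simp))
  rw [hy2 y1 (by simp)] at e1
  rw [hc.symm y2 y3, hy3 y2 (by simp)] at e2
  have h1 : p y2 := by tauto
  have h2 : ¬ p y2 := by
    rcases e2 with h | h
    · exact absurd h.1.symm hij
    · exact h.2.2
  exact h2 h1

end Gallai

theorem Good.gallai {c : V → V → ℕ} (hc : Good c) : Gallai (fun u v => c u v / 2) where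
  symm u v := (hc.flip_div v u)
  lt u v := by
    have := hc.lt u v
    omega
  rainbow x y z h1 h2 h3 := by
    have l1 := hc.lt x y
    have l2 := hc.lt y z
    have l3 := hc.lt x z
    have s1 := hc.flip_div x y
    have s2 := hc.flip_div y z
    have s3 := hc.flip_div x z
    have r1 : ¬ (c x y / 2 = 0 ∧ c y z / 2 = 1 ∧ c x z / 2 = 2) :=
      fun h => hc.rainbow h.1 h.2.1 h.2.2
    have r2 : ¬ (c y x / 2 = 0 ∧ c x z / 2 = 1 ∧ c y z / 2 = 2) :=
      fun h => hc.rainbow h.1 h.2.1 h.2.2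
    have r3 : ¬ (c y z / 2 = 0 ∧ c z x / 2 = 1 ∧ c y x / 2 = 2) :=
      fun h => hc.rainbow h.1 h.2.1 h.2.2
    have r4 : ¬ (c z y / 2 = 0 ∧ c y x / 2 = 1 ∧ c z x / 2 = 2) :=
      fun h => hc.rainbow h.1 h.2.1 h.2.2
    have r5 : ¬ (c x z / 2 = 0 ∧ c z y / 2 = 1 ∧ c x y / 2 = 2) :=
      fun h => hc.rainbow h.1 h.2.1 h.2.2
    have r6 : ¬ (c z x / 2 = 0 ∧ c x y / 2 = 1 ∧ c z y / 2 = 2) :=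
      fun h => hc.rainbow h.1 h.2.1 h.2.2
    omega


/-! Finite chains. -/

/-- `G[X]` is a tournament without cyclic triangles. -/
def ChainOn (G : Dgraph V) (X : Set V) : Prop :=
  (∀ x ∈ X, ∀ y ∈ X, x ≠ y → G.Dir x y) ∧
  ∀ x ∈ X, ∀ y ∈ X, ∀ z ∈ X, G.Arc x y → G.Arc y z → G.Arc z x → False

theorem ChainOn.mono {G : Dgraph V} {X Y : Set V} (h : ChainOn G X) (hY : Y ⊆ X) :
    ChainOn G Y :=
  ⟨fun x hx y hy => h.1 x (hY hx) y (hY hy),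
    fun x hx y hy z hz => h.2 x (hY hx) y (hY hy) z (hY hz)⟩

theorem ChainOn.asymm {G : Dgraph V} {X : Set V} (h : ChainOn G X) {x y : V} (hx : x ∈ X)
    (hy : y ∈ X) (hxy : G.Arc x y) : ¬ G.Arc y x := by
  have hne : x ≠ y := by
    rintro rfl
    exact G.irrefl x hxy
  rcases h.1 x hx y hy hne with h1 | h1
  · exact h1.2
  · exact absurd hxy h1.2

theorem ChainOn.total {G : Dgraph V} {X : Set V} (h : ChainOn G X) {x y : V} (hx : x ∈ X)
    (hy : y ∈ X) (hxy : x ≠ y) : G.Arc x y ∨ G.Arc y x :=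
  (h.1 x hx y hy hxy).imp And.left And.left

theorem ChainOn.trans {G : Dgraph V} {X : Set V} (h : ChainOn G X) {x y z : V} (hx : x ∈ X)
    (hy : y ∈ X) (hz : z ∈ X) (hxy : G.Arc x y) (hyz : G.Arc y z) : G.Arc x z := by
  have hne : x ≠ z := by
    rintro rfl
    exact h.asymm hx hy hxy hyz
  exact (h.total hx hz hne).resolve_right fun hzx => h.2 x hx y hy z hz hxy hyz hzx

theorem ChainOn.dual {G : Dgraph V} {X : Set V} (h : ChainOn G X) : ChainOn G.dual X :=
  ⟨fun x hx y hy hxy => (h.1 x hx y hy hxy).symm,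
    fun x hx y hy z hz h1 h2 h3 => h.2 z hz y hy x hx h2 h1 h3⟩

theorem ChainOn.exists_enum {G : Dgraph V} {X : Set V} (h : ChainOn G X) (hX : X.Finite) :
    ∃ e : Fin X.ncard ≃ X, ∀ i j, i < j ↔ G.Arc (e i) (e j) := by
  classical
  have := hX.fintype
  let : LinearOrder X :=
    { le := fun x y => x = y ∨ G.Arc x y
      lt := fun x y => G.Arc x y
      le_refl := fun x => .inl rfl
      le_trans := by
        rintro x y z (rfl | h1) (rfl | h2)
        · exact .inl rfl
        · exact .inr h2
        · exact .inr h1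
        · exact .inr (h.trans x.2 y.2 z.2 h1 h2)
      le_antisymm := by
        rintro x y (rfl | h1) (h2 | h2)
        · rfl
        · rfl
        · exact h2.symm
        · exact absurd h2 (h.asymm x.2 y.2 h1)
      lt_iff_le_not_ge := by
        intro x y
        constructor
        · intro h1
          refine ⟨.inr h1, ?_⟩
          rintro (rfl | h2)
          · exact G.irrefl _ h1
          · exact h.asymm x.2 y.2 h1 h2
        · rintro ⟨rfl | h1, h2⟩
          · exact absurd (.inl rfl) h2
          · exact h1
      le_total := by
        intro x y
        by_cases hxy : x = y
        · exact .inl (.inl hxy)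
        · exact (h.total x.2 y.2 fun he => hxy (Subtype.ext he)).imp .inr .inr
      toDecidableLE := Classical.decRel _ }
  let e : Fin X.ncard ≃o X := Fintype.orderIsoFinOfCardEq X
    (by rw [← Nat.card_eq_fintype_card, Nat.card_coe_set_eq])
  exact ⟨e.toEquiv, fun i j => (e.lt_iff_lt).symm⟩

/-- Finite chains of the same size are isomorphic. -/
theorem ChainOn.isoOn {G H : Dgraph V} {X Y : Set V} (hX : X.Finite) (hY : Y.Finite)
    (h : X.ncard = Y.ncard) (hG : ChainOn G X) (hH : ChainOn H Y) : IsoOn G H X Y := by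
  rw [isoOn_iff_iso]
  obtain ⟨e, he⟩ := hG.exists_enum hX
  obtain ⟨f, hf⟩ := hH.exists_enum hY
  refine ⟨e.symm.trans ((finCongr h).trans f), fun x y => ?_⟩
  have h1 := he (e.symm x) (e.symm y)
  have h2 := hf (finCongr h (e.symm x)) (finCongr h (e.symm y))
  simp only [Equiv.apply_symm_apply] at h1
  exact h1.symm.trans (Iff.trans (by rw [Fin.lt_def, Fin.lt_def]; rfl) h2)

/-! Systems of pair types as pairs of digraphs. -/

/-- `c` records the types of pairs in `G` and `H`. -/
structure Coded (G H : Dgraph V) (c : V → V → ℕ) : Prop extends Good c where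
  fst : ∀ u v, G.Arc u v ↔ c u v = 1 ∨ c u v = 2 ∨ c u v = 4
  snd : ∀ u v, H.Arc u v ↔ c u v = 1 ∨ c u v = 2 ∨ c u v = 5

theorem LeHemi.coded {G H : Dgraph V} (h : LeHemi 6 G H) : Coded G H (code G H) where
  toGood := h.good
  fst u v := by
    unfold code
    split_ifs <;> simp_all
  snd u v := by
    have := pairSnd_code_eq h (by omega) (u := u) (v := v)
    have hlt := code_lt G H u v
    generalize code G H u v = n at *
    interval_cases n <;> simp_all [pairSnd]

theorem pairSwap_div {n : ℕ} (h : n < 6) : (pairSwap n / 2 = 0 ↔ n / 2 = 0) ∧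
    (pairSwap n / 2 = 1 ↔ n / 2 = 2) ∧ (pairSwap n / 2 = 2 ↔ n / 2 = 1) ∧
    (pairSwap n = 0 ↔ n = 0) ∧ (pairSwap n = 1 ↔ n = 1) ∧ (pairSwap n = 2 ↔ n = 4) ∧
    (pairSwap n = 3 ↔ n = 5) ∧ (pairSwap n = 4 ↔ n = 2) ∧ (pairSwap n = 5 ↔ n = 3) := by
  interval_cases n <;> simp [pairSwap]

theorem pairSwap_inj {m n : ℕ} (hm : m < 6) (hn : n < 6) : pairSwap m = pairSwap n ↔ m = n := by
  interval_cases m <;> interval_cases n <;> simp [pairSwap]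

theorem Coded.swap {G H : Dgraph V} {c : V → V → ℕ} (hc : Coded G H c) :
    Coded G H.dual (fun u v => pairSwap (c u v)) where
  toGood := hc.toGood.swap
  fst u v := by
    have := pairSwap_div (hc.lt u v)
    rw [hc.fst]
    omega
  snd u v := by
    have := pairSwap_div (hc.lt u v)
    have := hc.flip_eq u v
    change H.Arc v u ↔ _
    rw [hc.snd]
    omega

/-- Being joined by a pair of colour `i`: neutral, same, or reversed. -/
abbrev Col (c : V → V → ℕ) (i : ℕ) : V → V → Prop := Joined (fun u v => c u v / 2) i

section Good

variable {c : V → V → ℕ}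

theorem Good.col_symm (hc : Good c) (i : ℕ) (u v : V) (h : Col c i u v) : Col c i v u :=
  hc.gallai.joined_symm i u v h

theorem Good.col_swap_one (hc : Good c) : Col (fun u v => pairSwap (c u v)) 1 = Col c 2 := by
  funext u v
  exact propext (pairSwap_div (hc.lt u v)).2.1

theorem Good.col_swap_two (hc : Good c) : Col (fun u v => pairSwap (c u v)) 2 = Col c 1 := by
  funext u v
  exact propext (pairSwap_div (hc.lt u v)).2.2.1

theorem Good.exists_blue_over (hc : Good c) {C : Set V} (hC : Linked (Col c 2) C)
    (ht : ∀ u ∈ C, ∀ v ∈ C, u ≠ v → c u v / 2 ≠ 0) {x y z : V} (hx : x ∈ C) (hy : y ∈ C)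
    (hz : z ∈ C) (hxy : c x y = 2) (hyz : c y z = 2) (hzx : c z x = 2) :
    ∃ t ∈ C, ∃ s ∈ C, c t y = 2 ∧ c z t = 2 ∧ c s t / 2 = 2 ∧ c s y = c s t ∧ c s z = c s t := by
  have hne : {t | t ∈ C ∧ c t y = 2 ∧ c z t = 2} ≠ C := by
    intro h
    have : y ∈ {t | t ∈ C ∧ c t y = 2 ∧ c z t = 2} := by
      rw [h]
      exact hy
    have := this.2.1
    rw [hc.diag] at this
    omega
  obtain ⟨t, ⟨htC, hty, hzt⟩, s, ⟨hsC, hs⟩, hts⟩ := hC {t | t ∈ C ∧ c t y = 2 ∧ c z t = 2}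
    (fun u hu => hu.1) ⟨x, hx, hxy, hzx⟩ hne
  have hst : c s t / 2 = 2 := hc.col_symm 2 t s hts
  have hsy : s ≠ y := by rintro rfl; have := hc.flip_div s t; omega
  have hsz : s ≠ z := by rintro rfl; omega
  refine ⟨t, htC, s, hsC, hty, hzt, hst, ?_⟩
  refine (hc.red_cycle hty hyz hzt hst (ht s hsC y hy hsy) (ht s hsC z hz hsz)).resolve_right ?_
  rintro ⟨h1, h2⟩
  refine hs ⟨hsC, h1, ?_⟩
  have := hc.flip_eq s z
  omega

theorem Good.exists_red_over (hc : Good c) {C : Set V} (hC : Linked (Col c 1) C)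
    (ht : ∀ u ∈ C, ∀ v ∈ C, u ≠ v → c u v / 2 ≠ 0) {x y z : V} (hx : x ∈ C) (hy : y ∈ C)
    (hz : z ∈ C) (hxy : c x y = 4) (hyz : c y z = 4) (hzx : c z x = 4) :
    ∃ t ∈ C, ∃ s ∈ C, c t y = 4 ∧ c z t = 4 ∧ c s t / 2 = 1 ∧ c s y = c s t ∧ c s z = c s t := by
  have hp := fun u v => pairSwap_div (hc.lt u v)
  obtain ⟨t, htC, s, hsC, h1, h2, h3, h4, h5⟩ := hc.swap.exists_blue_over (C := C)
    (by rw [hc.col_swap_two]; exact hC)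
    (fun u hu v hv huv h => ht u hu v hv huv ((hp u v).1.1 h)) hx hy hz
    ((hp _ _).2.2.2.2.2.1.2 hxy) ((hp _ _).2.2.2.2.2.1.2 hyz) ((hp _ _).2.2.2.2.2.1.2 hzx)
  exact ⟨t, htC, s, hsC, (hp _ _).2.2.2.2.2.1.1 h1, (hp _ _).2.2.2.2.2.1.1 h2,
    (hp _ _).2.2.1.1 h3, (pairSwap_inj (hc.lt _ _) (hc.lt _ _)).1 h4,
    (pairSwap_inj (hc.lt _ _) (hc.lt _ _)).1 h5⟩

theorem Good.not_blue_over_two (hc : Good c) {u w y z : V} (h1 : c u y / 2 = 2)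
    (h2 : c u z = c u y) (h3 : c w y = 2) (h4 : c y z = 2) (h5 : c z w = 2)
    (h6 : c u w / 2 = 1) : False := by
  have f1 := hc.flip_eq u w
  have f2 := hc.flip_eq u y
  have f3 := hc.flip_eq u z
  have k1 : c u w = 2 ∨ c u w = 3 := by omega
  have k2 : c u y = 4 ∨ c u y = 5 := by omega
  rcases k1 with k1 | k1 <;> rcases k2 with k2 | k2
  · have := hc.dominating (t := u) (.inl h3) (.inl h4) (.inl h5) (.inl k1) (.inr k2) (.inr (by omega))
    omega
  · have := hc.cycle (.inl k1) (.inl h3) (.inr (by omega) : c y u = 2 ∨ c y u = 4)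
    omega
  · have := hc.cycle (.inl h5) (.inl (by omega : c w u = 2)) (.inr (by omega) : c u z = 2 ∨ c u z = 4)
    omega
  · have := hc.dominated (t := u) (.inl h3) (.inl h4) (.inl h5) (.inl (by omega)) (.inr (by omega))
      (.inr (by omega))
    omega

/-- In a tournament connected by agreeing pairs, no reversed vertex lies uniformly over an
agreeing cyclic triangle. -/
theorem Good.no_blue_over (hc : Good c) {C : Set V} (hR : Linked (Col c 1) C)
    (ht : ∀ u ∈ C, ∀ v ∈ C, u ≠ v → c u v / 2 ≠ 0) {x y z s : V} (hxC : x ∈ C) (hyC : y ∈ C)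
    (hzC : z ∈ C) (hsC : s ∈ C) (hxy : c x y = 2) (hyz : c y z = 2) (hzx : c z x = 2)
    (h1 : c s x / 2 = 2) (h2 : c s y = c s x) (h3 : c s z = c s x) : False := by
  have hx : x ∉ {u | u ∈ C ∧ c u x / 2 = 2 ∧ c u y = c u x ∧ c u z = c u x} := by
    intro h
    have := h.2.1
    rw [hc.diag] at this
    omega
  obtain ⟨u, ⟨-, hu, huy, huz⟩, w, ⟨hwC, hw⟩, huw⟩ :=
    hR {u | u ∈ C ∧ c u x / 2 = 2 ∧ c u y = c u x ∧ c u z = c u x} (fun _ h => h.1)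
    ⟨s, hsC, h1, h2, h3⟩ (fun h => hx (by rw [h]; exact hxC))
  have huw' : c u w / 2 = 1 := huw
  have hw' : ¬ (c w x / 2 = 2 ∧ c w y = c w x ∧ c w z = c w x) :=
    fun h => hw ⟨hwC, h⟩
  have fxw := hc.flip_div x w
  have fuw := hc.flip_div u w
  have nx := ht w hwC x hxC (by rintro rfl; omega)
  have ny := ht w hwC y hyC (by rintro rfl; omega)
  have nz := ht w hwC z hzC (by rintro rfl; omega)
  have fx := hc.flip_eq w x
  have fy := hc.flip_eq w y
  have fz := hc.flip_eq w z
  have key : ¬ (c w y = 2 ∧ c w z = 3) := fun h =>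
    hc.not_blue_over_two (u := u) (w := w) (y := y) (z := z) (by omega) (by omega) h.1 hyz
      (by omega) huw'
  have key2 : ¬ (c w z = 2 ∧ c w x = 3) := fun h =>
    hc.not_blue_over_two (u := u) (w := w) (y := z) (z := x) (by omega) (by omega) h.1 hzx
      (by omega) huw'
  have key3 : ¬ (c w x = 2 ∧ c w y = 3) := fun h =>
    hc.not_blue_over_two (u := u) (w := w) (y := x) (z := y) (by omega) (by omega) h.1 hxy
      (by omega) huw'
  clear fxw fuw
  by_cases bx : c w x / 2 = 2
  · rcases hc.red_cycle hxy hyz hzx bx ny nz with h | h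
    · exact hw' ⟨bx, h⟩
    · exact key h
  by_cases bby : c w y / 2 = 2
  · rcases hc.red_cycle hyz hzx hxy bby nz nx with h | h
    · exact hw' ⟨by omega, by omega, by omega⟩
    · exact key2 h
  by_cases bz : c w z / 2 = 2
  · rcases hc.red_cycle hzx hxy hyz bz nx ny with h | h
    · exact hw' ⟨by omega, by omega, by omega⟩
    · exact key3 h
  have e : c w y = c w x ∧ c w z = c w x := by
    have kx : c w x = 2 ∨ c w x = 3 := by omega
    have ky : c w y = 2 ∨ c w y = 3 := by omega
    have kz : c w z = 2 ∨ c w z = 3 := by omega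
    clear fx fy fz nx ny nz bx bby bz hw' hu huy huz
    omega
  exact hc.two_uniform (x := x) (y := y) (z := z) (p := w) (t := u) (.inl hxy) (.inl hyz)
    (.inl hzx) (by omega) e.1 e.2 hu huy huz

theorem Good.no_red_cycle (hc : Good c) (hR : Linked (Col c 1) Set.univ)
    (hB : Linked (Col c 2) Set.univ) (ht : ∀ u v, u ≠ v → c u v / 2 ≠ 0) {x y z : V}
    (hxy : c x y = 2) (hyz : c y z = 2) (hzx : c z x = 2) : False := by
  obtain ⟨x, -, s, -, hxy, hzx, h1, h2, h3⟩ := hc.exists_blue_over hB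
    (fun u _ v _ => ht u v) trivial trivial trivial hxy hyz hzx
  exact hc.no_blue_over hR (fun u _ v _ => ht u v) trivial trivial trivial trivial hxy hyz hzx
    h1 h2 h3

/-- In a tournament connected by reversed pairs, no agreeing vertex lies uniformly over a reversed
cyclic triangle. -/
theorem Good.no_red_over (hc : Good c) {C : Set V} (hB : Linked (Col c 2) C)
    (ht : ∀ u ∈ C, ∀ v ∈ C, u ≠ v → c u v / 2 ≠ 0) {x y z s : V} (hxC : x ∈ C) (hyC : y ∈ C)
    (hzC : z ∈ C) (hsC : s ∈ C) (hxy : c x y = 4) (hyz : c y z = 4) (hzx : c z x = 4)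
    (h1 : c s x / 2 = 1) (h2 : c s y = c s x) (h3 : c s z = c s x) : False := by
  have hp := fun u v => pairSwap_div (hc.lt u v)
  exact hc.swap.no_blue_over (C := C) (by rw [hc.col_swap_one]; exact hB)
    (fun u hu v hv huv h => ht u hu v hv huv ((hp u v).1.1 h)) hxC hyC hzC hsC
    ((hp _ _).2.2.2.2.2.1.2 hxy) ((hp _ _).2.2.2.2.2.1.2 hyz) ((hp _ _).2.2.2.2.2.1.2 hzx)
    ((hp _ _).2.2.1.2 h1) ((pairSwap_inj (hc.lt _ _) (hc.lt _ _)).2 h2)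
    ((pairSwap_inj (hc.lt _ _) (hc.lt _ _)).2 h3)

theorem Good.no_neutral (hc : Good c) (hR : Linked (Col c 1) Set.univ)
    (hB : Linked (Col c 2) Set.univ) {a b : V} (hab : a ≠ b) : c a b / 2 ≠ 0 := by
  intro h
  refine hc.gallai.no_third (i := 1) (j := 2) (k := 0) (by omega) (by omega) (by omega) (by omega)
    (by omega) (by omega) hab h (p := fun v => c v a = c v b) ?_ hR hB
  intro v w h1 h2 h3 h4
  have := hc.peak hab h h1 h2 h3 h4
  tauto

theorem Good.no_cycle (hc : Good c) (hR : Linked (Col c 1) Set.univ)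
    (hB : Linked (Col c 2) Set.univ) {x y z : V}
    (hxy : c x y = 2 ∨ c x y = 4) (hyz : c y z = 2 ∨ c y z = 4) (hzx : c z x = 2 ∨ c z x = 4) :
    False := by
  have ht : ∀ u v, u ≠ v → c u v / 2 ≠ 0 := fun u v => hc.no_neutral hR hB
  obtain ⟨e1, e2⟩ := hc.cycle hxy hyz hzx
  have hp := fun u v => pairSwap_div (hc.lt u v)
  rcases hxy with h | h
  · exact hc.no_red_cycle hR hB ht h (by omega) (by omega : c z x = 2)
  · refine hc.swap.no_red_cycle (x := x) (y := y) (z := z) (by rw [hc.col_swap_one]; exact hB)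
      (by rw [hc.col_swap_two]; exact hR)
      (fun u v huv h => ht u v huv ((hp u v).1.1 h)) ?_ ?_ ?_
    · exact (hp _ _).2.2.2.2.2.1.2 h
    · exact (hp _ _).2.2.2.2.2.1.2 (by omega)
    · exact (hp _ _).2.2.2.2.2.1.2 (by omega)

end Good

theorem cycle_snd_aux : ∀ x ∈ [2, 5], ∀ y ∈ [2, 5], ∀ z ∈ [2, 5],
    hemiLevels [3] (table3 x (pairFlip z) y) = true → x = y ∧ y = z := by decide +kernel

/-- A cyclic triangle in the second digraph is also one, up to direction, in the first one. -/
theorem Good.cycle_snd {c : V → V → ℕ} (hc : Good c) {x y z : V} (h1 : c x y = 2 ∨ c x y = 5)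
    (h2 : c y z = 2 ∨ c y z = 5) (h3 : c z x = 2 ∨ c z x = 5) :
    c x y = c y z ∧ c y z = c z x := by
  refine cycle_snd_aux _ (by simpa using h1) _ (by simpa using h2) _ (by simpa using h3) ?_
  rw [← hc.flip]
  refine hc.table3 [3] x y z ?_
  simp [hc.ne (u := x) (v := y) (by omega), (hc.ne (u := z) (v := x) (by omega)).symm,
    hc.ne (u := y) (v := z) (by omega)]

section Coded

variable {G H : Dgraph V} {c : V → V → ℕ}

theorem Coded.chainOn_fst (hc : Coded G H c) {X : Set V}
    (ht : ∀ u ∈ X, ∀ v ∈ X, u ≠ v → c u v / 2 ≠ 0)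
    (hcyc : ∀ x ∈ X, ∀ y ∈ X, ∀ z ∈ X, (c x y = 2 ∨ c x y = 4) → (c y z = 2 ∨ c y z = 4) →
      (c z x = 2 ∨ c z x = 4) → False) : ChainOn G X := by
  have harc : ∀ u ∈ X, ∀ v ∈ X, G.Arc u v → c u v = 2 ∨ c u v = 4 := by
    intro u hu v hv h
    by_cases huv : u = v
    · subst huv
      exact absurd h (G.irrefl u)
    · have := ht u hu v hv huv
      rw [hc.fst] at h
      omega
  refine ⟨fun u hu v hv huv => ?_, fun x hx y hy z hz h1 h2 h3 => ?_⟩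
  · have := ht u hu v hv huv
    have := hc.flip_eq u v
    unfold Dir
    rw [hc.fst, hc.fst]
    omega
  · exact hcyc x hx y hy z hz (harc x hx y hy h1) (harc y hy z hz h2) (harc z hz x hx h3)

theorem Coded.chainOn_snd (hc : Coded G H c) {X : Set V}
    (ht : ∀ u ∈ X, ∀ v ∈ X, u ≠ v → c u v / 2 ≠ 0)
    (hcyc : ∀ x ∈ X, ∀ y ∈ X, ∀ z ∈ X, (c x y = 2 ∨ c x y = 4) → (c y z = 2 ∨ c y z = 4) →
      (c z x = 2 ∨ c z x = 4) → False) : ChainOn H X := by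
  have hp := fun u v => pairSwap_div (hc.lt u v)
  have hfun : ∀ u v, H.Arc u v → u ∈ X → v ∈ X → c u v = 2 ∨ c u v = 5 := by
    intro u v h hu hv
    by_cases huv : u = v
    · subst huv
      exact absurd h (H.irrefl u)
    · have := ht u hu v hv huv
      rw [hc.snd] at h
      omega
  refine ⟨fun u hu v hv huv => ?_, fun x hx y hy z hz h1 h2 h3 => ?_⟩
  · have := ht u hu v hv huv
    have := hc.flip_eq u v
    unfold Dir
    rw [hc.snd, hc.snd]
    omega
  · have k1 := hfun _ _ h1 hx hy
    have k2 := hfun _ _ h2 hy hz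
    have k3 := hfun _ _ h3 hz hx
    obtain ⟨e1, e2⟩ := hc.cycle_snd k1 k2 k3
    rcases k1 with k1 | k1
    · exact hcyc x hx y hy z hz (.inl k1) (.inl (by omega)) (.inl (by omega))
    · have f1 := hc.flip_eq x y
      have f2 := hc.flip_eq y z
      have f3 := hc.flip_eq z x
      exact hcyc y hy x hx z hz (.inr (by omega)) (.inr (by omega)) (.inr (by omega))

end Coded


/-! Small diamond-free tournaments. -/

/-- `G[X]` is a tournament in which no vertex dominates, or is dominated by, a cyclic triangle. -/
def DFTOn (G : Dgraph V) (X : Set V) : Prop :=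
  (∀ x ∈ X, ∀ y ∈ X, x ≠ y → G.Dir x y) ∧
  ∀ x ∈ X, ∀ y ∈ X, ∀ z ∈ X, ∀ t ∈ X, G.Arc x y → G.Arc y z → G.Arc z x →
    ¬ (G.Arc t x ∧ G.Arc t y ∧ G.Arc t z) ∧ ¬ (G.Arc x t ∧ G.Arc y t ∧ G.Arc z t)

theorem DFTOn.mono {G : Dgraph V} {X Y : Set V} (h : DFTOn G X) (hY : Y ⊆ X) : DFTOn G Y :=
  ⟨fun x hx y hy => h.1 x (hY hx) y (hY hy),
    fun x hx y hy z hz t ht => h.2 x (hY hx) y (hY hy) z (hY hz) t (hY ht)⟩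

theorem DFTOn.dual {G : Dgraph V} {X : Set V} (h : DFTOn G X) : DFTOn G.dual X :=
  ⟨fun x hx y hy hxy => (h.1 x hx y hy hxy).symm,
    fun x hx y hy z hz t ht h1 h2 h3 => by
      have := h.2 y hy x hx z hz t ht h1 h3 h2
      exact ⟨fun h => this.2 ⟨h.2.1, h.1, h.2.2⟩, fun h => this.1 ⟨h.2.1, h.1, h.2.2⟩⟩⟩

/-- Whether a tournament on four vertices is a diamond. -/
def diamondTest (x01 x02 x03 x12 x13 x23 : ℕ) : Bool :=
  (Nat.beq x01 x02 && Nat.beq x02 x03 && Nat.beq x12 x23 && Nat.beq x13 (pairFlip x12)) ||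
  (Nat.beq (pairFlip x01) x12 && Nat.beq x12 x13 && Nat.beq x02 x23 &&
    Nat.beq x03 (pairFlip x02)) ||
  (Nat.beq x02 x12 && Nat.beq (pairFlip x12) x23 && Nat.beq x01 x13 &&
    Nat.beq x03 (pairFlip x01)) ||
  (Nat.beq x03 x13 && Nat.beq x13 x23 && Nat.beq x01 x12 && Nat.beq x02 (pairFlip x01))

/-- Whether the two digraphs on `k` vertices encoded by a table of types are isomorphic. -/
def isoTest (k : ℕ) (t : List (List ℕ)) : Bool :=
  permSearch (fun i j x y => Nat.beq (pairFst (entry t i j)) (pairSnd (entry t x y))) k k 0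
    (fun _ => 0)

theorem selfDual_three : ∀ x01 ∈ [4, 5], ∀ x02 ∈ [4, 5], ∀ x12 ∈ [4, 5],
    isoTest 3 (table3 x01 x02 x12) = true := by decide +kernel

theorem selfDual_four : ∀ x01 ∈ [4, 5], ∀ x02 ∈ [4, 5], ∀ x03 ∈ [4, 5], ∀ x12 ∈ [4, 5],
    ∀ x13 ∈ [4, 5], ∀ x23 ∈ [4, 5], diamondTest x01 x02 x03 x12 x13 x23 = false →
    isoTest 4 (table4 x01 x02 x03 x12 x13 x23) = true := by decide +kernel

theorem selfDual_five : ∀ x01 ∈ [4, 5], ∀ x02 ∈ [4, 5], ∀ x03 ∈ [4, 5], ∀ x12 ∈ [4, 5],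
    ∀ x13 ∈ [4, 5], ∀ x23 ∈ [4, 5], diamondTest x01 x02 x03 x12 x13 x23 = false →
    ∀ x04 ∈ [4, 5], ∀ x14 ∈ [4, 5], ∀ x24 ∈ [4, 5],
    diamondTest x01 x02 x04 x12 x14 x24 = false → ∀ x34 ∈ [4, 5],
    diamondTest x01 x03 x04 x13 x14 x34 = false → diamondTest x02 x03 x04 x23 x24 x34 = false →
    diamondTest x12 x13 x14 x23 x24 x34 = false →
    isoTest 5 (table5 x01 x02 x03 x04 x12 x13 x14 x23 x24 x34) = true := by decide +kernel

theorem LeHemi.refl (k : ℕ) (G : Dgraph V) : LeHemi k G G :=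
  fun _ _ _ _ _ _ => .inl (Iso.refl _)

theorem entry_map (vs : List V) (a : V) (c : V → V → ℕ) {i j : ℕ} (hi : i < vs.length)
    (hj : j < vs.length) : entry (vs.map fun u => vs.map (c u)) i j = c (vs.getD i a) (vs.getD j a) := by
  have h1 : (vs.map fun u => vs.map (c u)).getD i [] = vs.map (c (vs.getD i a)) := by
    rw [List.getD_eq_getElem _ _ (by rw [List.length_map]; exact hi), List.getElem_map,
      List.getD_eq_getElem _ _ hi]
  rw [entry, h1, List.getD_eq_getElem _ _ (by rw [List.length_map]; exact hj),
    List.getElem_map, List.getD_eq_getElem _ _ hj]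

theorem bijOn_self {α : Type*} {X : Set α} {g : α → α} (hX : X.Finite) (h : Set.MapsTo g X X)
    (hg : Set.InjOn g X) : Set.BijOn g X X := by
  refine ⟨h, hg, ?_⟩
  have : g '' X = X := Set.eq_of_subset_of_ncard_le h.image_subset
    (Set.InjOn.ncard_image hg).ge hX
  exact this.ge

theorem Coded.isoOn_of_isoTest {G H : Dgraph V} {c : V → V → ℕ} (hc : Coded G H c) {vs : List V}
    (hvs : vs.Nodup) (h : isoTest vs.length (vs.map fun u => vs.map (c u)) = true) :
    IsoOn G H {u | u ∈ vs} {u | u ∈ vs} := by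
  classical
  rcases vs.eq_nil_or_concat with hnil | ⟨_, a, -⟩
  · subst hnil
    exact ⟨id, by simp [Set.bijOn_empty_iff_left], by simp⟩
  obtain ⟨f, hf⟩ := permSearch_iff.1 h
  set g : V → V := fun x => vs.getD (f (vs.idxOf x)) a with hg
  have hidx : ∀ x ∈ vs, vs.idxOf x < vs.length := fun x hx => List.idxOf_lt_length_of_mem hx
  have hget : ∀ x ∈ vs, vs.getD (vs.idxOf x) a = x := by
    intro x hx
    rw [List.getD_eq_getElem _ _ (hidx x hx), List.getElem_idxOf]
  have hmaps : Set.MapsTo g {u | u ∈ vs} {u | u ∈ vs} := by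
    intro x hx
    have := (hf _ (hidx x hx)).1
    simp only [hg, Set.mem_ofPred_eq, List.getD_eq_getElem _ _ this]
    exact List.getElem_mem _
  have hfinj : ∀ i < vs.length, ∀ j < vs.length, f i = f j → i = j := by
    intro i hi j hj hij
    rcases lt_trichotomy i j with hlt | rfl | hlt
    · exact absurd hij ((hf j hj).2 i hlt).1
    · rfl
    · exact absurd hij.symm ((hf i hi).2 j hlt).1
  have hinj : Set.InjOn g {u | u ∈ vs} := by
    intro x hx y hy hxy
    have h1 := (hf _ (hidx x hx)).1
    have h2 := (hf _ (hidx y hy)).1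
    simp only [hg, List.getD_eq_getElem _ _ h1, List.getD_eq_getElem _ _ h2] at hxy
    have h3 := hfinj _ (hidx x hx) _ (hidx y hy) ((List.Nodup.getElem_inj_iff hvs).1 hxy)
    rw [← hget x hx, h3, hget y hy]
  have hfin : {u | u ∈ vs}.Finite := List.finite_toSet vs
  refine ⟨g, bijOn_self hfin hmaps hinj, ?_⟩
  have key : ∀ x ∈ vs, ∀ y ∈ vs, vs.idxOf y < vs.idxOf x →
      pairFst (c x y) = pairSnd (c (g x) (g y)) := by
    intro x hx y hy hlt
    have h1 := ((hf _ (hidx x hx)).2 _ hlt).2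
    rw [Nat.beq_eq] at h1
    rw [entry_map vs a _ (hidx x hx) (hidx y hy), entry_map vs a _ (hf _ (hidx x hx)).1
      (hf _ (hidx y hy)).1, hget x hx, hget y hy] at h1
    exact h1
  have key2 : ∀ m < 6, ∀ n < 6, pairFst m = pairSnd n →
      ((m = 1 ∨ m = 2 ∨ m = 4 ↔ n = 1 ∨ n = 2 ∨ n = 5) ∧
      (m = 1 ∨ m = 3 ∨ m = 5 ↔ n = 1 ∨ n = 3 ∨ n = 4)) := by
    intro m hm n hn
    interval_cases m <;> interval_cases n <;> simp [pairFst, pairSnd]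
  intro x hx y hy
  rw [hc.fst, hc.snd]
  rcases lt_trichotomy (vs.idxOf x) (vs.idxOf y) with hlt | he | hlt
  · have h1 := (key2 _ (hc.lt _ _) _ (hc.lt _ _) (key y hy x hx hlt)).2
    have f1 := hc.flip_eq x y
    have f2 := hc.flip_eq (g x) (g y)
    omega
  · have : x = y := by rw [← hget x hx, he, hget y hy]
    subst this
    rw [hc.diag, hc.diag]
    omega
  · exact (key2 _ (hc.lt _ _) _ (hc.lt _ _) (key x hx y hy hlt)).1

/-- The types of pairs in a digraph and its dual. -/
noncomputable def dualCode (G : Dgraph V) (u v : V) : ℕ := pairSwap (code G G u v)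

theorem coded_dualCode (G : Dgraph V) : Coded G G.dual (dualCode G) := (LeHemi.refl 6 G).coded.swap

theorem DFTOn.not_uniform {G : Dgraph V} {X : Set V} (h : DFTOn G X) {x y z t : V}
    (hx : x ∈ X) (hy : y ∈ X) (hz : z ∈ X) (ht : t ∈ X) (h1 : dualCode G t x = 4 ∨ dualCode G t x = 5)
    (h2 : dualCode G t y = dualCode G t x) (h3 : dualCode G t z = dualCode G t x)
    (h4 : dualCode G x y = 4 ∨ dualCode G x y = 5) (h5 : dualCode G y z = dualCode G x y)
    (h6 : dualCode G z x = dualCode G x y) : False := by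
  have hc := coded_dualCode G
  have a1 := h.2 x hx y hy z hz t ht
  have a2 := h.2 y hy x hx z hz t ht
  simp only [hc.fst] at a1 a2
  have f1 := hc.flip_eq t x
  have f2 := hc.flip_eq t y
  have f3 := hc.flip_eq t z
  have f4 := hc.flip_eq x y
  have f5 := hc.flip_eq y z
  have f6 := hc.flip_eq z x
  rcases h4 with h4 | h4
  · have := a1 (by omega) (by omega) (by omega)
    rcases h1 with h1 | h1
    · exact this.1 ⟨by omega, by omega, by omega⟩
    · exact this.2 ⟨by omega, by omega, by omega⟩
  · have := a2 (by omega) (by omega) (by omega)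
    rcases h1 with h1 | h1
    · exact this.1 ⟨by omega, by omega, by omega⟩
    · exact this.2 ⟨by omega, by omega, by omega⟩

theorem DFTOn.code_eq {G : Dgraph V} {X : Set V} (h : DFTOn G X) {x y : V}
    (hx : x ∈ X) (hy : y ∈ X) (hxy : x ≠ y) : dualCode G x y = 4 ∨ dualCode G x y = 5 := by
  have := h.1 x hx y hy hxy
  unfold Dir at this
  unfold dualCode code
  split_ifs <;> simp_all [pairSwap]

theorem DFTOn.not_diamondTest {G : Dgraph V} {X : Set V} (h : DFTOn G X) {x y z t : V}
    (hx : x ∈ X) (hy : y ∈ X) (hz : z ∈ X) (ht : t ∈ X) (hxy : x ≠ y) (hxz : x ≠ z) (hxt : x ≠ t)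
    (hyz : y ≠ z) (hyt : y ≠ t) (hzt : z ≠ t) :
    diamondTest (dualCode G x y) (dualCode G x z) (dualCode G x t) (dualCode G y z) (dualCode G y t)
      (dualCode G z t) = false := by
  have hc := coded_dualCode G
  by_contra htest
  rw [Bool.not_eq_false, diamondTest] at htest
  simp only [Bool.or_eq_true, Bool.and_eq_true, Nat.beq_eq, ← hc.flip] at htest
  have c1 := h.code_eq hx hy hxy
  have c2 := h.code_eq hx hz hxz
  have c3 := h.code_eq hx ht hxt
  have c4 := h.code_eq hy hz hyz
  have c5 := h.code_eq hy ht hyt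
  have c6 := h.code_eq hz ht hzt
  have f1 := hc.flip_eq x y
  have f2 := hc.flip_eq x z
  have f3 := hc.flip_eq x t
  have f4 := hc.flip_eq y z
  have f5 := hc.flip_eq y t
  have f6 := hc.flip_eq z t
  rcases htest with ((⟨⟨⟨h1, h2⟩, h3⟩, h4⟩ | ⟨⟨⟨h1, h2⟩, h3⟩, h4⟩) | ⟨⟨⟨h1, h2⟩, h3⟩, h4⟩) |
    ⟨⟨⟨h1, h2⟩, h3⟩, h4⟩
  · exact h.not_uniform hy hz ht hx c1 (by omega) (by omega) c4 (by omega) (by omega)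
  · exact h.not_uniform hx hz ht hy (by omega) (by omega) (by omega) c2 (by omega) (by omega)
  · exact h.not_uniform hx hy ht hz (by omega) (by omega) (by omega) c1 (by omega) (by omega)
  · exact h.not_uniform hx hy hz ht (by omega) (by omega) (by omega) c1 (by omega) (by omega)

/-- Diamond-free tournaments on at most five vertices are self-dual. -/
theorem DFTOn.isoOn_dual {G : Dgraph V} {X : Set V} (h : DFTOn G X) (hX : X.Finite)
    (hcard : X.ncard ≤ 5) : IsoOn G G.dual X X := by
  have hc := coded_dualCode G
  obtain ⟨vs, hvs, rfl⟩ : ∃ vs : List V, vs.Nodup ∧ X = {u | u ∈ vs} :=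
    ⟨hX.toFinset.toList, Finset.nodup_toList _, by ext; simp⟩
  have hlen : vs.length ≤ 5 := by
    classical
    have h1 := List.toFinset_card_of_nodup hvs
    rw [← Set.ncard_coe_finset, List.coe_toFinset] at h1
    omega
  have hmem : ∀ {x y}, x ∈ vs → y ∈ vs → x ≠ y → dualCode G x y ∈ [4, 5] := by
    intro x y hx hy hxy
    have := h.code_eq (x := x) (y := y) hx hy hxy
    simpa using this
  rcases vs with _ | ⟨x, _ | ⟨y, _ | ⟨z, _ | ⟨t, _ | ⟨s, _ | ⟨r, l⟩⟩⟩⟩⟩⟩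
  · exact ⟨id, by simp [Set.bijOn_empty_iff_left], by simp⟩
  · refine ⟨id, Set.bijOn_id _, ?_⟩
    simp [G.irrefl, Dgraph.dual]
  · refine ChainOn.isoOn hX hX rfl ⟨h.1, ?_⟩ (ChainOn.dual ⟨h.1, ?_⟩) <;>
    · intro a ha b hb d hd h1 h2 h3
      have d1 : a ≠ b := by rintro rfl; exact G.irrefl _ h1
      have d2 : b ≠ d := by rintro rfl; exact G.irrefl _ h2
      have d3 : d ≠ a := by rintro rfl; exact G.irrefl _ h3
      simp at ha hb hd
      grind
  · refine hc.isoOn_of_isoTest hvs ?_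
    have e := selfDual_three (dualCode G x y) ?_ (dualCode G x z) ?_ (dualCode G y z) ?_
    · simp only [table3, ← hc.flip] at e
      simpa only [List.map_cons, List.map_nil, hc.diag, List.length_cons, List.length_nil] using e
    all_goals
      simp only [List.nodup_cons, List.mem_cons, not_or] at hvs
      exact hmem (by simp) (by simp) (by tauto)
  · refine hc.isoOn_of_isoTest hvs ?_
    have e := selfDual_four (dualCode G x y) ?_ (dualCode G x z) ?_ (dualCode G x t) ?_ (dualCode G y z) ?_
      (dualCode G y t) ?_ (dualCode G z t) ?_ ?_
    · simp only [table4, ← hc.flip] at e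
      simpa only [List.map_cons, List.map_nil, hc.diag, List.length_cons, List.length_nil] using e
    all_goals
      simp only [List.nodup_cons, List.mem_cons, not_or] at hvs
    on_goal 7 => refine h.not_diamondTest (by simp) (by simp) (by simp) (by simp) ?_ ?_ ?_ ?_ ?_ ?_
    iterate 6 exact hmem (by simp) (by simp) (by tauto)
    all_goals tauto
  · refine hc.isoOn_of_isoTest hvs ?_
    have e := selfDual_five (dualCode G x y) ?_ (dualCode G x z) ?_ (dualCode G x t) ?_ (dualCode G y z) ?_
      (dualCode G y t) ?_ (dualCode G z t) ?_ ?_ (dualCode G x s) ?_ (dualCode G y s) ?_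
      (dualCode G z s) ?_ ?_ (dualCode G t s) ?_ ?_ ?_ ?_
    · simp only [table5, ← hc.flip] at e
      simpa only [List.map_cons, List.map_nil, hc.diag, List.length_cons, List.length_nil] using e
    all_goals
      simp only [List.nodup_cons, List.mem_cons, not_or] at hvs
      first
        | exact hmem (by simp) (by simp) (by tauto)
        | exact h.not_diamondTest (by simp) (by simp) (by simp) (by simp) (by tauto) (by tauto)
            (by tauto) (by tauto) (by tauto) (by tauto)
  · simp only [List.length_cons] at hlen
    omega


/-! Blue components seen from a vertex joined to them by arcs of a single red type. -/

/-- `C` is linked by blue pairs and `w` is joined to all of `C` by one type of red arcs. -/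
structure BlueOver (c : V → V → ℕ) (w : V) (C : Set V) : Prop where
  linked : Linked (Col c 2) C
  red : ∀ u ∈ C, c w u / 2 = 1
  eq : ∀ u ∈ C, ∀ v ∈ C, c w u = c w v

section BlueOver

variable {c : V → V → ℕ} {w : V} {C : Set V}

theorem BlueOver.no_uniform_blue (hc : Good c) (h : BlueOver c w C) {x y z t : V} (hx : x ∈ C)
    (hy : y ∈ C) (hz : z ∈ C) (h1 : c x y = 2 ∨ c x y = 4) (h2 : c y z = 2 ∨ c y z = 4)
    (h3 : c z x = 2 ∨ c z x = 4) (h4 : c t x / 2 = 2) (h5 : c t y = c t x) (h6 : c t z = c t x) :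
    False :=
  hc.two_uniform h1 h2 h3 (h.red x hx) (h.eq y hy x hx) (h.eq z hz x hx) h4 h5 h6

theorem BlueOver.cycle_blue (hc : Good c) (h : BlueOver c w C)
    (ht : ∀ u ∈ C, ∀ v ∈ C, u ≠ v → c u v / 2 ≠ 0) {x y z : V} (hx : x ∈ C)
    (hy : y ∈ C) (hz : z ∈ C) (h1 : c x y = 2 ∨ c x y = 4) (h2 : c y z = 2 ∨ c y z = 4)
    (h3 : c z x = 2 ∨ c z x = 4) : c x y = 4 ∧ c y z = 4 ∧ c z x = 4 := by
  obtain ⟨e1, e2⟩ := hc.cycle h1 h2 h3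
  rcases h1 with h1 | h1
  · obtain ⟨t, htC, s, hs, a1, a2, a3, a4, a5⟩ :=
      hc.exists_blue_over h.linked ht hx hy hz h1 (by omega) (by omega)
    exact (h.no_uniform_blue hc htC hy hz (.inl a1) (.inl (by omega)) (.inl a2) a3 a4 a5).elim
  · omega

theorem BlueOver.code_uniform (hc : Good c) (h : BlueOver c w C)
    (ht : ∀ u ∈ C, ∀ v ∈ C, u ≠ v → c u v / 2 ≠ 0) {x y z t : V} (hx : x ∈ C)
    (hy : y ∈ C) (hz : z ∈ C) (htC : t ∈ C) (h1 : c x y = 4) (h2 : c y z = 4) (h3 : c z x = 4)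
    (hxt : t ≠ x) (h4 : c t y = c t x) (h5 : c t z = c t x) : False := by
  have := ht t htC x hx hxt
  have := hc.lt t x
  by_cases h6 : c t x / 2 = 2
  · exact h.no_uniform_blue hc hx hy hz (.inr h1) (.inr h2) (.inr h3) h6 h4 h5
  · exact hc.no_red_over h.linked ht hx hy hz htC h1 h2 h3 (by omega) h4 h5

theorem BlueOver.dftOn {G H : Dgraph V} (hc : Coded G H c) (h : BlueOver c w C)
    (ht : ∀ u ∈ C, ∀ v ∈ C, u ≠ v → c u v / 2 ≠ 0) : DFTOn G C := by
  have harc : ∀ u ∈ C, ∀ v ∈ C, G.Arc u v → c u v = 2 ∨ c u v = 4 := by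
    intro u hu v hv h
    by_cases huv : u = v
    · subst huv
      exact absurd h (G.irrefl u)
    · have := ht u hu v hv huv
      rw [hc.fst] at h
      omega
  refine ⟨fun u hu v hv huv => ?_, fun x hx y hy z hz t htC h1 h2 h3 => ?_⟩
  · have := ht u hu v hv huv
    have := hc.flip_eq u v
    unfold Dir
    rw [hc.fst, hc.fst]
    omega
  · have k1 := harc x hx y hy h1
    have k2 := harc y hy z hz h2
    have k3 := harc z hz x hx h3
    obtain ⟨b1, b2, b3⟩ := h.cycle_blue hc.toGood ht hx hy hz k1 k2 k3
    constructor
    · rintro ⟨h4, h5, h6⟩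
      have k4 := harc t htC x hx h4
      obtain ⟨e1, e2⟩ := hc.dominating k1 k2 k3 k4 (harc t htC y hy h5) (harc t htC z hz h6)
      exact h.code_uniform hc.toGood ht hx hy hz htC b1 b2 b3 (hc.ne (by omega)) e1.symm (by omega)
    · rintro ⟨h4, h5, h6⟩
      have k4 := harc x hx t htC h4
      obtain ⟨e1, e2⟩ := hc.dominated k1 k2 k3 k4 (harc y hy t htC h5) (harc z hz t htC h6)
      have f1 := hc.flip_eq x t
      have f2 := hc.flip_eq y t
      have f3 := hc.flip_eq z t
      exact h.code_uniform hc.toGood ht hx hy hz htC b1 b2 b3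
        (hc.ne (u := t) (v := x) (by omega)) (by omega) (by omega)

theorem Good.uniform_of_linked (hc : Good c) {i : ℕ} {Z : Set V} {z : V} (hi : i ≠ 0)
    (hZ : Linked (Col c i) Z) (hz : ∀ u ∈ Z, c z u / 2 ≠ 0 ∧ c z u / 2 ≠ i) {u v : V} (hu : u ∈ Z)
    (hv : v ∈ Z) : c z u = c z v := by
  refine (hZ.induction (P := fun v => c z u = c z v) hu rfl ?_ v hv)
  intro a ha b hb hab hr
  have h1 := hz a ha
  have h2 := hz b hb
  have h3 := hc.lt z a
  have h4 := hc.lt z b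
  have h5 := hc.lt a b
  have h6 : c a b / 2 = i := hr
  rw [hab]
  exact hc.uniform (by omega) (by omega) (by omega) (by omega)

theorem BlueOver.isoOn_dual {G H : Dgraph V} (hc : Coded G H c) (h : BlueOver c w C)
    (ht : ∀ u ∈ C, ∀ v ∈ C, u ≠ v → c u v / 2 ≠ 0) {Y : Set V} (hY : Y.Finite) (hYC : Y ⊆ C) :
    IsoOn G H.dual Y Y := by
  have hr := Reach.equivalence (X := C) (hc.col_symm 1)
  refine IsoOn.glue (Reach (Col c 1) C) hr ?_ ?_
  · intro p hp
    have hsub : Y ∩ {y | Reach (Col c 1) C p y} ⊆ C := fun v hv => hYC hv.1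
    have hfin := hY.subset (Set.inter_subset_left (t := {y | Reach (Col c 1) C p y}))
    have ht' : ∀ u ∈ Y ∩ {y | Reach (Col c 1) C p y}, ∀ v ∈ Y ∩ {y | Reach (Col c 1) C p y},
      u ≠ v → c u v / 2 ≠ 0 := fun u hu v hv => ht u (hsub hu) v (hsub hv)
    have hcyc : ∀ x ∈ Y ∩ {y | Reach (Col c 1) C p y}, ∀ y ∈ Y ∩ {y | Reach (Col c 1) C p y},
        ∀ z ∈ Y ∩ {y | Reach (Col c 1) C p y}, (c x y = 2 ∨ c x y = 4) →
        (c y z = 2 ∨ c y z = 4) → (c z x = 2 ∨ c z x = 4) → False := by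
      intro x hx y hy z hz h1 h2 h3
      obtain ⟨b1, b2, b3⟩ := h.cycle_blue hc.toGood ht (hsub hx) (hsub hy) (hsub hz) h1 h2 h3
      have hMC : ∀ v, Reach (Col c 1) C p v → v ∈ C := fun v hv => Reach.mem (hYC hp) hv
      obtain ⟨t, htM, s, hsM, a1, a2, a3, a4, a5⟩ :=
        hc.toGood.exists_red_over (linked_reach (hc.col_symm 1) p)
          (fun u hu v hv => ht u (hMC u hu) v (hMC v hv)) hx.2 hy.2 hz.2 b1 b2 b3
      exact hc.no_red_over h.linked ht (hMC t htM) (hsub hy) (hsub hz) (hMC s hsM) a1 b2 a2 a3 a4 a5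
    exact ChainOn.isoOn hfin hfin rfl (hc.chainOn_fst ht' hcyc) (hc.chainOn_snd ht' hcyc).dual
  · have hblue : ∀ u ∈ C, ∀ v ∈ C, ¬ Reach (Col c 1) C u v → c u v / 2 ≠ 0 ∧ c u v / 2 ≠ 1 := by
      intro u hu v hv huv
      refine ⟨ht u hu v hv ?_, fun h1 => huv (Reach.step hu hv h1)⟩
      rintro rfl
      exact huv (hr.refl u)
    have hcon : ∀ x ∈ C, ∀ y ∈ C, ∀ y' ∈ C, ¬ Reach (Col c 1) C x y → Reach (Col c 1) C y y' →
        c x y = c x y' := by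
      intro x hx y hy y' hy' hxy hyy'
      refine hc.uniform_of_linked one_ne_zero (linked_reach (hc.col_symm 1) y)
        (fun u hu => hblue x hx u (Reach.mem hy hu) fun hxu => hxy (hr.trans hxu (hr.symm hu)))
        (hr.refl y) hyy'
    intro x hx y hy x' hx' y' hy' hxy hxx' hyy'
    have e1 := hcon x (hYC hx) y (hYC hy) y' (hYC hy') hxy hyy'
    have e2 := hcon y' (hYC hy') x (hYC hx) x' (hYC hx')
      (fun h1 => hxy (hr.symm (hr.trans hyy' h1))) hxx'
    have f1 := hc.flip_eq x y'
    have f2 := hc.flip_eq x' y'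
    have := hblue x (hYC hx) y (hYC hy) hxy
    change _ ↔ H.Arc y' x'
    rw [hc.fst, hc.snd]
    omega

/-- Without a cyclic triangle both digraphs are chains. -/
theorem BlueOver.exists_cycle_or_isoOn {G H : Dgraph V} (hc : Coded G H c)
    (ht : ∀ u ∈ C, ∀ v ∈ C, u ≠ v → c u v / 2 ≠ 0) :
    (∃ x ∈ C, ∃ y ∈ C, ∃ z ∈ C, G.Arc x y ∧ G.Arc y z ∧ G.Arc z x) ∨
      ∀ Y : Set V, Y.Finite → Y ⊆ C → IsoOn G H Y Y := by
  by_cases hcyc : ∃ x ∈ C, ∃ y ∈ C, ∃ z ∈ C, (c x y = 2 ∨ c x y = 4) ∧ (c y z = 2 ∨ c y z = 4) ∧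
      (c z x = 2 ∨ c z x = 4)
  · obtain ⟨x, hx, y, hy, z, hz, h1, h2, h3⟩ := hcyc
    refine .inl ⟨x, hx, y, hy, z, hz, ?_, ?_, ?_⟩ <;> rw [hc.fst] <;> omega
  · refine .inr fun Y hY hYC => ?_
    have ht' : ∀ u ∈ Y, ∀ v ∈ Y, u ≠ v → c u v / 2 ≠ 0 :=
      fun u hu v hv => ht u (hYC hu) v (hYC hv)
    have hcyc' : ∀ x ∈ Y, ∀ y ∈ Y, ∀ z ∈ Y, (c x y = 2 ∨ c x y = 4) →
        (c y z = 2 ∨ c y z = 4) → (c z x = 2 ∨ c z x = 4) → False :=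
      fun x hx y hy z hz h1 h2 h3 => hcyc ⟨x, hYC hx, y, hYC hy, z, hYC hz, h1, h2, h3⟩
    exact ChainOn.isoOn hY hY rfl (hc.chainOn_fst ht' hcyc') (hc.chainOn_snd ht' hcyc')

end BlueOver


/-! Blue components whose neutral pairs are surrounded by cyclic triangles. -/

theorem isoTest_four_quadrangle : ∀ e ∈ [0, 1], ∀ r ∈ [0, 1, 4, 5],
    isoTest 4 (table4 e 4 5 5 4 r) = true := by decide +kernel

theorem isoTest_five_quadrangle : ∀ e ∈ [0, 1], ∀ r ∈ [0, 1, 4, 5], ∀ s ∈ [0, 1, 4, 5],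
    ((s = 4 ∧ r = 5) ∨ (r = e ∧ s = 4) ∨ (s = e ∧ r = 5)) →
    isoTest 5 (table5 e 4 4 5 5 5 4 4 r s) = true := by decide +kernel

theorem isoTest_six_quadrangle : ∀ e ∈ [0, 1], ∀ pm ∈ [0, 1, 4, 5], ∀ qm ∈ [0, 1, 4, 5],
    ∀ pn ∈ [0, 1, 4, 5], ∀ qn ∈ [0, 1, 4, 5],
    ((qm = 4 ∧ pm = 5) ∨ (pm = e ∧ qm = 4) ∨ (qm = e ∧ pm = 5)) →
    ((qn = 4 ∧ pn = 5) ∨ (pn = e ∧ qn = 4) ∨ (qn = e ∧ pn = 5)) →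
    ((pn = 5 ∧ pm = 4) ∨ (pm = e ∧ pn = 5) ∨ (pn = e ∧ pm = 4)) →
    ((qn = 5 ∧ qm = 4) ∨ (qm = e ∧ qn = 5) ∨ (qn = e ∧ qm = 4)) →
    isoTest 6 (table6 e 4 4 5 5 5 5 4 4 4 pm pn qm qn 4) = true := by decide +kernel

/-- Every neutral pair of `C` forms with each other vertex of `C` a path of blue arcs. -/
def Consec (c : V → V → ℕ) (C : Set V) : Prop :=
  ∀ a ∈ C, ∀ b ∈ C, a ≠ b → c a b / 2 = 0 → ∀ z ∈ C, z ≠ a → z ≠ b →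
    (c a z = 4 ∧ c z b = 4) ∨ (c b z = 4 ∧ c z a = 4)

section Neutral

variable {c : V → V → ℕ} {w : V} {C : Set V}

/-- A vertex does not form a blue peak with a neutral pair. -/
theorem BlueOver.no_peak (hc : Good c) (h : BlueOver c w C) {a b z : V} (ha : a ∈ C) (hb : b ∈ C)
    (hab : a ≠ b) (hN : c a b / 2 = 0) (h1 : c z a / 2 = 2) (h2 : c z b / 2 = 2) :
    c z a ≠ c z b := by
  rcases hc.peak hab hN (h.red a ha) (h.red b hb) h1 h2 with h3 | h3
  · exact h3.2.2
  · exact absurd (h.eq a ha b hb) h3.2.2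

theorem BlueOver.no_star (hc : Good c) (h : BlueOver c w C) {v x y z : V} (hv : v ∈ C)
    (hx : x ∈ C) (hy : y ∈ C) (hz : z ∈ C) (h5 : c v x / 2 = 2) (h6 : c v y / 2 = 2)
    (h7 : c v z / 2 = 2) (h8 : c x y / 2 = 0) (h9 : c y z / 2 = 0) (hxy : x ≠ y) (hyz : y ≠ z)
    (hxz : x ≠ z) : False :=
  hc.star (h.red v hv) (h.eq x hx v hv) (h.eq y hy v hv) (h.eq z hz v hv) h5 h6 h7 h8 h9 hxy hyz hxz

theorem Linked.exists_cut {α : V → V → Prop} {X : Set V} (h : Linked α X) {S : Set V} {x y : V}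
    (hx : x ∈ X) (hy : y ∈ X) (hxS : x ∈ S) (hyS : y ∉ S) :
    ∃ u ∈ X, ∃ v ∈ X, u ∈ S ∧ v ∉ S ∧ α u v := by
  by_contra hno
  refine hyS (h.induction (P := fun v => v ∈ S) hx hxS (fun u hu v hv huS huv => ?_) y hy)
  by_contra hvS
  exact hno ⟨u, hu, v, hv, huS, hvS, huv⟩

theorem BlueOver.consec (hc : Good c) (h : BlueOver c w C) (hC : ¬ Linked (Col c 0) C) :
    Consec c C := by
  intro a ha b hb hab hN
  set K := {v | Reach (Col c 0) C a v} with hK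
  have hr := Reach.equivalence (X := C) (hc.col_symm 0)
  have hKl : Linked (Col c 0) K := linked_reach (hc.col_symm 0) a
  have haK : a ∈ K := hr.refl a
  have hbK : b ∈ K := Reach.step ha hb hN
  have hKC : K ⊆ C := fun v hv => Reach.mem ha hv
  have hout : ∀ z ∈ C, z ∉ K → ∀ u ∈ K, c z u / 2 ≠ 0 := fun z hz hzK u hu h0 =>
    hzK (hr.trans hu (Reach.step (hKC hu) hz (hc.col_symm 0 _ _ h0)))
  have hcon : ∀ z ∈ C, z ∉ K → ∀ u ∈ K, c z u / 2 = c z a / 2 := fun z hz hzK =>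
    hc.gallai.mono hKl (hout z hz hzK) haK
  have hblue : ∀ z ∈ C, z ∉ K → ∀ u ∈ K, c z u / 2 = 2 := by
    intro r hr' hrK u hu
    by_contra hne
    have hra : c r a / 2 = 1 := by
      have h1 := hcon r hr' hrK u hu
      have h2 := hout r hr' hrK a haK
      have h3 := hc.lt r a
      omega
    obtain ⟨x, hx, z, hz, ⟨hxK, hxa⟩, hzS, hxz⟩ :=
      h.linked.exists_cut (S := {x | x ∉ K ∧ c x a / 2 = 1}) hr' ha ⟨hrK, hra⟩ (fun h' => h'.1 haK)
    have hxz : c x z / 2 = 2 := hxz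
    by_cases hzK : z ∈ K
    · have h1 := hcon x hx hxK z hzK
      omega
    · have hza : c z a / 2 = 2 := by
        have h2 := hout z hz hzK a haK
        have h3 := hc.lt z a
        by_contra h4
        exact hzS ⟨hzK, by omega⟩
      have hzb := hcon z hz hzK b hbK
      have hxb := hcon x hx hxK b hbK
      rcases hc.peak hab hN hxa (by omega) hza (by omega) with h5 | h5
      · omega
      · exact h.no_peak hc ha hb hab hN hza (by omega) h5.2.1
  have hKab : ∀ d ∈ K, d = a ∨ d = b := by
    intro d hd
    by_contra hne
    obtain ⟨z, hz, hzK⟩ : ∃ z ∈ C, z ∉ K := by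
      by_contra hno
      push Not at hno
      exact hC (hKC.antisymm hno ▸ hKl)
    obtain ⟨u, hu, v, hv, huS, hvS, huv⟩ :=
      hKl.exists_cut (S := {x | x = a ∨ x = b}) haK hd (.inl rfl) hne
    have huv : c u v / 2 = 0 := huv
    have h2 : v ≠ a ∧ v ≠ b := not_or.1 hvS
    have hb2 := hblue z hz hzK
    have hba := hc.flip_div a b
    rcases huS with rfl | rfl
    · exact h.no_star hc hz hb ha (hKC hv) (hb2 _ hbK) (hb2 _ haK) (hb2 _ hv) (by omega) huv
        hab.symm h2.1.symm h2.2.symm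
    · exact h.no_star hc hz ha hb (hKC hv) (hb2 _ haK) (hb2 _ hbK) (hb2 _ hv) (by omega) huv
        hab h2.2.symm h2.1.symm
  intro z hz hza hzb
  have hzK : z ∉ K := fun h' => (hKab z h').elim hza hzb
  have h1 := hblue z hz hzK a haK
  have h2 := hblue z hz hzK b hbK
  have h3 := h.no_peak hc ha hb hab hN h1 h2
  have := hc.flip_eq z a
  have := hc.flip_eq z b
  omega

theorem Consec.not_neutral (hc : Good c) (hC : Consec c C) {a p q : V} (ha : a ∈ C)
    (hp : p ∈ C) (hq : q ∈ C) (hpq : p ≠ q) (h1 : c a p / 2 ≠ 0) (h2 : c a q = c a p) :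
    c p q / 2 ≠ 0 := by
  intro h0
  have := hC p hp q hq hpq h0 a ha (hc.ne h1) (hc.ne (by omega))
  have := hc.flip_eq a p
  have := hc.flip_eq a q
  omega

theorem BlueOver.no_three_aux (hc : Good c) (h : BlueOver c w C) (hC : Consec c C)
    {a b x y z m : V} (ha : a ∈ C) (hb : b ∈ C) (hx : x ∈ C) (hy : y ∈ C) (hz : z ∈ C)
    (hm : m ∈ C) (hab : a ≠ b) (hN : c a b / 2 = 0) (hx1 : c a x = 4) (hx2 : c x b = 4)
    (hy1 : c a y = 4) (hy2 : c y b = 4) (hz1 : c a z = 4) (hz2 : c z b = 4) (hm1 : c b m = 4)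
    (hm2 : c m a = 4) (hxy : c x y = 2 ∨ c x y = 4) (hyz : c y z = 2 ∨ c y z = 4) (hxz : x ≠ z) :
    False := by
  have e := fun u (hu : u ∈ C) v (hv : v ∈ C) => h.eq u hu v hv
  have fb := hc.flip_eq b m
  have fa := hc.flip_eq m a
  have hxm : x ≠ m := by rintro rfl; omega
  have hym : y ≠ m := by rintro rfl; omega
  have hzm : z ≠ m := by rintro rfl; omega
  have q1 := hc.quadrangle hab hxm hym (h.red a ha) (e b hb a ha) (e x hx a ha) (e y hy a ha)
    (e m hm a ha) hN hx1 hx2 hy1 hy2 hm1 hm2 hxy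
  have q2 := hc.quadrangle hab hym hzm (h.red a ha) (e b hb a ha) (e y hy a ha) (e z hz a ha)
    (e m hm a ha) hN hy1 hy2 hz1 hz2 hm1 hm2 hyz
  have f1 := hc.flip_eq y m
  have f2 := hc.flip_eq x m
  have f3 := hc.flip_eq z m
  have k1 : c m y / 2 = 0 ∧ c m x = 4 ∧ c z m = 4 := by omega
  have q3 := hc.quadrangle (w := w) (a := m) (b := y) (p := a) (q := x) (m := z) hym.symm
    (hc.ne (by omega)) hxz (h.red m hm) (e y hy m hm) (e a ha m hm) (e x hx m hm) (e z hz m hm)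
    k1.1 hm2 hy1 k1.2.1 q1.1 q2.1 k1.2.2 (.inr hx1)
  have h0 := hC.not_neutral hc ha hx hz hxz (by omega) (by omega)
  have f4 := hc.flip_eq a z
  omega

theorem Good.directed_cases (hc : Good c) {x y : V} (h : c x y / 2 ≠ 0) :
    (c x y = 2 ∨ c x y = 4) ∨ (c y x = 2 ∨ c y x = 4) := by
  have := hc.flip_eq x y
  omega

theorem BlueOver.no_three (hc : Good c) (h : BlueOver c w C) (hC : Consec c C)
    {a b x y z m : V} (ha : a ∈ C) (hb : b ∈ C) (hx : x ∈ C) (hy : y ∈ C) (hz : z ∈ C)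
    (hm : m ∈ C) (hab : a ≠ b) (hN : c a b / 2 = 0) (hx1 : c a x = 4) (hx2 : c x b = 4)
    (hy1 : c a y = 4) (hy2 : c y b = 4) (hz1 : c a z = 4) (hz2 : c z b = 4) (hm1 : c b m = 4)
    (hm2 : c m a = 4) (hxy : x ≠ y) (hyz : y ≠ z) (hxz : x ≠ z) : False := by
  have d1 := hc.directed_cases (hC.not_neutral hc ha hx hy hxy (by omega) (by omega))
  have d2 := hc.directed_cases (hC.not_neutral hc ha hy hz hyz (by omega) (by omega))
  have d3 := hc.directed_cases (hC.not_neutral hc ha hx hz hxz (by omega) (by omega))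
  rcases d1 with d1 | d1
  · rcases d2 with d2 | d2
    · exact h.no_three_aux hc hC ha hb hx hy hz hm hab hN hx1 hx2 hy1 hy2 hz1 hz2 hm1 hm2 d1 d2 hxz
    · rcases d3 with d3 | d3
      · exact h.no_three_aux hc hC ha hb hx hz hy hm hab hN hx1 hx2 hz1 hz2 hy1 hy2 hm1 hm2 d3 d2
          hxy
      · exact h.no_three_aux hc hC ha hb hz hx hy hm hab hN hz1 hz2 hx1 hx2 hy1 hy2 hm1 hm2 d3 d1
          hyz.symm
  · rcases d3 with d3 | d3
    · exact h.no_three_aux hc hC ha hb hy hx hz hm hab hN hy1 hy2 hx1 hx2 hz1 hz2 hm1 hm2 d1 d3 hyz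
    · rcases d2 with d2 | d2
      · exact h.no_three_aux hc hC ha hb hy hz hx hm hab hN hy1 hy2 hz1 hz2 hx1 hx2 hm1 hm2 d2 d3
          hxy.symm
      · exact h.no_three_aux hc hC ha hb hz hy hx hm hab hN hz1 hz2 hy1 hy2 hx1 hx2 hm1 hm2 d2 d1
          hxz.symm

/-- At most two vertices lie between the vertices of a neutral pair. -/
theorem BlueOver.exists_le_two (hc : Good c) (h : BlueOver c w C) (hC : Consec c C)
    {a b m p : V} (ha : a ∈ C) (hb : b ∈ C) (hm : m ∈ C) (hp : p ∈ C) (hab : a ≠ b)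
    (hN : c a b / 2 = 0) (hm1 : c b m = 4) (hm2 : c m a = 4) (hp1 : c a p = 4) (hp2 : c p b = 4)
    {Y : Set V} (hY : Y ⊆ C) (hpY : p ∈ Y) :
    (∀ z ∈ Y, c a z = 4 → c z b = 4 → z = p) ∨
    ∃ x ∈ Y, ∃ y ∈ Y, c a x = 4 ∧ c x b = 4 ∧ c a y = 4 ∧ c y b = 4 ∧ (c x y = 2 ∨ c x y = 4) ∧
      ∀ z ∈ Y, c a z = 4 → c z b = 4 → z = x ∨ z = y := by
  by_cases hq : ∃ q ∈ Y, c a q = 4 ∧ c q b = 4 ∧ q ≠ p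
  · obtain ⟨q, hqY, hq1, hq2, hqp⟩ := hq
    have hall : ∀ z ∈ Y, c a z = 4 → c z b = 4 → z = p ∨ z = q := by
      intro z hz hz1 hz2
      by_contra hne
      push Not at hne
      exact h.no_three hc hC ha hb hp (hY hqY) (hY hz) hm hab hN hp1 hp2 hq1 hq2 hz1 hz2 hm1 hm2
        hqp.symm hne.2.symm hne.1.symm
    rcases hc.directed_cases (hC.not_neutral hc ha hp (hY hqY) hqp.symm (by omega) (by omega))
      with d | d
    · exact .inr ⟨p, hpY, q, hqY, hp1, hp2, hq1, hq2, d, hall⟩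
    · exact .inr ⟨q, hqY, p, hpY, hq1, hq2, hp1, hp2, d, fun z hz h1 h2 => (hall z hz h1 h2).symm⟩
  · push Not at hq
    exact .inl hq

/-- Two vertices on opposite sides of a neutral pair are not joined by a red pair. -/
theorem Good.opposite (hc : Good c) {a b p m : V} (hp1 : c a p = 4) (hp2 : c p b = 4)
    (hm1 : c b m = 4) (hm2 : c m a = 4) : c p m / 2 ≠ 1 := by
  intro h
  rcases hc.directed_cases (x := p) (y := m) (by omega) with d | d
  · have := hc.cycle d (.inr hm2) (.inr hp1)
    omega
  · have := hc.cycle d (.inr hp2) (.inr hm1)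
    have := hc.flip_div m p
    omega

theorem Good.mem_not_red (hc : Good c) {x y : V} (h : c x y / 2 ≠ 1) : c x y ∈ [0, 1, 4, 5] := by
  have := hc.flip_eq x y
  simp
  omega

end Neutral


open Classical in
/-- Extending an isomorphism by exchanging two vertices. -/
theorem IsoOn.extend_swap {G H : Dgraph V} {X : Set V} (h : IsoOn G H X X) {a b : V} (ha : a ∉ X)
    (hb : b ∉ X) (hab : a ≠ b) (h1 : G.Arc a b ↔ H.Arc b a) (h2 : G.Arc b a ↔ H.Arc a b)
    (h3 : ∀ x ∈ X, ∀ y ∈ X, (G.Arc a x ↔ H.Arc b y) ∧ (G.Arc b x ↔ H.Arc a y) ∧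
      (G.Arc x a ↔ H.Arc y b) ∧ (G.Arc x b ↔ H.Arc y a)) :
    IsoOn G H (insert a (insert b X)) (insert a (insert b X)) := by
  obtain ⟨f, hf, harc⟩ := h
  set g : V → V := fun u => if u = a then b else if u = b then a else f u with hg
  have ga : g a = b := by simp [hg]
  have gb : g b = a := by simp [hg, hab.symm]
  have gx : ∀ x ∈ X, g x = f x := by
    intro x hx
    have : x ≠ a := fun h => ha (h ▸ hx)
    have : x ≠ b := fun h => hb (h ▸ hx)
    simp [*]
  have fX : ∀ x ∈ X, f x ∈ X := fun x hx => hf.mapsTo hx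
  refine ⟨g, ⟨?_, ?_, ?_⟩, ?_⟩
  · rintro x (rfl | rfl | hx)
    · rw [ga]; exact .inr (.inl rfl)
    · rw [gb]; exact .inl rfl
    · rw [gx x hx]; exact .inr (.inr (fX x hx))
  · have fa : ∀ x ∈ X, f x ≠ a := fun x hx h => ha (h ▸ fX x hx)
    have fb : ∀ x ∈ X, f x ≠ b := fun x hx h => hb (h ▸ fX x hx)
    rintro x (rfl | rfl | hx) y (rfl | rfl | hy) hxy
    · rfl
    · rw [ga, gb] at hxy; exact absurd hxy hab.symm
    · rw [ga, gx y hy] at hxy; exact absurd hxy.symm (fb y hy)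
    · rw [ga, gb] at hxy; exact absurd hxy hab
    · rfl
    · rw [gb, gx y hy] at hxy; exact absurd hxy.symm (fa y hy)
    · rw [ga, gx x hx] at hxy; exact absurd hxy (fb x hx)
    · rw [gb, gx x hx] at hxy; exact absurd hxy (fa x hx)
    · rw [gx x hx, gx y hy] at hxy; exact hf.injOn hx hy hxy
  · rintro y (rfl | rfl | hy)
    · exact ⟨b, .inr (.inl rfl), gb⟩
    · exact ⟨a, .inl rfl, ga⟩
    · obtain ⟨x, hx, rfl⟩ := hf.surjOn hy
      exact ⟨x, .inr (.inr hx), gx x hx⟩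
  · rintro x (rfl | rfl | hx) y (rfl | rfl | hy)
    · rw [ga]; exact iff_of_false (G.irrefl _) (H.irrefl _)
    · rw [ga, gb]; exact h1
    · rw [ga, gx y hy]; exact (h3 y hy _ (fX y hy)).1
    · rw [ga, gb]; exact h2
    · rw [gb]; exact iff_of_false (G.irrefl _) (H.irrefl _)
    · rw [gb, gx y hy]; exact (h3 y hy _ (fX y hy)).2.1
    · rw [ga, gx x hx]; exact (h3 x hx _ (fX x hx)).2.2.1
    · rw [gb, gx x hx]; exact (h3 x hx _ (fX x hx)).2.2.2
    · rw [gx x hx, gx y hy]; exact harc x hx y hy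

theorem Good.eq_five {c : V → V → ℕ} (hc : Good c) {x y : V} (h : c x y = 4) : c y x = 5 := by
  have := hc.flip_eq x y
  omega

theorem Good.neutral_flip {c : V → V → ℕ} (hc : Good c) {x y : V} {k : ℕ} (hk : k / 2 = 0)
    (h : c x y = k) : c y x = k := by
  have := hc.flip_eq x y
  omega

section Neutral

variable {G H : Dgraph V} {c : V → V → ℕ} {w : V} {C : Set V}

theorem BlueOver.no_cycle_side (hc : Good c) (h : BlueOver c w C) {a x y z : V}
    (hx : x ∈ C) (hy : y ∈ C) (hz : z ∈ C) (h1 : c a x = 4) (h2 : c a y = 4) (h3 : c a z = 4)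
    (hxy : c x y = 2 ∨ c x y = 4) (hyz : c y z = 2 ∨ c y z = 4) (hzx : c z x = 2 ∨ c z x = 4) :
    False :=
  h.no_uniform_blue hc hx hy hz hxy hyz hzx (t := a) (by omega) (by omega) (by omega)

/-- The vertices of `Y` on a given side of a neutral pair. -/
theorem BlueOver.isoOn_side (hc : Coded G H c) (h : BlueOver c w C) (hC : Consec c C)
    {a : V} (ha : a ∈ C) {Y : Set V} (hY : Y.Finite) (hYC : Y ⊆ C) (hYa : ∀ y ∈ Y, c a y = 4) :
    IsoOn G H Y Y := by
  have ht : ∀ u ∈ Y, ∀ v ∈ Y, u ≠ v → c u v / 2 ≠ 0 := fun u hu v hv huv =>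
    hC.not_neutral hc.toGood ha (hYC hu) (hYC hv) huv (by have := hYa u hu; omega)
      ((hYa v hv).trans (hYa u hu).symm)
  have hcyc : ∀ x ∈ Y, ∀ y ∈ Y, ∀ z ∈ Y, (c x y = 2 ∨ c x y = 4) → (c y z = 2 ∨ c y z = 4) →
      (c z x = 2 ∨ c z x = 4) → False := fun x hx y hy z hz =>
    h.no_cycle_side hc.toGood (hYC hx) (hYC hy) (hYC hz) (hYa x hx) (hYa y hy) (hYa z hz)
  exact ChainOn.isoOn hY hY rfl (hc.chainOn_fst ht hcyc) (hc.chainOn_snd ht hcyc)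

/-- All the other vertices of `Y` are on the same side of a neutral pair of `Y`. -/
theorem BlueOver.isoOn_one_side (hc : Coded G H c) (h : BlueOver c w C) (hC : Consec c C)
    {a b : V} {Y : Set V} (ha : a ∈ Y) (hb : b ∈ Y) (hab : a ≠ b) (hN : c a b / 2 = 0)
    (hY : Y.Finite) (hYC : Y ⊆ C) (hside : ∀ z ∈ Y, z ≠ a → z ≠ b → c a z = 4 ∧ c z b = 4) :
    IsoOn G H Y Y := by
  have key : IsoOn G H (Y \ {a, b}) (Y \ {a, b}) := by
    refine h.isoOn_side hc hC (hYC ha) (hY.subset Set.sdiff_subset)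
      (Set.sdiff_subset.trans hYC) fun y hy => ?_
    have h2 := hy.2
    simp only [Set.mem_insert_iff, Set.mem_singleton_iff, not_or] at h2
    exact (hside y hy.1 h2.1 h2.2).1
  have e : insert a (insert b (Y \ {a, b})) = Y := by
    ext x
    simp only [Set.mem_insert_iff, Set.mem_sdiff, Set.mem_singleton_iff, not_or]
    constructor
    · rintro (rfl | rfl | h) <;> [exact ha; exact hb; exact h.1]
    · tauto
  rw [← e]
  have f0 := hc.flip_eq a b
  refine key.extend_swap (by simp) (by simp) hab ?_ ?_ ?_
  · rw [hc.fst, hc.snd]; omega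
  · rw [hc.fst, hc.snd]; omega
  · intro x hx y hy
    have hx2 := hx.2
    have hy2 := hy.2
    simp only [Set.mem_insert_iff, Set.mem_singleton_iff, not_or] at hx2 hy2
    have k1 := hside x hx.1 hx2.1 hx2.2
    have k2 := hside y hy.1 hy2.1 hy2.2
    have f1 := hc.flip_eq a x
    have f2 := hc.flip_eq a y
    have f3 := hc.flip_eq x b
    have f4 := hc.flip_eq y b
    simp only [hc.fst, hc.snd]
    omega

theorem Coded.isoOn_of_list (hc : Coded G H c) {vs : List V} (hvs : vs.Nodup)
    (h : isoTest vs.length (vs.map fun u => vs.map (c u)) = true) {Y : Set V}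
    (hY : ∀ y, y ∈ Y ↔ y ∈ vs) : IsoOn G H Y Y := by
  have : Y = {u | u ∈ vs} := Set.ext hY
  rw [this]
  exact hc.isoOn_of_isoTest hvs h

/-- Two vertices of `Y` on one side of a neutral pair, one on the other side. -/
theorem BlueOver.isoOn_two_one (hc : Coded G H c) (h : BlueOver c w C) {Y : Set V} (hYC : Y ⊆ C)
    {a b p q m : V} (ha : a ∈ Y) (hb : b ∈ Y) (hp : p ∈ Y) (hq : q ∈ Y) (hm : m ∈ Y) (hab : a ≠ b)
    (hN : c a b / 2 = 0) (hp1 : c a p = 4) (hp2 : c p b = 4) (hq1 : c a q = 4) (hq2 : c q b = 4)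
    (hm1 : c b m = 4) (hm2 : c m a = 4) (hpq : c p q = 2 ∨ c p q = 4)
    (hall : ∀ y ∈ Y, y = a ∨ y = b ∨ y = p ∨ y = q ∨ y = m) : IsoOn G H Y Y := by
  have e := fun u (hu : u ∈ Y) v (hv : v ∈ Y) => h.eq u (hYC hu) v (hYC hv)
  have f1 := hc.flip_eq a b
  have f2 := hc.flip_eq a p
  have f3 := hc.flip_eq a q
  have f4 := hc.flip_eq b m
  have f5 := hc.flip_eq m a
  have f6 := hc.flip_eq p b
  have f7 := hc.flip_eq q b
  have f8 := hc.flip_eq p q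
  have f9 := hc.flip_eq p m
  have f10 := hc.flip_eq q m
  have hpm : p ≠ m := by rintro rfl; omega
  have hqm : q ≠ m := by rintro rfl; omega
  obtain ⟨q1, q2⟩ := hc.quadrangle hab hpm hqm (h.red a (hYC ha)) (e b hb a ha) (e p hp a ha)
    (e q hq a ha) (e m hm a ha) hN hp1 hp2 hq1 hq2 hm1 hm2 hpq
  refine hc.isoOn_of_list (vs := [a, b, p, q, m]) ?_ ?_ ?_
  · simp [hab, hpm, hqm, hc.ne (u := a) (v := p) (by omega), hc.ne (u := a) (v := q) (by omega),
      hc.ne (u := b) (v := p) (by omega), hc.ne (u := b) (v := q) (by omega),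
      hc.ne (u := a) (v := m) (by omega), hc.ne (u := b) (v := m) (by omega),
      hc.ne (u := p) (v := q) (by omega)]
  · have key : isoTest 5 (table5 (c a b) (c a p) (c a q) (c a m) (c b p) (c b q) (c b m) (c p q)
        (c p m) (c q m)) = true := by
      rw [hp1, hq1, hm1, q1, show c a m = 5 by omega, show c b p = 5 by omega,
        show c b q = 5 by omega]
      exact isoTest_five_quadrangle (c a b) (mem_neutral hN) (c p m)
        (hc.mem_not_red (hc.opposite hp1 hp2 hm1 hm2)) (c q m)
        (hc.mem_not_red (hc.opposite hq1 hq2 hm1 hm2)) (by omega)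
    simp only [table5, ← hc.flip] at key
    simpa only [List.map_cons, List.map_nil, hc.diag, List.length_cons, List.length_nil] using key
  · intro y
    simp only [List.mem_cons, List.not_mem_nil, or_false]
    exact ⟨hall y, by rintro (rfl | rfl | rfl | rfl | rfl) <;> assumption⟩

/-- One vertex of `Y` on each side of a neutral pair. -/
theorem BlueOver.isoOn_one_one (hc : Coded G H c) {Y : Set V}
    {a b p m : V} (ha : a ∈ Y) (hb : b ∈ Y) (hp : p ∈ Y) (hm : m ∈ Y) (hab : a ≠ b)
    (hN : c a b / 2 = 0) (hp1 : c a p = 4) (hp2 : c p b = 4)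
    (hm1 : c b m = 4) (hm2 : c m a = 4)
    (hall : ∀ y ∈ Y, y = a ∨ y = b ∨ y = p ∨ y = m) : IsoOn G H Y Y := by
  have f5 := hc.flip_eq m a
  have f6 := hc.flip_eq p b
  have hpm : p ≠ m := by rintro rfl; omega
  refine hc.isoOn_of_list (vs := [a, b, p, m]) ?_ ?_ ?_
  · simp [hab, hpm, hc.ne (u := a) (v := p) (by omega), hc.ne (u := b) (v := p) (by omega),
      hc.ne (u := a) (v := m) (by omega), hc.ne (u := b) (v := m) (by omega)]
  · have key : isoTest 4 (table4 (c a b) (c a p) (c a m) (c b p) (c b m) (c p m)) = true := by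
      rw [hp1, hm1, show c a m = 5 by omega, show c b p = 5 by omega]
      exact isoTest_four_quadrangle (c a b) (mem_neutral hN) (c p m)
        (hc.mem_not_red (hc.opposite hp1 hp2 hm1 hm2))
    simp only [table4, ← hc.flip] at key
    simpa only [List.map_cons, List.map_nil, hc.diag, List.length_cons, List.length_nil] using key
  · intro y
    simp only [List.mem_cons, List.not_mem_nil, or_false]
    exact ⟨hall y, by rintro (rfl | rfl | rfl | rfl) <;> assumption⟩

/-- Two vertices of `Y` on each side of a neutral pair. -/
theorem BlueOver.isoOn_two_two (hc : Coded G H c) (h : BlueOver c w C) {Y : Set V} (hYC : Y ⊆ C)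
    {a b p q m n : V} (ha : a ∈ Y) (hb : b ∈ Y) (hp : p ∈ Y) (hq : q ∈ Y) (hm : m ∈ Y) (hn : n ∈ Y)
    (hab : a ≠ b) (hN : c a b / 2 = 0) (hp1 : c a p = 4) (hp2 : c p b = 4) (hq1 : c a q = 4)
    (hq2 : c q b = 4) (hm1 : c b m = 4) (hm2 : c m a = 4) (hn1 : c b n = 4) (hn2 : c n a = 4)
    (hpq : c p q = 2 ∨ c p q = 4) (hmn : c m n = 2 ∨ c m n = 4)
    (hall : ∀ y ∈ Y, y = a ∨ y = b ∨ y = p ∨ y = q ∨ y = m ∨ y = n) : IsoOn G H Y Y := by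
  have e := fun u (hu : u ∈ Y) v (hv : v ∈ Y) => h.eq u (hYC hu) v (hYC hv)
  have hpm : p ≠ m := by rintro rfl; have := hc.flip_eq p b; omega
  have hqm : q ≠ m := by rintro rfl; have := hc.flip_eq q b; omega
  have hpn : p ≠ n := by rintro rfl; have := hc.flip_eq p b; omega
  have hqn : q ≠ n := by rintro rfl; have := hc.flip_eq q b; omega
  have hba := hc.flip_div a b
  have eba : c b a = c a b := by have := hc.flip_eq a b; omega
  obtain ⟨q1, q2⟩ := hc.quadrangle hab hpm hqm (h.red a (hYC ha)) (e b hb a ha) (e p hp a ha)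
    (e q hq a ha) (e m hm a ha) hN hp1 hp2 hq1 hq2 hm1 hm2 hpq
  obtain ⟨-, q3⟩ := hc.quadrangle hab hpn hqn (h.red a (hYC ha)) (e b hb a ha) (e p hp a ha)
    (e q hq a ha) (e n hn a ha) hN hp1 hp2 hq1 hq2 hn1 hn2 hpq
  obtain ⟨q4, q5⟩ := hc.quadrangle hab.symm hpm.symm hpn.symm (h.red b (hYC hb)) (e a ha b hb)
    (e m hm b hb) (e n hn b hb) (e p hp b hb) (hba.trans hN) hm1 hm2 hn1 hn2 hp1 hp2 hmn
  obtain ⟨-, q6⟩ := hc.quadrangle hab.symm hqm.symm hqn.symm (h.red b (hYC hb)) (e a ha b hb)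
    (e m hm b hb) (e n hn b hb) (e q hq b hb) (hba.trans hN) hm1 hm2 hn1 hn2 hq1 hq2 hmn
  rw [eba] at q5 q6
  have f2 : c b p = 5 := by have := hc.flip_eq p b; omega
  have f3 : c b q = 5 := by have := hc.flip_eq q b; omega
  have f4 : c a m = 5 := by have := hc.flip_eq m a; omega
  have f5 : c a n = 5 := by have := hc.flip_eq n a; omega
  refine hc.isoOn_of_list (vs := [a, b, p, q, m, n]) ?_ ?_ ?_
  · simp [hab, hpm, hqm, hpn, hqn, hc.ne (u := a) (v := p) (by omega),
      hc.ne (u := a) (v := q) (by omega), hc.ne (u := b) (v := p) (by omega),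
      hc.ne (u := b) (v := q) (by omega), hc.ne (u := a) (v := m) (by omega),
      hc.ne (u := b) (v := m) (by omega), hc.ne (u := a) (v := n) (by omega),
      hc.ne (u := b) (v := n) (by omega), hc.ne (u := p) (v := q) (by omega),
      hc.ne (u := m) (v := n) (by omega)]
  · have key : isoTest 6 (table6 (c a b) (c a p) (c a q) (c a m) (c a n) (c b p) (c b q) (c b m)
        (c b n) (c p q) (c p m) (c p n) (c q m) (c q n) (c m n)) = true := by
      rw [hp1, hq1, hm1, hn1, q1, q4, f2, f3, f4, f5]
      exact isoTest_six_quadrangle (c a b) (mem_neutral hN)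
        _ (hc.mem_not_red (hc.opposite hp1 hp2 hm1 hm2))
        _ (hc.mem_not_red (hc.opposite hq1 hq2 hm1 hm2))
        _ (hc.mem_not_red (hc.opposite hp1 hp2 hn1 hn2))
        _ (hc.mem_not_red (hc.opposite hq1 hq2 hn1 hn2))
        (q2.imp (fun t => ⟨t.1, hc.eq_five t.2⟩) (Or.imp id fun t => ⟨t.1, hc.eq_five t.2⟩))
        (q3.imp (fun t => ⟨t.1, hc.eq_five t.2⟩) (Or.imp id fun t => ⟨t.1, hc.eq_five t.2⟩))
        (q5.imp (fun t => ⟨hc.eq_five t.1, t.2⟩) (Or.imp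
          (fun t => ⟨hc.neutral_flip hN t.1, hc.eq_five t.2⟩) fun t => ⟨hc.neutral_flip hN t.1, t.2⟩))
        (q6.imp (fun t => ⟨hc.eq_five t.1, t.2⟩) (Or.imp
          (fun t => ⟨hc.neutral_flip hN t.1, hc.eq_five t.2⟩) fun t => ⟨hc.neutral_flip hN t.1, t.2⟩))
    simp only [table6, ← hc.flip] at key
    simpa only [List.map_cons, List.map_nil, hc.diag, List.length_cons, List.length_nil] using key
  · intro y
    simp only [List.mem_cons, List.not_mem_nil, or_false]
    exact ⟨hall y, by rintro (rfl | rfl | rfl | rfl | rfl | rfl) <;> assumption⟩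

/-- Some neutral pair of `Y` has vertices of `Y` on both sides. -/
theorem BlueOver.isoOn_two_sides (hc : Coded G H c) (h : BlueOver c w C) (hC : Consec c C)
    {Y : Set V} (hYC : Y ⊆ C)
    {a b p m : V} (ha : a ∈ Y) (hb : b ∈ Y) (hp : p ∈ Y) (hm : m ∈ Y) (hab : a ≠ b)
    (hN : c a b / 2 = 0) (hp1 : c a p = 4) (hp2 : c p b = 4) (hm1 : c b m = 4) (hm2 : c m a = 4) :
    IsoOn G H Y Y := by
  have hba : c b a / 2 = 0 := (hc.flip_div a b).trans hN
  have hcases : ∀ y ∈ Y, y = a ∨ y = b ∨ (c a y = 4 ∧ c y b = 4) ∨ (c b y = 4 ∧ c y a = 4) := by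
    intro y hy
    by_cases hya : y = a
    · exact .inl hya
    · by_cases hyb : y = b
      · exact .inr (.inl hyb)
      · exact .inr (.inr (hC a (hYC ha) b (hYC hb) hab hN y (hYC hy) hya hyb))
  have s1 := h.exists_le_two hc.toGood hC (hYC ha) (hYC hb) (hYC hm) (hYC hp) hab hN hm1 hm2 hp1 hp2
    hYC hp
  have s2 := h.exists_le_two hc.toGood hC (hYC hb) (hYC ha) (hYC hp) (hYC hm) hab.symm hba hp1 hp2
    hm1 hm2 hYC hm
  rcases s1 with s1 | ⟨x, hx, y, hy, x1, x2, y1, y2, hxy, s1⟩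
  · rcases s2 with s2 | ⟨u, hu, v, hv, u1, u2, v1, v2, huv, s2⟩
    · refine BlueOver.isoOn_one_one hc ha hb hp hm hab hN hp1 hp2 hm1 hm2 fun y hy => ?_
      have := s1 y hy
      have := s2 y hy
      have := hcases y hy
      tauto
    · refine h.isoOn_two_one hc hYC hb ha hu hv hp hab.symm hba u1 u2 v1 v2 hp1 hp2 huv
        fun y hy => ?_
      have := s1 y hy
      have := s2 y hy
      have := hcases y hy
      tauto
  · rcases s2 with s2 | ⟨u, hu, v, hv, u1, u2, v1, v2, huv, s2⟩
    · refine h.isoOn_two_one hc hYC ha hb hx hy hm hab hN x1 x2 y1 y2 hm1 hm2 hxy fun y hy => ?_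
      have := s1 y hy
      have := s2 y hy
      have := hcases y hy
      tauto
    · refine h.isoOn_two_two hc hYC ha hb hx hy hu hv hab hN x1 x2 y1 y2 u1 u2 v1 v2 hxy huv
        fun y hy => ?_
      rcases hcases y hy with e | e | e | e
      · simp [e]
      · simp [e]
      · rcases s1 y hy e.1 e.2 with e | e <;> simp [e]
      · rcases s2 y hy e.1 e.2 with e | e <;> simp [e]

theorem BlueOver.isoOn_of_neutral_mem (hc : Coded G H c) (h : BlueOver c w C) (hC : Consec c C)
    {Y : Set V} (hY : Y.Finite) (hYC : Y ⊆ C) {a b : V} (ha : a ∈ Y) (hb : b ∈ Y) (hab : a ≠ b)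
    (hN : c a b / 2 = 0) : IsoOn G H Y Y := by
  have hcases := fun y hy => hC a (hYC ha) b (hYC hb) hab hN y (hYC hy)
  by_cases hp : ∃ p ∈ Y, c a p = 4 ∧ c p b = 4
  · by_cases hm : ∃ m ∈ Y, c b m = 4 ∧ c m a = 4
    · obtain ⟨p, hp, p1, p2⟩ := hp
      obtain ⟨m, hm, m1, m2⟩ := hm
      exact h.isoOn_two_sides hc hC hYC ha hb hp hm hab hN p1 p2 m1 m2
    · refine h.isoOn_one_side hc hC ha hb hab hN hY hYC fun z hz hza hzb => ?_
      exact (hcases z hz hza hzb).resolve_right fun h' => hm ⟨z, hz, h'⟩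
  · refine h.isoOn_one_side hc hC hb ha hab.symm ((hc.flip_div a b).trans hN) hY hYC
      fun z hz hza hzb => ?_
    exact (hcases z hz hzb hza).resolve_left fun h' => hp ⟨z, hz, h'⟩

/-- `Y` has no neutral pair and lies on one side of a neutral pair. -/
theorem BlueOver.isoOn_chain_side (hc : Coded G H c) (h : BlueOver c w C)
    {Y : Set V} (hY : Y.Finite) (hYC : Y ⊆ C) (ht : ∀ u ∈ Y, ∀ v ∈ Y, u ≠ v → c u v / 2 ≠ 0)
    {a b : V} (hab : a ≠ b) (hN : c a b / 2 = 0)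
    (hside : ∀ z ∈ Y, z ≠ a → z ≠ b → c a z = 4 ∧ c z b = 4) : IsoOn G H Y Y := by
  have hcyc : ∀ x ∈ Y, ∀ y ∈ Y, ∀ z ∈ Y, (c x y = 2 ∨ c x y = 4) → (c y z = 2 ∨ c y z = 4) →
      (c z x = 2 ∨ c z x = 4) → False := by
    have hba := hc.flip_div a b
    have hbs : ∀ y ∈ Y, y = b → ∀ z ∈ Y, c y z = 2 ∨ c y z = 4 → False := by
      rintro y hy rfl z hz hyz
      by_cases hza : z = a
      · subst hza; omega
      · have := hside z hz hza (hc.ne (u := y) (v := z) (by omega)).symm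
        have := hc.flip_eq z y
        omega
    have has : ∀ y ∈ Y, y = a → ∀ z ∈ Y, c z y = 2 ∨ c z y = 4 → False := by
      rintro y hy rfl z hz hyz
      by_cases hza : z = b
      · subst hza; omega
      · have := hside z hz (hc.ne (u := z) (v := y) (by omega)) hza
        have := hc.flip_eq z y
        omega
    intro x hx y hy z hz h1 h2 h3
    exact h.no_cycle_side hc.toGood (hYC hx) (hYC hy) (hYC hz)
      (hside x hx (fun e => has x hx e z hz h3) (fun e => hbs x hx e y hy h1)).1
      (hside y hy (fun e => has y hy e x hx h1) (fun e => hbs y hy e z hz h2)).1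
      (hside z hz (fun e => has z hz e y hy h2) (fun e => hbs z hz e x hx h3)).1 h1 h2 h3
  exact ChainOn.isoOn hY hY rfl (hc.chainOn_fst ht hcyc) (hc.chainOn_snd ht hcyc)

end Neutral


section Neutral

variable {G H : Dgraph V} {c : V → V → ℕ} {w : V} {C : Set V}

theorem BlueOver.not_red_side (hc : Good c) (h : BlueOver c w C) {a b p q m : V}
    (ha : a ∈ C) (hb : b ∈ C) (hp : p ∈ C) (hq : q ∈ C) (hm : m ∈ C) (hab : a ≠ b)
    (hN : c a b / 2 = 0) (hp1 : c a p = 4) (hp2 : c p b = 4) (hq1 : c a q = 4)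
    (hq2 : c q b = 4) (hm1 : c b m = 4) (hm2 : c m a = 4) : c p q / 2 ≠ 1 := by
  intro h1
  have fb := hc.flip_eq b m
  have hpm : p ≠ m := by rintro rfl; omega
  have hqm : q ≠ m := by rintro rfl; omega
  have e := fun u (hu : u ∈ C) => h.eq u hu a ha
  rcases hc.directed_cases (x := p) (y := q) (by omega) with d | d
  · have := (hc.quadrangle hab hpm hqm (h.red a ha) (e b hb) (e p hp) (e q hq) (e m hm)
      hN hp1 hp2 hq1 hq2 hm1 hm2 d).1
    omega
  · have := (hc.quadrangle hab hqm hpm (h.red a ha) (e b hb) (e q hq) (e p hp) (e m hm)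
      hN hq1 hq2 hp1 hp2 hm1 hm2 d).1
    have := hc.flip_div p q
    omega

theorem ncard_le_five {α : Type*} {Y : Set α} {a x y u v : α}
    (h : ∀ z ∈ Y, z = a ∨ z = x ∨ z = y ∨ z = u ∨ z = v) : Y.ncard ≤ 5 := by
  classical
  have hsub : Y ⊆ (({a, x, y, u, v} : Finset α) : Set α) := by
    intro z hz
    simpa using h z hz
  have := Set.ncard_le_ncard hsub (Finset.finite_toSet _)
  rw [Set.ncard_coe_finset] at this
  exact this.trans Finset.card_le_five

/-- `Y` has no neutral pair, but `C` has one, with vertices on both sides. -/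
theorem BlueOver.isoOn_small (hc : Coded G H c) (h : BlueOver c w C) (hC : Consec c C)
    {Y : Set V} (hY : Y.Finite) (hYC : Y ⊆ C) (ht : ∀ u ∈ Y, ∀ v ∈ Y, u ≠ v → c u v / 2 ≠ 0)
    {a b p m : V} (ha : a ∈ C) (hb : b ∈ C) (hp : p ∈ C) (hm : m ∈ C) (hab : a ≠ b)
    (hN : c a b / 2 = 0) (hp1 : c a p = 4) (hp2 : c p b = 4) (hm1 : c b m = 4) (hm2 : c m a = 4) :
    IsoOn G H Y Y := by
  have hba : c b a / 2 = 0 := (hc.flip_div a b).trans hN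
  have hcases : ∀ y ∈ C, y = a ∨ y = b ∨ (c a y = 4 ∧ c y b = 4) ∨ (c b y = 4 ∧ c y a = 4) := by
    intro y hy
    by_cases hya : y = a
    · exact .inl hya
    · by_cases hyb : y = b
      · exact .inr (.inl hyb)
      · exact .inr (.inr (hC a ha b hb hab hN y hy hya hyb))
  have hnr : ∀ u ∈ C, ∀ v ∈ C, c u v / 2 ≠ 1 := by
    intro u hu v hv
    by_cases huv : u = v
    · subst huv
      rw [hc.diag]
      omega
    have f := hc.flip_div u v
    rcases hcases u hu with eu | eu | ⟨u1, u2⟩ | ⟨u1, u2⟩ <;>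
      rcases hcases v hv with ev | ev | ⟨v1, v2⟩ | ⟨v1, v2⟩ <;> try subst eu <;> try subst ev
    all_goals try subst ev
    all_goals try first | exact absurd rfl huv | omega
    · exact h.not_red_side hc.toGood ha hb hu hv hm hab hN u1 u2 v1 v2 hm1 hm2
    · have := hc.opposite u1 u2 v1 v2
      omega
    · have := hc.opposite v1 v2 u1 u2
      omega
    · exact h.not_red_side hc.toGood hb ha hu hv hp hab.symm hba u1 u2 v1 v2 hp1 hp2
  have hb2 : ∀ u ∈ Y, ∀ v ∈ Y, u ≠ v → c u v = 4 ∨ c u v = 5 := by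
    intro u hu v hv huv
    have := ht u hu v hv huv
    have := hnr u (hYC hu) v (hYC hv)
    have := hc.lt u v
    omega
  have hdual : IsoOn G.dual H Y Y := by
    refine IsoOn.of_eq fun x hx y hy => ?_
    change G.Arc y x ↔ _
    rw [hc.fst, hc.snd]
    by_cases hxy : x = y
    · subst hxy
      rw [hc.diag]
      omega
    · have := hb2 x hx y hy hxy
      have := hc.flip_eq x y
      omega
  have hdft : DFTOn G Y := by
    refine ⟨fun u hu v hv huv => ?_, fun x hx y hy z hz t htY h1 h2 h3 => ?_⟩
    · have := hb2 u hu v hv huv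
      have := hc.flip_eq u v
      unfold Dir
      rw [hc.fst, hc.fst]
      omega
    · have harc : ∀ u ∈ Y, ∀ v ∈ Y, G.Arc u v → c u v = 4 := by
        intro u hu v hv huv
        have := hb2 u hu v hv (by rintro rfl; exact G.irrefl _ huv)
        rw [hc.fst] at huv
        omega
      have k1 := harc x hx y hy h1
      have k2 := harc y hy z hz h2
      have k3 := harc z hz x hx h3
      constructor
      · rintro ⟨h4, h5, h6⟩
        have k4 := harc t htY x hx h4
        have k5 := harc t htY y hy h5
        have k6 := harc t htY z hz h6
        exact h.no_uniform_blue hc.toGood (hYC hx) (hYC hy) (hYC hz) (.inr k1) (.inr k2) (.inr k3)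
          (t := t) (by omega) (by omega) (by omega)
      · rintro ⟨h4, h5, h6⟩
        have k4 := hc.eq_five (harc x hx t htY h4)
        have k5 := hc.eq_five (harc y hy t htY h5)
        have k6 := hc.eq_five (harc z hz t htY h6)
        exact h.no_uniform_blue hc.toGood (hYC hx) (hYC hy) (hYC hz) (.inr k1) (.inr k2) (.inr k3)
          (t := t) (by omega) (by omega) (by omega)
  have two : ∀ {a b p m : V}, a ∈ C → b ∈ C → p ∈ C → m ∈ C → a ≠ b → c a b / 2 = 0 →
      c a p = 4 → c p b = 4 → c b m = 4 → c m a = 4 →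
      ∃ x y, ∀ z ∈ C, c a z = 4 → c z b = 4 → z = x ∨ z = y := by
    intro a b p m ha hb hp hm hab hN hp1 hp2 hm1 hm2
    rcases h.exists_le_two hc.toGood hC ha hb hm hp hab hN hm1 hm2 hp1 hp2 subset_rfl hp
      with s | ⟨x, -, y, -, -, -, -, -, -, s⟩
    · exact ⟨p, p, fun z hz h1 h2 => .inl (s z hz h1 h2)⟩
    · exact ⟨x, y, s⟩
  obtain ⟨x, y, hxy⟩ := two ha hb hp hm hab hN hp1 hp2 hm1 hm2
  obtain ⟨u, v, huv⟩ := two hb ha hm hp hab.symm hba hm1 hm2 hp1 hp2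
  have hcard : Y.ncard ≤ 5 := by
    have hd : ∃ d, ∀ z ∈ Y, z = a ∨ z = b → z = d := by
      by_cases haY : a ∈ Y
      · refine ⟨a, fun z hz hzab => hzab.resolve_right ?_⟩
        rintro rfl
        exact ht a haY z hz hab hN
      · refine ⟨b, fun z hz hzab => hzab.resolve_left ?_⟩
        rintro rfl
        exact haY hz
    obtain ⟨d, hd⟩ := hd
    refine ncard_le_five (a := d) (x := x) (y := y) (u := u) (v := v) fun z hz => ?_
    rcases hcases z (hYC hz) with e | e | e | e
    · exact .inl (hd z hz (.inl e))
    · exact .inl (hd z hz (.inr e))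
    · rcases hxy z (hYC hz) e.1 e.2 with e | e <;> simp [e]
    · rcases huv z (hYC hz) e.1 e.2 with e | e <;> simp [e]
  exact (hdft.isoOn_dual hY hcard).trans hdual

theorem BlueOver.isoOn_consec (hc : Coded G H c) (h : BlueOver c w C) (hC : Consec c C)
    {a b : V} (ha : a ∈ C) (hb : b ∈ C) (hab : a ≠ b) (hN : c a b / 2 = 0) {Y : Set V}
    (hY : Y.Finite) (hYC : Y ⊆ C) : IsoOn G H Y Y := by
  by_cases hNY : ∃ x ∈ Y, ∃ y ∈ Y, x ≠ y ∧ c x y / 2 = 0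
  · obtain ⟨x, hx, y, hy, hxy, h0⟩ := hNY
    exact h.isoOn_of_neutral_mem hc hC hY hYC hx hy hxy h0
  · have ht : ∀ u ∈ Y, ∀ v ∈ Y, u ≠ v → c u v / 2 ≠ 0 :=
      fun u hu v hv huv h0 => hNY ⟨u, hu, v, hv, huv, h0⟩
    have hcases := hC a ha b hb hab hN
    by_cases hp : ∃ p ∈ C, c a p = 4 ∧ c p b = 4
    · by_cases hm : ∃ m ∈ C, c b m = 4 ∧ c m a = 4
      · obtain ⟨p, hp, p1, p2⟩ := hp
        obtain ⟨m, hm, m1, m2⟩ := hm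
        exact h.isoOn_small hc hC hY hYC ht ha hb hp hm hab hN p1 p2 m1 m2
      · refine h.isoOn_chain_side hc hY hYC ht hab hN fun z hz hza hzb => ?_
        exact (hcases z (hYC hz) hza hzb).resolve_right fun h' => hm ⟨z, hYC hz, h'⟩
    · refine h.isoOn_chain_side hc hY hYC ht hab.symm ((hc.flip_div a b).trans hN)
        fun z hz hza hzb => ?_
      exact (hcases z (hYC hz) hzb hza).resolve_left fun h' => hp ⟨z, hYC hz, h'⟩

end Neutral


/-! Blue components linked by neutral pairs. -/

section Linked

variable {c : V → V → ℕ} {w : V} {C : Set V}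

theorem Linked.exists_path {F : Set V} (h : Linked (Col c 0) F) {m m' : V} (hm : m ∈ F)
    (hm' : m' ∈ F) (hmm' : m ≠ m') (h1 : c m m' / 2 ≠ 0) :
    ∃ u ∈ F, ∃ v ∈ F, c m u / 2 = 0 ∧ c u v / 2 = 0 ∧ m ≠ u ∧ u ≠ v ∧ m ≠ v := by
  obtain ⟨u, hu, v, hv, huS, hvS, huv⟩ := h.exists_cut (S := {z | z = m ∨ c m z / 2 = 0}) hm hm'
    (.inl rfl) (by rintro (h | h); exacts [hmm' h.symm, h1 h])
  have hvS' : v ≠ m ∧ c m v / 2 ≠ 0 := not_or.1 hvS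
  have hum : u ≠ m := by rintro rfl; exact hvS'.2 huv
  refine ⟨u, hu, v, hv, huS.resolve_left hum, huv, hum.symm, ?_, hvS'.1.symm⟩
  rintro rfl
  exact hvS'.2 (huS.resolve_left hum)

theorem BlueOver.no_red (hc : Good c) (h : BlueOver c w C) (h0 : Linked (Col c 0) C) {m m' : V}
    (hm : m ∈ C) (hm' : m' ∈ C) : c m m' / 2 ≠ 1 := by
  intro h1
  have hmm' : m ≠ m' := hc.ne (by omega)
  obtain ⟨F, hF, hmF, hFC, hF0⟩ := h0.exists_finite (hc.col_symm 0) (F := {m, m'})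
    (Set.toFinite _) (Set.insert_subset hm (Set.singleton_subset_iff.2 hm'))
  have hmF' := hmF (Set.mem_insert _ _)
  have hmF'' := hmF (Set.mem_insert_of_mem _ rfl)
  obtain ⟨p, hp, q, hq, h2, h3, h4, h5, h6⟩ := hF0.exists_path hmF' hmF'' hmm' (by omega)
  obtain ⟨X, hX, hFX, hXC, hX0, hX2⟩ := hc.gallai.exists_linked_superset (i := 0) (j := 2) hF
    ⟨m, hmF'⟩ hFC hF0 h.linked fun y hy _ hall =>
      h.no_star hc hy hm (hFC hp) (hFC hq) (hall m hmF') (hall p hp) (hall q hq) h2 h3 h4 h5 h6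
  have hX1 : ¬ Linked (Col c 1) X := fun hX1 =>
    hc.gallai.not_linked (i := 0) (j := 1) (k := 2) (by simp) (by simp) (by simp) (by simp)
      (by simp) (by simp) hX ⟨m, hFX hmF', m', hFX hmF'', hmm'⟩ hX0 hX1 hX2
  have hmX := hFX hmF'
  have hm'X := hFX hmF''
  let M := {v | Reach (Col c 1) X m v}
  have hMX : M ⊆ X := fun v hv => hv.mem hmX
  have hM : Linked (Col c 1) M := linked_reach (hc.col_symm 1) m
  have hmM : m ∈ M := .refl
  have hm'M : m' ∈ M := Reach.step hmX hm'X h1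
  obtain ⟨z, hz, hzM⟩ : ∃ z ∈ X, z ∉ M := by
    by_contra hno
    refine hX1 ?_
    have : M = X := hMX.antisymm fun z hz => by_contra fun hzM => hno ⟨z, hz, hzM⟩
    rwa [this] at hM
  have hout : ∀ v ∈ X, v ∉ M → ∀ u ∈ M, c v u / 2 ≠ 1 := fun v hv hvM u hu huv =>
    hvM (Relation.ReflTransGen.tail hu ⟨hMX hu, hv, hc.col_symm 1 _ _ huv⟩)
  have hunif : ∀ v ∈ X, v ∉ M → ∀ u ∈ M, ∀ u' ∈ M, c v u / 2 = c v u' / 2 :=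
    fun v hv hvM u hu u' hu' => hc.gallai.mono hM (hout v hv hvM) hu' u hu
  obtain ⟨a, haX, b, hbX, haM, hbM, hab⟩ := hX0.exists_cut hmX hz hmM hzM
  have hbm : c b m / 2 = 0 :=
    (hunif b hbX hbM m hmM a haM).trans (hc.col_symm 0 _ _ hab)
  obtain ⟨u, hu, v, hv, huS, hvS, huv⟩ := hX2.exists_cut (S := {z | z ∉ M ∧ c z m / 2 = 0}) hbX hmX
    ⟨hbM, hbm⟩ (fun h => h.1 hmM)
  have hum' : c u m' / 2 = 0 := (hunif u hu huS.1 m' hm'M m hmM).trans huS.2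
  have huv' : c v u / 2 = 2 := hc.col_symm 2 _ _ huv
  have hvM : v ∉ M := by
    intro hvM
    have := hunif u hu huS.1 v hvM m hmM
    have := huS.2
    have : c u v / 2 = 2 := huv
    omega
  have hvm : c v m / 2 = 2 := by
    have e1 := hout v hv hvM m hmM
    have e2 : ¬ c v m / 2 = 0 := fun e => hvS ⟨hvM, e⟩
    have := hc.lt v m
    omega
  have hvm' : c v m' / 2 = 2 := (hunif v hv hvM m' hm'M m hmM).trans hvm
  refine h.no_star hc (hXC hv) hm (hXC hu) hm' hvm huv' hvm' ?_ hum' ?_ ?_ hmm'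
  · exact (hc.flip_div u m).trans huS.2
  · rintro rfl; exact huS.1 hmM
  · rintro rfl; exact huS.1 hm'M

theorem BlueOver.not_triangle (hc : Good c) (h : BlueOver c w C) (h0 : Linked (Col c 0) C)
    {q r s : V} (hq : q ∈ C) (hr : r ∈ C) (hs : s ∈ C) (hqr : c q r / 2 = 2) (hqs : c q s / 2 = 2)
    (hrs : c r s / 2 = 2) : False := by
  have hnb : ∀ u ∈ C, ∀ v ∈ C, c u v / 2 ≠ 0 → c u v / 2 = 2 := by
    intro u hu v hv h2
    have := h.no_red hc h0 hu hv
    have := hc.lt u v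
    omega
  have fl := hc.flip_div
  have hstar : ∀ v ∈ C, ∀ x ∈ C, ∀ y ∈ C, ∀ z ∈ C, c v x / 2 = 2 → c v y / 2 = 2 →
      c x y / 2 = 0 → c y z / 2 = 0 → x ≠ y → y ≠ z → x ≠ z → c v z / 2 = 0 := by
    intro v hv x hx y hy z hz h1 h2 h3 h4 h5 h6 h7
    by_contra h8
    exact h.no_star hc hv hx hy hz h1 h2 (hnb v hv z hz h8) h3 h4 h5 h6 h7
  by_cases hone : ∃ q ∈ C, ∃ r ∈ C, ∃ s ∈ C, ∃ t ∈ C, c q r / 2 = 2 ∧ c q s / 2 = 2 ∧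
      c r s / 2 = 2 ∧ t ≠ q ∧ c t q / 2 = 0 ∧ c t r / 2 = 2 ∧ c t s / 2 = 2
  · clear hqr hqs hrs hq hr hs q r s
    obtain ⟨q, hq, r, hr, s, hs, t, ht, hqr, hqs, hrs, htq, nq, br, bs⟩ := hone
    have hqr' := hc.ne (u := q) (v := r) (by omega)
    have hqs' := hc.ne (u := q) (v := s) (by omega)
    have htr' := hc.ne (u := t) (v := r) (by omega)
    have hts' := hc.ne (u := t) (v := s) (by omega)
    have hrs' := hc.ne (u := r) (v := s) (by omega)
    have hall : ∀ q ∈ C, ∀ t ∈ C, c q r / 2 = 2 → c q s / 2 = 2 → c t q / 2 = 0 → c t r / 2 = 2 →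
        c t s / 2 = 2 → t ≠ q → ∀ t' ∈ C, t' ≠ q → t' ≠ t → c t' q / 2 = 0 →
        c t' r / 2 = 0 ∧ c t' s / 2 = 0 ∧ c t' t / 2 = 0 := by
      intro q hq t ht hqr hqs nq br bs htq t' ht' n1 n2 e
      have hr' := hstar r hr t ht q hq t' ht' ((fl t r).trans br) ((fl q r).trans hqr) nq
        ((fl t' q).trans e) htq n1.symm n2.symm
      have hs' := hstar s hs t ht q hq t' ht' ((fl t s).trans bs) ((fl q s).trans hqs) nq
        ((fl t' q).trans e) htq n1.symm n2.symm
      have hr'' := (fl r t').trans hr'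
      have hs'' := (fl s t').trans hs'
      refine ⟨hr'', hs'', ?_⟩
      by_contra hb
      have hb := (fl t' t).trans (hnb t' ht' t ht hb)
      have hne1 : t' ≠ r := by rintro rfl; have := fl q t'; omega
      have hne2 : t' ≠ s := by rintro rfl; have := fl q t'; omega
      exact h.no_star hc ht hr ht' hs br hb bs hr' hs'' hne1.symm hne2 hrs'
    obtain ⟨a, ha, b, hb, haS, hbS, hab⟩ := h0.exists_cut (S := {z | z = q ∨ z = t}) hq hr
      (.inl rfl) (by rintro (e | e); exacts [hqr' e.symm, htr' e.symm])
    have hbS' : b ≠ q ∧ b ≠ t := not_or.1 hbS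
    have hA : ∀ z ∈ C, z ≠ q → z ≠ t → (c z q / 2 = 0 ∨ c z t / 2 = 0) →
        c z q / 2 = 0 ∧ c z t / 2 = 0 := by
      rintro z hz n1 n2 (e | e)
      · exact ⟨e, (hall q hq t ht hqr hqs nq br bs htq z hz n1 n2 e).2.2⟩
      · exact ⟨(hall t ht q hq br bs ((fl t q).trans nq) hqr hqs htq.symm z hz n2 n1 e).2.2, e⟩
    have hbA : c b q / 2 = 0 ∧ c b t / 2 = 0 := by
      refine hA b hb hbS'.1 hbS'.2 ?_
      have hba : c b a / 2 = 0 := hc.col_symm 0 _ _ hab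
      rcases haS with rfl | rfl
      exacts [.inl hba, .inr hba]
    obtain ⟨u, hu, v, hv, huS, hvS, huv⟩ := h.linked.exists_cut
      (S := {z | z ≠ q ∧ z ≠ t ∧ c z q / 2 = 0 ∧ c z t / 2 = 0}) hb hq
      ⟨hbS'.1, hbS'.2, hbA⟩ (fun e => e.1 rfl)
    obtain ⟨n1, n2, n3, n4⟩ := huS
    have huv' : c u v / 2 = 2 := huv
    have hvq : v ≠ q := by rintro rfl; omega
    have hvt : v ≠ t := by rintro rfl; omega
    have hvno : ¬ (c v q / 2 = 0 ∨ c v t / 2 = 0) := fun e => hvS ⟨hvq, hvt, hA v hv hvq hvt e⟩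
    refine h.no_star hc hv hu hq ht ((fl u v).trans huv') (hnb v hv q hq fun e => hvno (.inl e))
      (hnb v hv t ht fun e => hvno (.inr e)) n3 ((fl t q).trans nq) n1 htq.symm n2
  · have hqr' := hc.ne (u := q) (v := r) (by omega)
    have hqs' := hc.ne (u := q) (v := s) (by omega)
    have hrs' := hc.ne (u := r) (v := s) (by omega)
    have hall : ∀ t ∈ C, t ≠ q → t ≠ r → t ≠ s →
        (c t q / 2 = 0 ∨ c t r / 2 = 0 ∨ c t s / 2 = 0) → c t q / 2 = 0 ∧ c t r / 2 = 0 := by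
      intro t ht n1 n2 n3 e
      have two : ∀ q ∈ C, ∀ r ∈ C, ∀ s ∈ C, c q r / 2 = 2 → c q s / 2 = 2 → c r s / 2 = 2 →
          t ≠ q → c t q / 2 = 0 → c t r / 2 ≠ 0 → c t s / 2 = 0 := by
        intro q hq r hr s hs h1 h2 h3 h4 h5 h6
        by_contra h7
        exact hone ⟨q, hq, r, hr, s, hs, t, ht, h1, h2, h3, h4, h5, hnb t ht r hr h6,
          hnb t ht s hs h7⟩
      have st : ∀ q ∈ C, ∀ r ∈ C, ∀ s ∈ C, c q r / 2 = 2 → c q s / 2 = 2 → c r s / 2 = 2 →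
          t ≠ q → t ≠ r → c t q / 2 = 0 → c t r / 2 = 0 → c t s / 2 = 0 := by
        intro q hq r hr s hs h1 h2 h3 h4 h5 h6 h7
        by_contra h8
        exact h.no_star hc hs hq ht hr ((fl q s).trans h2)
          ((fl t s).trans (hnb t ht s hs h8)) ((fl r s).trans h3) ((fl t q).trans h6) h7 h4.symm h5
          (hc.ne (by omega))
      have all : ∀ q ∈ C, ∀ r ∈ C, ∀ s ∈ C, c q r / 2 = 2 → c q s / 2 = 2 → c r s / 2 = 2 →
          t ≠ q → t ≠ r → t ≠ s → c t q / 2 = 0 → c t r / 2 = 0 ∧ c t s / 2 = 0 := by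
        intro q hq r hr s hs h1 h2 h3 h4 h5 h6 h7
        have k : c t r / 2 = 0 := by
          by_contra k
          exact k (st q hq s hs r hr h2 h1 ((fl r s).trans h3) h4 h6 h7
            (two q hq r hr s hs h1 h2 h3 h4 h7 k))
        exact ⟨k, st q hq r hr s hs h1 h2 h3 h4 h5 h7 k⟩
      rcases e with e | e | e
      · exact ⟨e, (all q hq r hr s hs hqr hqs hrs n1 n2 n3 e).1⟩
      · exact ⟨(all r hr q hq s hs ((fl q r).trans hqr) hrs hqs n2 n1 n3 e).1, e⟩
      · exact all s hs q hq r hr ((fl q s).trans hqs) ((fl r s).trans hrs) hqr n3 n1 n2 e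
    obtain ⟨a, ha, -, -, hqa, -, hqa', -, -⟩ := h0.exists_path hq hr hqr' (by omega)
    have har : a ≠ r := by rintro rfl; omega
    have has : a ≠ s := by rintro rfl; omega
    obtain ⟨u, hu, v, hv, huS, hvS, huv⟩ := h.linked.exists_cut
      (S := {z | z ≠ q ∧ z ≠ r ∧ z ≠ s ∧ c z q / 2 = 0 ∧ c z r / 2 = 0}) ha hq
      ⟨hqa'.symm, har, has, hall a ha hqa'.symm har has (.inl ((fl q a).trans hqa))⟩
      (fun e => e.1 rfl)
    obtain ⟨n1, n2, n3, n4, n5⟩ := huS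
    have huv' : c u v / 2 = 2 := huv
    have hvu : c v u / 2 = 2 := (fl u v).trans huv'
    have hvq : v ≠ q := by rintro rfl; omega
    have hvr : v ≠ r := by rintro rfl; omega
    have hvs : v ≠ s := by
      rintro rfl
      exact h.no_star hc hv hq hu hr ((fl q v).trans hqs) hvu ((fl r v).trans hrs)
        ((fl u q).trans n4) n5 n1.symm n2 hqr'
    have hvno : ¬ (c v q / 2 = 0 ∨ c v r / 2 = 0 ∨ c v s / 2 = 0) := fun e =>
      hvS ⟨hvq, hvr, hvs, hall v hv hvq hvr hvs e⟩
    exact h.no_star hc hv hq hu hr (hnb v hv q hq fun e => hvno (.inl e)) hvu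
      (hnb v hv r hr fun e => hvno (.inr (.inl e))) ((fl u q).trans n4) n5 n1.symm n2 hqr'

end Linked


/-- A finite connected partial injection has an orientation-reversing bijection. -/
theorem exists_reversal {A : V → V → Prop} {X : Set V} (hX : X.Finite)
    (hfun : ∀ x ∈ X, ∀ y ∈ X, ∀ z ∈ X, A x y → A x z → y = z)
    (hinj : ∀ x ∈ X, ∀ y ∈ X, ∀ z ∈ X, A y x → A z x → y = z)
    (hlink : Linked (fun u v => A u v ∨ A v u) X) :
    ∃ f : V → V, Set.BijOn f X X ∧ ∀ x ∈ X, ∀ y ∈ X, A x y ↔ A (f y) (f x) := by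
  classical
  by_cases hs : ∃ s ∈ X, ∀ y ∈ X, ¬ A s y
  · obtain ⟨s, hs, hsA⟩ := hs
    let σ : V → V := fun x => if h : ∃ y ∈ X, A x y then h.choose else x
    have hσ : ∀ x ∈ X, ∀ y ∈ X, A x y → σ x = y := by
      intro x hx y hy hxy
      have h : ∃ y ∈ X, A x y := ⟨y, hy, hxy⟩
      simp only [σ, dif_pos h]
      exact hfun x hx _ h.choose_spec.1 _ hy h.choose_spec.2 hxy
    have hσ' : ∀ x ∈ X, (∃ y ∈ X, A x y ∧ σ x = y) ∨ σ x = x := by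
      intro x hx
      by_cases h : ∃ y ∈ X, A x y
      · exact .inl ⟨h.choose, h.choose_spec.1, h.choose_spec.2, by simp only [σ, dif_pos h]⟩
      · exact .inr (by simp only [σ, dif_neg h])
    have hfix : ∀ x, σ x = x → ∀ n, σ^[n] x = x := fun x hx n => Function.iterate_fixed hx n
    have hreach : ∀ x ∈ X, ∃ n, σ^[n] x = s := by
      refine hlink.induction hs ⟨0, rfl⟩ ?_
      rintro u hu v hv ⟨n, hn⟩ (h | h)
      · cases n with
        | zero => exact absurd (by rwa [← show u = s from hn] : A s v) (hsA v hv)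
        | succ n =>
          rw [Function.iterate_succ_apply, hσ u hu v hv h] at hn
          exact ⟨n, hn⟩
      · exact ⟨n + 1, by rw [Function.iterate_succ_apply, hσ v hv u hu h, hn]⟩
    let d : V → ℕ := fun x => if h : ∃ n, σ^[n] x = s then Nat.find h else 0
    have hd : ∀ x ∈ X, σ^[d x] x = s := by
      intro x hx
      simp only [d, dif_pos (hreach x hx)]
      exact Nat.find_spec (hreach x hx)
    have hdmin : ∀ x ∈ X, ∀ n, σ^[n] x = s → d x ≤ n := by
      intro x hx n hn
      simp only [d, dif_pos (hreach x hx)]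
      exact Nat.find_min' _ hn
    have hstep : ∀ x ∈ X, ∀ y ∈ X, A x y → d x = d y + 1 := by
      intro x hx y hy hxy
      refine le_antisymm (hdmin x hx _ ?_) ?_
      · rw [Function.iterate_succ_apply, hσ x hx y hy hxy, hd y hy]
      · have h1 := hd x hx
        rcases hdx : d x with _ | n
        · rw [hdx] at h1
          exact absurd (by rwa [← show x = s from h1] : A s y) (hsA y hy)
        · rw [hdx, Function.iterate_succ_apply, hσ x hx y hy hxy] at h1
          have := hdmin y hy n h1
          omega
    have hsucc : ∀ x ∈ X, d x ≠ 0 → ∃ y ∈ X, A x y := by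
      intro x hx hdx
      rcases hσ' x hx with ⟨y, hy, hxy, -⟩ | h
      · exact ⟨y, hy, hxy⟩
      · have h1 := hd x hx
        rw [hfix x h] at h1
        have := hdmin x hx 0 h1
        omega
    have hdinj : ∀ n, ∀ x ∈ X, ∀ y ∈ X, d x = n → d y = n → x = y := by
      intro n
      induction n with
      | zero =>
        intro x hx y hy h1 h2
        have e1 := hd x hx
        have e2 := hd y hy
        rw [h1] at e1
        rw [h2] at e2
        exact (show x = s from e1).trans (show y = s from e2).symm
      | succ n ih =>
        intro x hx y hy h1 h2
        obtain ⟨x', hx', hxx'⟩ := hsucc x hx (by omega)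
        obtain ⟨y', hy', hyy'⟩ := hsucc y hy (by omega)
        have e1 := hstep x hx x' hx' hxx'
        have e2 := hstep y hy y' hy' hyy'
        have := ih x' hx' y' hy' (by omega) (by omega)
        subst this
        exact hinj x' hx' x hx y hy hxx' hyy'
    have hcov : ∀ x ∈ X, ∀ y ∈ X, A x y ↔ d y < d x ∧ ¬ ∃ z ∈ X, d y < d z ∧ d z < d x := by
      intro x hx y hy
      constructor
      · intro h
        have := hstep x hx y hy h
        exact ⟨by omega, by rintro ⟨z, -, h1, h2⟩; omega⟩
      · rintro ⟨h1, h2⟩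
        obtain ⟨x', hx', hxx'⟩ := hsucc x hx (by omega)
        have e1 := hstep x hx x' hx' hxx'
        by_cases h : d x' = d y
        · rwa [hdinj _ x' hx' y hy h rfl] at hxx'
        · exact absurd ⟨x', hx', by omega, by omega⟩ h2
    let P : Dgraph V := ⟨fun x y => d x < d y, fun x h => lt_irrefl _ h⟩
    have hP : ChainOn P X := by
      refine ⟨fun x hx y hy hxy => ?_, fun x _ y _ z _ h1 h2 h3 => ?_⟩
      · have : d x ≠ d y := fun h => hxy (hdinj _ x hx y hy h rfl)
        simp only [Dir, P]
        omega
      · exact lt_irrefl _ (h1.trans (h2.trans h3))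
    obtain ⟨f, hf, hfP⟩ := hP.isoOn hX hX rfl hP.dual
    refine ⟨f, hf, fun x hx y hy => ?_⟩
    rw [hcov x hx y hy, hcov _ (hf.mapsTo hy) _ (hf.mapsTo hx)]
    have hlt : ∀ u ∈ X, ∀ v ∈ X, d u < d v ↔ d (f v) < d (f u) := fun u hu v hv => hfP u hu v hv
    rw [hlt y hy x hx]
    refine and_congr_right' (not_congr ⟨?_, ?_⟩)
    · rintro ⟨z, hz, h1, h2⟩
      exact ⟨f z, hf.mapsTo hz, (hlt z hz x hx).1 h2, (hlt y hy z hz).1 h1⟩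
    · rintro ⟨z, hz, h1, h2⟩
      obtain ⟨z, hz', rfl⟩ := hf.surjOn hz
      exact ⟨z, hz', (hlt y hy z hz').2 h2, (hlt z hz' x hx).2 h1⟩
  · push Not at hs
    choose! g hg hgA using hs
    have : Finite X := hX
    have hginj : Function.Injective (fun x : X => (⟨g x, hg x x.2⟩ : X)) := by
      intro x y hxy
      have e : g x = g y := congrArg Subtype.val hxy
      have h2 := hgA y y.2
      rw [← e] at h2
      exact Subtype.ext (hinj _ (hg x x.2) x x.2 y y.2 (hgA x x.2) h2)
    let σ : Equiv.Perm X := Equiv.ofBijective _ (Finite.injective_iff_bijective.1 hginj)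
    have : Fintype X := Fintype.ofFinite X
    obtain ⟨τ, hτ⟩ := isConj_iff.1 (Equiv.Perm.isConj_iff_cycleType_eq.2
      (Equiv.Perm.cycleType_inv σ).symm)
    have hσ : ∀ x y : X, A x y ↔ σ x = y := by
      intro x y
      constructor
      · intro h
        exact Subtype.ext (hfun x x.2 _ (hg x x.2) _ y.2 (hgA x x.2) h)
      · rintro rfl
        exact hgA x x.2
    have hτ' : ∀ x y : X, σ x = y ↔ σ (τ y) = τ x := by
      intro x y
      have h1 : τ (σ x) = σ⁻¹ (τ x) := by
        have := Equiv.congr_fun (mul_inv_eq_iff_eq_mul.1 hτ) x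
        simpa using this
      rw [← τ.injective.eq_iff, h1, Equiv.Perm.inv_eq_iff_eq]
      exact eq_comm
    refine ⟨fun x => if h : x ∈ X then (τ ⟨x, h⟩ : V) else x, ⟨?_, ?_, ?_⟩, ?_⟩
    · intro x hx
      simp only [dif_pos hx]
      exact (τ ⟨x, hx⟩).2
    · intro x hx y hy hxy
      simp only [dif_pos hx, dif_pos hy] at hxy
      exact congrArg Subtype.val (τ.injective (Subtype.ext hxy))
    · intro y hy
      refine ⟨τ.symm ⟨y, hy⟩, (τ.symm ⟨y, hy⟩).2, ?_⟩
      simp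
    · intro x hx y hy
      simp only [dif_pos hx, dif_pos hy]
      rw [hσ, ← hτ', ← hσ]

section Linked

variable {G H : Dgraph V} {c : V → V → ℕ} {w : V} {C : Set V}

theorem BlueOver.blue_fun (hc : Good c) (h : BlueOver c w C) (h0 : Linked (Col c 0) C) {x y z : V}
    (hx : x ∈ C) (hy : y ∈ C) (hz : z ∈ C) (h1 : c x y / 2 = 2) (h2 : c x z = c x y) : y = z := by
  by_contra hyz
  have h3 := h.no_red hc h0 hy hz
  have h4 : c y z / 2 ≠ 2 := fun h4 => h.not_triangle hc h0 hx hy hz h1 (by omega) h4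
  have := hc.lt y z
  exact h.no_peak hc hy hz hyz (by omega) h1 (by omega) h2.symm

theorem BlueOver.neutral_at (hc : Good c) (h : BlueOver c w C) (h0 : Linked (Col c 0) C)
    {u y y' : V} (hu : u ∈ C) (hy : y ∈ C) (hy' : y' ∈ C) (huy : u ≠ y) (huy' : u ≠ y')
    (h1 : c u y / 2 = 0) (h2 : c u y' / 2 = 0) : c u y = c u y' := by
  have fl := hc.flip_div
  have hnb : ∀ u ∈ C, ∀ v ∈ C, c u v / 2 ≠ 2 → c u v / 2 = 0 := by
    intro u hu v hv h2
    have := h.no_red hc h0 hu hv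
    have := hc.lt u v
    omega
  have hcut : ∀ y ∈ C, u ≠ y → c u y / 2 = 0 → ∃ p ∈ C, ∃ g ∈ C, u ≠ p ∧ c u p = c u y ∧
      c p g / 2 = 2 ∧ c g u / 2 = 2 := by
    intro y hy huy h1
    obtain ⟨p, hp, g, hg, hpS, hgS, hpg⟩ := h.linked.exists_cut
      (S := {z | u ≠ z ∧ c u z = c u y}) hy hu ⟨huy, rfl⟩ (fun e => e.1 rfl)
    refine ⟨p, hp, g, hg, hpS.1, hpS.2, hpg, ?_⟩
    by_contra hgu
    have hgu0 := hnb g hg u hu hgu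
    have hpg' : c p g / 2 = 2 := hpg
    have hug : u ≠ g := by
      rintro rfl
      have := fl u p
      have := hpS.2
      omega
    refine hgS ⟨hug, ?_⟩
    have := hpS.2
    rw [← hpS.2]
    exact (hc.neutral_eq hpg' (h.red p hp) (h.red g hg) (x := u) (by omega)
      ((fl g u).trans hgu0)).symm
  by_contra hne
  obtain ⟨y, hy, g, hg, huy, e, hyg, hgu⟩ := hcut y hy huy h1
  obtain ⟨y', hy', g', hg', huy', e', hyg', hgu'⟩ := hcut y' hy' huy' h2
  rw [← e, ← e'] at hne
  rw [← e] at h1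
  rw [← e'] at h2
  have hyy' : y ≠ y' := by rintro rfl; exact hne rfl
  have h1' := (fl u y).trans h1
  have h2' := (fl u y').trans h2
  have hyg2 := (fl y g).trans hyg
  have hyg2' := (fl y' g').trans hyg'
  have n1 : c g y' / 2 = 0 := hnb _ hg _ hy' fun hb =>
    h.no_star hc hg hy hu hy' hyg2 hgu hb h1' h2 huy.symm huy' hyy'
  have n2 : c g' y / 2 = 0 := hnb _ hg' _ hy fun hb =>
    h.no_star hc hg' hy' hu hy hyg2' hgu' hb h2' h1 huy'.symm huy hyy'.symm
  have hgg' : g ≠ g' := by rintro rfl; omega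
  have n3 : c g g' / 2 = 0 := hnb _ hg _ hg' fun hb =>
    h.not_triangle hc h0 hu hg hg' ((fl g u).trans hgu) ((fl g' u).trans hgu') hb
  have r := h.red
  have k1 := hc.neutral_eq (x := y') hgu (r g hg) (r u hu) ((fl g y').trans n1) h2'
  have k2 := hc.neutral_eq (x := g) hyg' (r y' hy') (r g' hg') n1 n3
  have k3 := hc.neutral_eq (x := g') hyg (r y hy) (r g hg) n2 ((fl g g').trans n3)
  have k4 := hc.neutral_eq (x := y) hgu' (r g' hg') (r u hu) ((fl g' y).trans n2) h1'
  have s1 := hc.neutral_flip h1 rfl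
  have s2 := hc.neutral_flip h2 rfl
  have s3 := hc.neutral_flip n1 rfl
  have s4 := hc.neutral_flip n2 rfl
  have s5 := hc.neutral_flip n3 rfl
  omega

theorem BlueOver.neutral_const (hc : Good c) (h : BlueOver c w C) (h0 : Linked (Col c 0) C) :
    ∃ e, ∀ u ∈ C, ∀ v ∈ C, u ≠ v → c u v / 2 = 0 → c u v = e := by
  by_cases hN : ∃ u ∈ C, ∃ v ∈ C, u ≠ v ∧ c u v / 2 = 0
  · obtain ⟨a, ha, b, hb, hab, hN⟩ := hN
    refine ⟨c a b, h0.induction ha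
      (fun v hv hav h1 => h.neutral_at hc h0 ha hv hb hav hab h1 hN) ?_⟩
    intro u hu v hv ih huv x hx hvx h1
    by_cases huv' : u = v
    · subst huv'
      exact ih x hx hvx h1
    · have h2 := ih v hv huv' huv
      have h3 := hc.neutral_flip (x := u) (y := v) huv rfl
      have huv0 : c u v / 2 = 0 := huv
      rw [h.neutral_at hc h0 hv hx hu hvx (Ne.symm huv') h1 (by omega), h3, h2]
  · exact ⟨0, fun u hu v hv huv h1 => absurd ⟨u, hu, v, hv, huv, h1⟩ hN⟩

theorem BlueOver.isoOn_linked (hc : Coded G H c) (h : BlueOver c w C) (h0 : Linked (Col c 0) C)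
    {Y : Set V} (hY : Y.Finite) (hYC : Y ⊆ C) : IsoOn G H Y Y := by
  obtain ⟨e, he⟩ := h.neutral_const hc.toGood h0
  have hr := @BlueOver.no_red _ _ _ _ hc.toGood h h0
  have hf := @BlueOver.blue_fun _ _ _ _ hc.toGood h h0
  have h3 : ∀ u ∈ C, ∀ v ∈ C, u ≠ v → c u v = e ∨ c u v = 4 ∨ c u v = 5 := by
    intro u hu v hv huv
    have := hr hu hv
    have := hc.lt u v
    by_cases h1 : c u v / 2 = 0
    · exact .inl (he u hu v hv huv h1)
    · omega
  refine IsoOn.glue (Reach (Col c 2) Y) (Reach.equivalence (hc.col_symm 2)) ?_ ?_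
  · intro x hx
    have hXY : {y | Reach (Col c 2) Y x y} ⊆ Y := fun y hy => hy.mem hx
    rw [Set.inter_eq_right.2 hXY]
    have hl := linked_reach (X := Y) (hc.col_symm 2) x
    generalize {y | Reach (Col c 2) Y x y} = X at hXY hl
    have hXC := hXY.trans hYC
    have hA : (fun u v => c u v = 4 ∨ c v u = 4) = Col c 2 := by
      funext u v
      have := hc.flip_eq u v
      change _ = (c u v / 2 = 2)
      apply propext
      omega
    obtain ⟨f, hfX, hfA⟩ := exists_reversal (A := fun u v => c u v = 4) (hY.subset hXY)
      (fun x hx y hy z hz h1 h2 => hf (hXC hx) (hXC hy) (hXC hz) (by omega) (h2.trans h1.symm))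
      (fun x hx y hy z hz h1 h2 => by
        have h1 := hc.eq_five h1
        have h2 := hc.eq_five h2
        exact hf (hXC hx) (hXC hy) (hXC hz) (by omega) (h2.trans h1.symm))
      (by rwa [hA])
    refine ⟨f, hfX, fun u hu v hv => ?_⟩
    rw [hc.fst, hc.snd]
    by_cases huv : u = v
    · subst huv
      simp [hc.diag]
    · have huv' : f u ≠ f v := fun h => huv (hfX.injOn hu hv h)
      have a1 := h3 u (hXC hu) v (hXC hv) huv
      have a2 := h3 _ (hXC (hfX.mapsTo hu)) _ (hXC (hfX.mapsTo hv)) huv'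
      have b1 := hfA u hu v hv
      have b2 := hfA v hv u hu
      have b3 := hc.flip_eq u v
      have b4 := hc.flip_eq (f u) (f v)
      have r1 := hr (hXC hu) (hXC hv)
      have r2 := hr (hXC (hfX.mapsTo hu)) (hXC (hfX.mapsTo hv))
      generalize c u v = p at *
      generalize c (f u) (f v) = q at *
      omega
  · intro x hx y hy x' hx' y' hy' hxy hxx' hyy'
    have hxy' : ¬ Reach (Col c 2) Y x' y' := fun h' =>
      hxy ((hxx'.trans h').trans ((Reach.equivalence (hc.col_symm 2)).symm hyy'))
    have key : ∀ x ∈ Y, ∀ y ∈ Y, ¬ Reach (Col c 2) Y x y → c x y = e ∧ c x y / 2 = 0 := by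
      intro x hx y hy hxy
      have hne : x ≠ y := by rintro rfl; exact hxy .refl
      have h2 : c x y / 2 ≠ 2 := fun h => hxy (Reach.step hx hy h)
      have := hr (hYC hx) (hYC hy)
      have := hc.lt x y
      have h0 : c x y / 2 = 0 := by omega
      exact ⟨he x (hYC hx) y (hYC hy) hne h0, h0⟩
    have k1 := key x hx y hy hxy
    have k2 := key x' hx' y' hy' hxy'
    rw [hc.fst, hc.snd]
    omega

end Linked


/-! Intervals, contractions, and reversal of arcs inside a family of sets. -/

section Interval

variable {G H K : Dgraph V} {I J : Set V}

theorem isInterval_iff : G.IsInterval I ↔ ∀ x ∉ I, ∀ y ∈ I, ∀ z ∈ I,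
    (G.Arc x y ↔ G.Arc x z) ∧ (G.Arc y x ↔ G.Arc z x) := by
  constructor
  · intro h x hx y hy z hz
    rcases h x hx with h | h | h | h <;> simp [h y hy, h z hz]
  · intro h x hx
    rcases I.eq_empty_or_nonempty with rfl | ⟨y, hy⟩
    · simp
    · have key := fun z hz => h x hx z hz y hy
      by_cases h1 : G.Arc x y <;> by_cases h2 : G.Arc y x
      · exact .inr (.inr (.inl fun z hz => ⟨(key z hz).1.2 h1, (key z hz).2.2 h2⟩))
      · exact .inl fun z hz => ⟨(key z hz).1.2 h1, fun h3 => h2 ((key z hz).2.1 h3)⟩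
      · exact .inr (.inl fun z hz => ⟨(key z hz).2.2 h2, fun h3 => h1 ((key z hz).1.1 h3)⟩)
      · exact .inr (.inr (.inr fun z hz =>
          ⟨fun h3 => h1 ((key z hz).1.1 h3), fun h3 => h2 ((key z hz).2.1 h3)⟩))

theorem IsInterval.dual (h : G.IsInterval I) : G.dual.IsInterval I := by
  rw [isInterval_iff] at h ⊢
  exact fun x hx y hy z hz => (h x hx y hy z hz).symm

theorem IsInterval.image (e : V ≃ V) (he : ∀ x y, G.Arc x y ↔ K.Arc (e x) (e y))
    (h : G.IsInterval I) : K.IsInterval (e '' I) := by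
  rw [isInterval_iff] at h ⊢
  intro x hx
  obtain ⟨x, rfl⟩ := e.surjective x
  rintro _ ⟨y, hy, rfl⟩ _ ⟨z, hz, rfl⟩
  simp only [← he]
  exact h x (fun h' => hx ⟨x, h', rfl⟩) y hy z hz

theorem isoOn_image (e : V ≃ V) (he : ∀ x y, G.Arc x y ↔ K.Arc (e x) (e y)) :
    IsoOn G K I (e '' I) :=
  ⟨e, e.injective.injOn.bijOn_image, fun x _ y _ => he x y⟩

theorem DFTOn.of_isoOn (h : DFTOn G I) (hI : IsoOn G K I J) : DFTOn K J := by
  obtain ⟨f, hf, hfK⟩ := hI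
  refine ⟨fun x hx y hy hxy => ?_, fun x hx y hy z hz t ht => ?_⟩
  · obtain ⟨x, hx', rfl⟩ := hf.surjOn hx
    obtain ⟨y, hy', rfl⟩ := hf.surjOn hy
    have := h.1 x hx' y hy' (fun h => hxy (congrArg f h))
    simpa only [Dir, hfK x hx' y hy', hfK y hy' x hx'] using this
  · obtain ⟨x, hx', rfl⟩ := hf.surjOn hx
    obtain ⟨y, hy', rfl⟩ := hf.surjOn hy
    obtain ⟨z, hz', rfl⟩ := hf.surjOn hz
    obtain ⟨t, ht', rfl⟩ := hf.surjOn ht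
    have := h.2 x hx' y hy' z hz' t ht'
    simpa only [hfK x hx' y hy', hfK y hy' z hz', hfK z hz' x hx', hfK t ht' x hx', hfK t ht' y hy',
      hfK t ht' z hz', hfK x hx' t ht', hfK y hy' t ht', hfK z hz' t ht'] using this

theorem DFTOn.of_finite (h : ∀ Y : Set V, Y.Finite → Y ⊆ I → DFTOn G Y) : DFTOn G I := by
  refine ⟨fun x hx y hy hxy => ?_, fun x hx y hy z hz t ht => ?_⟩
  · exact (h {x, y} (Set.toFinite _) (by simp [Set.insert_subset_iff, hx, hy])).1 x (by simp) y
      (by simp) hxy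
  · exact (h {x, y, z, t} (Set.toFinite _) (by simp [Set.insert_subset_iff, hx, hy, hz, ht])).2
      x (by simp) y (by simp) z (by simp) t (by simp)

/-- A proper interval inducing a diamond-free tournament which is not self-dual. -/
structure Special (G : Dgraph V) (I : Set V) : Prop where
  interval : G.IsInterval I
  dft : DFTOn G I
  not_selfDual : ¬ IsoOn G G.dual I I
  ne_univ : I ≠ Set.univ

theorem Special.nonempty (h : Special G I) : I.Nonempty := by
  by_contra hne
  rw [Set.not_nonempty_iff_eq_empty] at hne
  exact h.not_selfDual (hne ▸ IsoOn.of_eq fun x hx => absurd hx (Set.notMem_empty x))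

theorem Special.dual (h : Special G I) : Special G.dual I :=
  ⟨h.interval.dual, h.dft.dual, fun h' => h.not_selfDual h'.symm, h.ne_univ⟩

theorem Special.image (e : V ≃ V) (he : ∀ x y, G.Arc x y ↔ K.Arc (e x) (e y))
    (h : Special G I) : Special K (e '' I) where
  interval := h.interval.image e he
  dft := h.dft.of_isoOn (isoOn_image e he)
  not_selfDual h' :=
    h.not_selfDual (((isoOn_image e he).trans h').trans (isoOn_image e he).dual.symm)
  ne_univ h' := h.ne_univ (Set.eq_univ_of_forall fun x => e.injective.mem_set_image.1 (h' ▸ Set.mem_univ (e x)))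

/-- An isomorphism from `G` contracted along `I` onto `H` contracted along `J`. -/
def OutIso (G H : Dgraph V) (I J : Set V) : Prop :=
  ∃ f : V → V, Set.BijOn f Iᶜ Jᶜ ∧ (∀ x ∈ Iᶜ, ∀ y ∈ Iᶜ, (G.Arc x y ↔ H.Arc (f x) (f y))) ∧
    ∀ x ∈ Iᶜ, ∀ z ∈ I, ∀ z' ∈ J, (G.Arc x z ↔ H.Arc (f x) z') ∧ (G.Arc z x ↔ H.Arc z' (f x))

end Interval


section OutIso

variable {G H K : Dgraph V} {I J L : Set V}

theorem OutIso.dual (h : OutIso G H I J) : OutIso G.dual H.dual I J := by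
  obtain ⟨f, hf, h1, h2⟩ := h
  exact ⟨f, hf, fun x hx y hy => h1 y hy x hx, fun x hx z hz z' hz' => (h2 x hx z hz z' hz').symm⟩

theorem OutIso.trans (h : OutIso G H I J) (h' : OutIso H K J L) (hJ : J.Nonempty) :
    OutIso G K I L := by
  obtain ⟨f, hf, hf1, hf2⟩ := h
  obtain ⟨g, hg, hg1, hg2⟩ := h'
  obtain ⟨j, hj⟩ := hJ
  refine ⟨g ∘ f, hg.comp hf, fun x hx y hy => ?_, fun x hx z hz z' hz' => ?_⟩
  · exact (hf1 x hx y hy).trans (hg1 _ (hf.mapsTo hx) _ (hf.mapsTo hy))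
  · have h1 := hf2 x hx z hz j hj
    have h2 := hg2 _ (hf.mapsTo hx) j hj z' hz'
    exact ⟨h1.1.trans h2.1, h1.2.trans h2.2⟩

theorem OutIso.of_equiv (e : V ≃ V) (he : ∀ x y, G.Arc x y ↔ K.Arc (e x) (e y))
    (hJ : K.IsInterval J) (heI : e '' I = J) : OutIso G K I J := by
  subst heI
  rw [isInterval_iff] at hJ
  refine ⟨e, ?_, fun x _ y _ => he x y, ?_⟩
  · rw [← Set.image_compl_eq e.bijective]
    exact e.injective.injOn.bijOn_image
  · intro x hx z hz z' hz'
    rw [he, he]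
    exact hJ (e x) (fun h => hx (e.injective.mem_set_image.1 h)) _ ⟨z, hz, rfl⟩ z' hz'

theorem OutIso.iso (h : OutIso G K I J) (h' : IsoOn G K I J) : Iso G K := by
  classical
  obtain ⟨f, hf, hf1, hf2⟩ := h
  obtain ⟨g, hg, hg1⟩ := h'
  rw [← isoOn_univ_iff]
  have hgf : ∀ x, x ∈ I → (if x ∈ I then g x else f x) = g x := fun x hx => if_pos hx
  have hff : ∀ x, x ∉ I → (if x ∈ I then g x else f x) = f x := fun x hx => if_neg hx
  refine ⟨fun x => if x ∈ I then g x else f x, ?_, ?_⟩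
  · have h1 : Set.BijOn (fun x => if x ∈ I then g x else f x) I J := hg.congr fun x hx => (hgf x hx).symm
    have h2 : Set.BijOn (fun x => if x ∈ I then g x else f x) Iᶜ Jᶜ :=
      hf.congr fun x hx => (hff x hx).symm
    have h3 := h1.union h2 ?_
    · simpa using h3
    · rw [Set.injOn_union disjoint_compl_right]
      refine ⟨h1.injOn, h2.injOn, fun x hx y hy hxy => h2.mapsTo hy (hxy ▸ h1.mapsTo hx)⟩
  · intro x _ y _
    by_cases hx : x ∈ I <;> by_cases hy : y ∈ I
    · simp only [hx, hy, if_true]; exact hg1 x hx y hy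
    · simp only [hx, hy, if_true, if_false]; exact (hf2 y hy x hx _ (hg.mapsTo hx)).2
    · simp only [hx, hy, if_true, if_false]; exact (hf2 x hx y hy _ (hg.mapsTo hy)).1
    · simp only [hx, hy, if_false]; exact hf1 x hx y hy

theorem contractIsoFix_iff (hG : G.IsInterval I) (hK : K.IsInterval I) (hI : I.Nonempty) :
    ContractIsoFix G K I ↔ OutIso G K I I := by
  classical
  rw [isInterval_iff] at hG hK
  obtain ⟨i, hi⟩ := hI
  constructor
  · rintro ⟨e, he, h⟩
    have hs : ∀ x : {x // x ∉ I}, ∃ y : {x // x ∉ I}, e (some x) = some y := by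
      intro x
      rcases hx : e (some x) with _ | y
      · exact absurd (e.injective (hx.trans he.symm)) (by simp)
      · exact ⟨y, rfl⟩
    choose g hg using hs
    have hgi : ∀ x (hx : x ∈ Iᶜ), (if hx : x ∈ I then x else (g ⟨x, hx⟩ : V)) = g ⟨x, hx⟩ :=
      fun x hx => dif_neg hx
    refine ⟨fun x => if hx : x ∈ I then x else g ⟨x, hx⟩, ⟨?_, ?_, ?_⟩, ?_, ?_⟩
    · intro x hx
      simp only [hgi x hx]
      exact (g ⟨x, hx⟩).2
    · intro x hx y hy hxy
      simp only [hgi x hx, hgi y hy] at hxy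
      have h1 : e (some ⟨x, hx⟩) = e (some ⟨y, hy⟩) := by rw [hg, hg, Subtype.ext hxy]
      simpa using e.injective h1
    · intro y hy
      obtain ⟨x, hx⟩ := e.surjective (some ⟨y, hy⟩)
      rcases x with _ | x
      · rw [he] at hx; simp at hx
      · refine ⟨x, x.2, ?_⟩
        simp only [hgi x x.2]
        rw [hg] at hx
        simpa using congrArg Subtype.val (Option.some_injective _ hx)
    · intro x hx y hy
      simp only [hgi x hx, hgi y hy]
      have := h (some ⟨x, hx⟩) (some ⟨y, hy⟩)
      rw [hg, hg] at this
      exact this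
    · intro x hx z hz z' hz'
      simp only [hgi x hx]
      have h1 := h (some ⟨x, hx⟩) none
      have h2 := h none (some ⟨x, hx⟩)
      rw [hg, he] at h1 h2
      have hgI := (g ⟨x, hx⟩).2
      constructor
      · calc _ ↔ ∃ z ∈ I, G.Arc x z :=
            ⟨fun h => ⟨z, hz, h⟩, fun ⟨u, hu, h⟩ => (hG x hx z hz u hu).1.2 h⟩
          _ ↔ _ := h1
          _ ↔ _ := ⟨fun ⟨u, hu, h⟩ => (hK _ hgI z' hz' u hu).1.2 h, fun h => ⟨z', hz', h⟩⟩
      · calc _ ↔ ∃ z ∈ I, G.Arc z x :=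
            ⟨fun h => ⟨z, hz, h⟩, fun ⟨u, hu, h⟩ => (hG x hx z hz u hu).2.2 h⟩
          _ ↔ _ := h2
          _ ↔ _ := ⟨fun ⟨u, hu, h⟩ => (hK _ hgI z' hz' u hu).2.2 h, fun h => ⟨z', hz', h⟩⟩
  · rintro ⟨f, hf, h1, h2⟩
    let e : {x // x ∉ I} ≃ {x // x ∉ I} := Set.BijOn.equiv f hf
    refine ⟨Equiv.optionCongr e, rfl, ?_⟩
    have key : ∀ x hx, ((e ⟨x, hx⟩ : {x // x ∉ I}) : V) = f x := fun x hx => rfl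
    rintro (_ | ⟨x, hx⟩) (_ | ⟨y, hy⟩)
    · simp [contract]
    · simp only [contract, Equiv.optionCongr_apply, Option.map_none, Option.map_some, key]
      constructor
      · rintro ⟨z, hz, h⟩
        exact ⟨z, hz, (h2 y hy z hz z hz).2.1 h⟩
      · rintro ⟨z, hz, h⟩
        exact ⟨z, hz, (h2 y hy z hz z hz).2.2 h⟩
    · simp only [contract, Equiv.optionCongr_apply, Option.map_none, Option.map_some, key]
      constructor
      · rintro ⟨z, hz, h⟩
        exact ⟨z, hz, (h2 x hx z hz z hz).1.1 h⟩
      · rintro ⟨z, hz, h⟩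
        exact ⟨z, hz, (h2 x hx z hz z hz).1.2 h⟩
    · simpa only [contract, Equiv.optionCongr_apply, Option.map_some, key] using h1 x hx y hy

end OutIso

section DiamondFree

variable {G : Dgraph V} {I : Set V}

theorem exists_of_isDiamond (X : Set V) : IsDiamond (G.ind X) → ∃ x ∈ X, ∃ y ∈ X, ∃ z ∈ X, ∃ t ∈ X,
    G.Arc x y ∧ G.Arc y z ∧ G.Arc z x ∧
      ((G.Arc t x ∧ G.Arc t y ∧ G.Arc t z) ∨ (G.Arc x t ∧ G.Arc y t ∧ G.Arc z t)) := by
  intro h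
  have := h.symm
  rcases this with ⟨e, he⟩ | ⟨e, he⟩
  · refine ⟨e 1, (e 1).2, e 2, (e 2).2, e 3, (e 3).2, e 0, (e 0).2, ?_⟩
    have h0 := he 0 1
    have h1 := he 0 2
    have h2 := he 0 3
    have h3 := he 1 2
    have h4 := he 2 3
    have h5 := he 3 1
    simp [diamondD, ofRel, ind] at h0 h1 h2 h3 h4 h5
    exact ⟨h3, h4, h5, .inl ⟨h0, h1, h2⟩⟩
  · refine ⟨e 1, (e 1).2, e 3, (e 3).2, e 2, (e 2).2, e 0, (e 0).2, ?_⟩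
    have h0 := he 1 0
    have h1 := he 2 0
    have h2 := he 3 0
    have h3 := he 2 1
    have h4 := he 3 2
    have h5 := he 1 3
    simp [diamondD, ofRel, ind, Dgraph.dual] at h0 h1 h2 h3 h4 h5
    exact ⟨h5, h4, h3, .inr ⟨h0, h2, h1⟩⟩

theorem Hemi.of_dual {V W : Type*} {G : Dgraph V} {H : Dgraph W} (h : Hemi G.dual H) :
    Hemi G H :=
  Or.symm h

theorem exists_isDiamond (hG : G.IsTournament) {x y z t : V} (h1 : G.Arc x y)
    (h2 : G.Arc y z) (h3 : G.Arc z x) (h : G.Arc t x ∧ G.Arc t y ∧ G.Arc t z) :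
    ∃ X : Set V, IsDiamond (G.ind X) := by
  have ne : ∀ {u v}, G.Arc u v → u ≠ v := fun {u v} h huv => G.irrefl v (huv ▸ h)
  have as : ∀ {u v}, G.Arc u v → ¬ G.Arc v u := fun {u v} h h' => by
    rcases hG u v (ne h) with h'' | h''
    · exact h''.2 h'
    · exact h''.2 h
  obtain ⟨h4, h5, h6⟩ := h
  let f : Fin 4 → V := ![t, x, y, z]
  have hf : Function.Injective f := by
    intro i j hij
    fin_cases i <;> fin_cases j <;> first
      | rfl
      | (exfalso; simp [f] at hij; first
          | exact ne h1 hij | exact ne h2 hij | exact ne h3 hij | exact ne h4 hij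
          | exact ne h5 hij | exact ne h6 hij | exact ne h1 hij.symm | exact ne h2 hij.symm
          | exact ne h3 hij.symm | exact ne h4 hij.symm | exact ne h5 hij.symm
          | exact ne h6 hij.symm)
  refine ⟨Set.range f, Hemi.symm (.inl ⟨Equiv.ofInjective f hf, fun i j => ?_⟩)⟩
  have : ((G.ind (Set.range f)).Arc (Equiv.ofInjective f hf i) (Equiv.ofInjective f hf j)) ↔
      G.Arc (f i) (f j) := Iff.rfl
  rw [this]
  fin_cases i <;> fin_cases j <;>
    simp [f, diamondD, ofRel, G.irrefl, h1, h2, h3, h4, h5, h6, as h1, as h2, as h3, as h4, as h5,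
      as h6]

theorem diamondFreeTournament_iff : DiamondFreeTournament (G.ind I) ↔ DFTOn G I := by
  constructor
  · rintro ⟨h1, h2⟩
    refine ⟨fun x hx y hy hxy => h1 ⟨x, hx⟩ ⟨y, hy⟩ fun h => hxy (congrArg Subtype.val h),
      fun x hx y hy z hz t ht hxy hyz hzx => ⟨?_, ?_⟩⟩
    · intro h
      obtain ⟨X, hX⟩ := exists_isDiamond (G := G.ind I) h1 (x := ⟨x, hx⟩) (y := ⟨y, hy⟩)
        (z := ⟨z, hz⟩) (t := ⟨t, ht⟩) hxy hyz hzx h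
      exact h2 X hX
    · intro h
      obtain ⟨X, hX⟩ := exists_isDiamond (G := (G.ind I).dual)
        (fun u v huv => Or.symm (h1 u v huv)) (x := ⟨x, hx⟩) (y := ⟨z, hz⟩)
        (z := ⟨y, hy⟩) (t := ⟨t, ht⟩) hzx hyz hxy ⟨h.1, h.2.2, h.2.1⟩
      exact h2 X (Hemi.of_dual hX)
  · rintro ⟨h1, h2⟩
    refine ⟨fun x y hxy => h1 x x.2 y y.2 fun h => hxy (Subtype.ext h), fun X hX => ?_⟩
    obtain ⟨x, _, y, _, z, _, t, _, hxy, hyz, hzx, h⟩ := exists_of_isDiamond X hX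
    have := h2 x x.2 y y.2 z z.2 t t.2 hxy hyz hzx
    exact h.elim this.1 this.2

theorem l12Int_iff (hG : G.ArcConnected) : G.L12Int I ↔ Special G I := by
  constructor
  · rintro ⟨h1, h2, h3, h4⟩
    refine ⟨h1, diamondFreeTournament_iff.1 h2, fun h => h3 (isoOn_iff_iso.1 h), ?_⟩
    rintro rfl
    apply h4
    rcases isEmpty_or_nonempty V with hV | ⟨⟨x⟩⟩
    · exact absurd ⟨Equiv.refl _, fun x => (hV.false x.1).elim⟩ h3
    · exact ⟨x, (Set.eq_univ_of_forall fun y => hG x y).symm⟩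
  · rintro ⟨h1, h2, h3, h4⟩
    refine ⟨h1, diamondFreeTournament_iff.2 h2, fun h => h3 (isoOn_iff_iso.2 h), ?_⟩
    rintro ⟨x, rfl⟩
    exact h4 (Set.eq_univ_of_forall fun y => hG x y)

end DiamondFree


section Rev

/-- `x` and `y` lie in a common member of the family `𝓕`. -/
def SameBlock (𝓕 : Set (Set V)) (x y : V) : Prop := ∃ I ∈ 𝓕, x ∈ I ∧ y ∈ I

/-- The digraph obtained by reversing the arcs inside the members of `𝓕`. -/
def rev (𝓕 : Set (Set V)) (G : Dgraph V) : Dgraph V where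
  Arc x y := (SameBlock 𝓕 x y ∧ G.Arc y x) ∨ (¬ SameBlock 𝓕 x y ∧ G.Arc x y)
  irrefl x h := h.elim (fun h => G.irrefl x h.2) (fun h => G.irrefl x h.2)

variable {𝓕 : Set (Set V)} {G : Dgraph V} {x y : V}

theorem rev_arc_of_sameBlock (h : SameBlock 𝓕 x y) : (rev 𝓕 G).Arc x y ↔ G.Arc y x := by
  simp [rev, h]

theorem rev_arc_of_not_sameBlock (h : ¬ SameBlock 𝓕 x y) :
    (rev 𝓕 G).Arc x y ↔ G.Arc x y := by
  simp [rev, h]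

theorem SameBlock.symm (h : SameBlock 𝓕 x y) : SameBlock 𝓕 y x :=
  let ⟨I, hI, hx, hy⟩ := h
  ⟨I, hI, hy, hx⟩

theorem sameBlock_singleton {I : Set V} : SameBlock {I} x y ↔ x ∈ I ∧ y ∈ I := by
  simp [SameBlock]

theorem OutIso.congr {H K : Dgraph V} {I J : Set V} (h : OutIso G H I J)
    (hK : ∀ x ∉ I, ∀ y, (G.Arc x y ↔ K.Arc x y) ∧ (G.Arc y x ↔ K.Arc y x)) :
    OutIso K H I J := by
  obtain ⟨f, hf, h1, h2⟩ := h
  refine ⟨f, hf, fun x hx y hy => (hK x hx y).1.symm.trans (h1 x hx y hy),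
    fun x hx z hz z' hz' => ?_⟩
  exact ⟨(hK x hx z).1.symm.trans (h2 x hx z hz z' hz').1,
    (hK x hx z).2.symm.trans (h2 x hx z hz z' hz').2⟩

end Rev

section Rigid

variable {G H : Dgraph V}

/-- Neither `L1` nor `L2` holds, in terms of special intervals. -/
structure Rigid (G : Dgraph V) : Prop where
  unique : ∀ I J, Special G I → Special G J → I = J
  outIso : ∀ I, Special G I → OutIso G G.dual I I

theorem Rigid.dual (h : Rigid G) : Rigid G.dual :=
  ⟨fun I J hI hJ => h.unique I J hI.dual hJ.dual, fun I hI => (h.outIso I hI.dual).dual⟩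

theorem Rigid.of_iso (h : Rigid G) (hH : Iso G H) : Rigid H := by
  have hH' := hH.symm
  obtain ⟨e, he⟩ := hH'
  have he' : ∀ x y, G.Arc x y ↔ H.Arc (e.symm x) (e.symm y) := fun x y => by simp [he]
  refine ⟨fun I J hI hJ => ?_, fun I hI => ?_⟩
  · exact e.injective.image_injective (h.unique _ _ (hI.image e he) (hJ.image e he))
  · have h1 := hI.image e he
    have h2 := h.outIso _ h1
    have h3 : OutIso H G I (e '' I) := .of_equiv e he h1.interval rfl
    have h4 : OutIso G.dual H.dual (e '' I) I :=
      .of_equiv e.symm (fun x y => he' y x) hI.interval.dual (by simp)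
    exact (h3.trans h2 h1.nonempty).trans h4 h1.nonempty

theorem Rigid.of_hemi (h : Rigid G) (hH : Hemi G H) : Rigid H :=
  hH.elim h.of_iso h.dual.of_iso

end Rigid

section Forward

variable {G H : Dgraph V} {c : V → V → ℕ}

theorem ArcConnected.exists_dir (hG : G.ArcConnected) {S : Set V} {x z : V} (hx : x ∈ S)
    (hz : z ∉ S) : ∃ u ∈ S, ∃ v, v ∉ S ∧ G.Dir u v := by
  by_contra! hcon
  have : ∀ y, G.ACRel x y → y ∈ S := by
    intro y hy
    induction hy with
    | refl => exact hx
    | tail _ h ih => exact by_contra fun hv => hcon _ ih _ hv h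
  exact hz (this z (hG x z))

theorem Coded.ne_neutral (hc : Coded G H c) {u v : V} (h : G.Dir u v) : c u v / 2 ≠ 0 := by
  have h1 := hc.flip_eq u v
  unfold Dir at h
  rw [hc.fst, hc.fst] at h
  omega

theorem Coded.exists_uniform (hc : Coded G H c) (hG : G.ArcConnected) {i : ℕ} {Z : Set V}
    (hi : i ≠ 0) (hZ : Linked (Col c i) Z) (hne : Z.Nonempty) (hZu : Z ≠ Set.univ)
    (hmax : ∀ z ∉ Z, ∀ u ∈ Z, c z u / 2 ≠ i) :
    ∃ w ∉ Z, (∀ u ∈ Z, c w u / 2 ≠ 0 ∧ c w u / 2 ≠ i) ∧ ∀ u ∈ Z, ∀ v ∈ Z, c w u = c w v := by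
  obtain ⟨x, hx⟩ := hne
  obtain ⟨z, hz⟩ := (Set.ne_univ_iff_exists_notMem Z).1 hZu
  obtain ⟨u, hu, w, hw, huw⟩ := hG.exists_dir hx hz
  have h1 := hc.ne_neutral huw
  have h2 := hc.flip_div u w
  have h3 := hc.gallai.mono hZ (hmax w hw) hu
  have h4 : ∀ u ∈ Z, c w u / 2 ≠ 0 ∧ c w u / 2 ≠ i := fun v hv =>
    ⟨by have := h3 v hv; omega, hmax w hw v hv⟩
  exact ⟨w, hw, h4, fun u hu v hv => hc.uniform_of_linked hi hZ h4 hu hv⟩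

theorem linked_univ_of_reach {α : V → V → Prop} (hsymm : ∀ u v, α u v → α v u) {u : V}
    (h : {v | Reach α Set.univ u v} = Set.univ) : Linked α Set.univ :=
  linked_of_reach hsymm (u := u) fun v _ => Set.eq_univ_iff_forall.1 h v

theorem Good.ne_of_not_reach (hc : Good c) {i : ℕ} {x z u : V}
    (hz : ¬ Reach (Col c i) Set.univ x z) (hu : Reach (Col c i) Set.univ x u) :
    c z u / 2 ≠ i := fun h =>
  hz (hu.trans (Reach.step trivial trivial (hc.col_symm i z u h)))

theorem Coded.linked_or (hc : Coded G H c) (hG : G.ArcConnected) :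
    Linked (Col c 1) Set.univ ∨ Linked (Col c 2) Set.univ := by
  by_contra! hcon
  rcases isEmpty_or_nonempty V with hV | ⟨⟨x⟩⟩
  · exact hcon.1 fun S _ ⟨x, _⟩ _ => (hV.false x).elim
  have hB := linked_reach (X := Set.univ) (hc.col_symm 2) x
  obtain ⟨w, hw, hwB, -⟩ := hc.exists_uniform hG two_ne_zero hB ⟨x, .refl⟩
    (fun h => hcon.2 (linked_univ_of_reach (hc.col_symm 2) h))
    (fun z hz u hu => hc.ne_of_not_reach hz hu)
  have hBR : ∀ u, Reach (Col c 2) Set.univ x u → Reach (Col c 1) Set.univ w u := by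
    intro u hu
    refine Reach.step trivial trivial ?_
    have h1 := hwB u hu
    have h2 := hc.lt w u
    change c w u / 2 = 1
    omega
  have hR := linked_reach (X := Set.univ) (hc.col_symm 1) w
  obtain ⟨t, ht, htR, -⟩ := hc.exists_uniform hG one_ne_zero hR ⟨w, .refl⟩
    (fun h => hcon.1 (linked_univ_of_reach (hc.col_symm 1) h))
    (fun z hz u hu => hc.ne_of_not_reach hz hu)
  have h1 := htR x (hBR x .refl)
  have h2 := hc.lt t x
  have h3 := hc.flip_div x t
  refine ht (hBR t (Reach.step trivial trivial ?_))
  change c x t / 2 = 2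
  omega

theorem Coded.isoOn_of_linked (hc : Coded G H c) (hR : Linked (Col c 1) Set.univ)
    (hB : Linked (Col c 2) Set.univ) {X : Set V} (hX : X.Finite) : IsoOn G H X X :=
  have ht : ∀ u ∈ X, ∀ v ∈ X, u ≠ v → c u v / 2 ≠ 0 := fun _ _ _ _ h => hc.no_neutral hR hB h
  have hcyc := fun x (_ : x ∈ X) y (_ : y ∈ X) z (_ : z ∈ X) =>
    hc.no_cycle (x := x) (y := y) (z := z) hR hB
  ChainOn.isoOn hX hX rfl (hc.chainOn_fst ht hcyc) (hc.chainOn_snd ht hcyc)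

/-- A class which is not a tournament containing a 3-cycle. -/
theorem BlueOver.isoOn (hc : Coded G H c) {w : V} {C : Set V} (h : BlueOver c w C)
    (hC : ¬ ((∀ u ∈ C, ∀ v ∈ C, u ≠ v → c u v / 2 ≠ 0) ∧
      ∃ x ∈ C, ∃ y ∈ C, ∃ z ∈ C, G.Arc x y ∧ G.Arc y z ∧ G.Arc z x))
    {Y : Set V} (hY : Y.Finite) (hYC : Y ⊆ C) : IsoOn G H Y Y := by
  by_cases ht : ∀ u ∈ C, ∀ v ∈ C, u ≠ v → c u v / 2 ≠ 0
  · exact (BlueOver.exists_cycle_or_isoOn hc ht).elim (fun h' => (hC ⟨ht, h'⟩).elim)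
      fun h' => h' Y hY hYC
  · push Not at ht
    obtain ⟨a, ha, b, hb, hab, hN⟩ := ht
    by_cases h0 : Linked (Col c 0) C
    · exact h.isoOn_linked hc h0 hY hYC
    · exact h.isoOn_consec hc (h.consec hc.toGood h0) ha hb hab hN hY hYC

end Forward


section BlueClasses

variable {G H : Dgraph V} {c : V → V → ℕ}

/-- The class of `x` for blue reachability. -/
def blueClass (c : V → V → ℕ) (x : V) : Set V := {v | Reach (Col c 2) Set.univ x v}

theorem Coded.exists_blueOver (hc : Coded G H c) (hG : G.ArcConnected)
    (hB : ¬ Linked (Col c 2) Set.univ) (x : V) : ∃ w, BlueOver c w (blueClass c x) := by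
  have hB' := linked_reach (X := Set.univ) (hc.col_symm 2) x
  obtain ⟨w, hw, hwB, hw'⟩ := hc.exists_uniform hG two_ne_zero hB' ⟨x, .refl⟩
    (fun h => hB (linked_univ_of_reach (hc.col_symm 2) h))
    (fun z hz u hu => hc.ne_of_not_reach hz hu)
  refine ⟨w, hB', fun u hu => ?_, hw'⟩
  have h1 := hwB u hu
  have h2 := hc.lt w u
  omega

theorem Coded.const_on_blueClass (hc : Coded G H c) (hG : G.ArcConnected)
    (hB : ¬ Linked (Col c 2) Set.univ) {x y z : V} (hx : ¬ Reach (Col c 2) Set.univ x y)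
    (hyz : Reach (Col c 2) Set.univ y z) : c x y = c x z := by
  obtain ⟨w, hw⟩ := hc.exists_blueOver hG hB y
  have hr := @Reach.equivalence _ (Col c 2) Set.univ (hc.col_symm 2)
  have hmax : ∀ u ∈ blueClass c y, c x u / 2 ≠ 2 := fun u hu =>
    hc.ne_of_not_reach (fun h => hx (hr.symm h)) hu
  have hy : y ∈ blueClass c y := .refl
  have hmono := hc.gallai.mono hw.linked hmax hy
  have hlt := hc.lt x y
  by_cases h0 : c x y / 2 = 0
  · refine hw.linked.induction (P := fun u => c x y = c x u) hy rfl
      (fun u hu v hv hu' huv => hu'.trans ?_) z hyz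
    exact hc.neutral_eq huv (hw.red u hu) (hw.red v hv) ((hmono u hu).trans h0)
      ((hmono v hv).trans h0)
  · exact hc.uniform_of_linked two_ne_zero hw.linked
      (fun u hu => ⟨by have := hmono u hu; omega, hmax u hu⟩) hy hyz

theorem Coded.eq_of_blueClass (hc : Coded G H c) (hG : G.ArcConnected)
    (hB : ¬ Linked (Col c 2) Set.univ) {x y x' y' : V} (hxy : ¬ Reach (Col c 2) Set.univ x y)
    (hx : Reach (Col c 2) Set.univ x x') (hy : Reach (Col c 2) Set.univ y y') :
    c x y = c x' y' := by
  have hr := @Reach.equivalence _ (Col c 2) Set.univ (hc.col_symm 2)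
  have h1 := hc.const_on_blueClass hG hB hxy hy
  have h2 := hc.const_on_blueClass hG hB (x := y')
    (fun h => hxy (hr.trans (hr.symm h) (hr.symm hy)) |>.elim) hx
  have h3 := hc.flip_eq x y'
  have h4 := hc.flip_eq x' y'
  omega

/-- Digraphs agreeing with `H` between blue classes agree with `G` there. -/
theorem Coded.arc_iff (hc : Coded G H c) (hG : G.ArcConnected)
    (hB : ¬ Linked (Col c 2) Set.univ) {x y x' y' : V} (hxy : ¬ Reach (Col c 2) Set.univ x y)
    (hx : Reach (Col c 2) Set.univ x x') (hy : Reach (Col c 2) Set.univ y y') :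
    (G.Arc x y ↔ H.Arc x' y') ∧ (H.Arc x y ↔ H.Arc x' y') := by
  have hr := @Reach.equivalence _ (Col c 2) Set.univ (hc.col_symm 2)
  have h1 := hc.eq_of_blueClass hG hB hxy hx hy
  have h2 : c x y / 2 ≠ 2 := hc.ne_of_not_reach (x := y) (u := y) (fun h => hxy (hr.symm h)) .refl
  have h3 := hc.lt x y
  rw [hc.fst, hc.snd, hc.snd, ← h1]
  omega

/-- The blue classes inducing tournaments with a 3-cycle. -/
def cyclicClasses (G : Dgraph V) (c : V → V → ℕ) : Set (Set V) :=
  {C | (∃ x, C = blueClass c x) ∧ (∀ u ∈ C, ∀ v ∈ C, u ≠ v → c u v / 2 ≠ 0) ∧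
    ∃ x ∈ C, ∃ y ∈ C, ∃ z ∈ C, G.Arc x y ∧ G.Arc y z ∧ G.Arc z x}

theorem Coded.sameBlock_iff (hc : Coded G H c) {x y : V} : SameBlock (cyclicClasses G c) x y ↔
    Reach (Col c 2) Set.univ x y ∧ blueClass c x ∈ cyclicClasses G c := by
  have hr := @Reach.equivalence _ (Col c 2) Set.univ (hc.col_symm 2)
  constructor
  · rintro ⟨I, hI, hx, hy⟩
    obtain ⟨a, rfl⟩ := hI.1
    refine ⟨hr.trans (hr.symm hx) hy, ?_⟩
    convert hI using 1
    exact Set.ext fun v => ⟨fun h => hr.trans hx h, fun h => hr.trans (hr.symm hx) h⟩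
  · exact fun h => ⟨_, h.2, .refl, h.1⟩

theorem Coded.isoOn_rev (hc : Coded G H c) (hG : G.ArcConnected)
    (hB : ¬ Linked (Col c 2) Set.univ) {X : Set V} (hX : X.Finite) :
    IsoOn G (rev (cyclicClasses G c) H) X X := by
  have hr := @Reach.equivalence _ (Col c 2) Set.univ (hc.col_symm 2)
  refine IsoOn.glue _ hr (fun x hx => ?_) fun x _ y _ x' _ y' _ hxy hx hy => ?_
  · obtain ⟨w, hw⟩ := hc.exists_blueOver hG hB x
    have hfin := hX.inter_of_left {y | Reach (Col c 2) Set.univ x y}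
    have hsub : X ∩ {y | Reach (Col c 2) Set.univ x y} ⊆ blueClass c x := fun y hy => hy.2
    have hrel : ∀ u ∈ X ∩ {y | Reach (Col c 2) Set.univ x y},
        ∀ v ∈ X ∩ {y | Reach (Col c 2) Set.univ x y}, Reach (Col c 2) Set.univ u v :=
      fun u hu v hv => hr.trans (hr.symm hu.2) hv.2
    by_cases hC : blueClass c x ∈ cyclicClasses G c
    · refine (hw.isoOn_dual hc hC.2.1 hfin hsub).trans (.of_eq fun u hu v hv => ?_)
      exact (rev_arc_of_sameBlock ⟨_, hC, hsub hu, hsub hv⟩).symm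
    · refine (hw.isoOn hc (fun h => hC ⟨⟨x, rfl⟩, h⟩) hfin hsub).trans (.of_eq fun u hu v hv => ?_)
      refine (rev_arc_of_not_sameBlock fun h => hC ?_).symm
      have h1 : SameBlock (cyclicClasses G c) x v := by
        obtain ⟨I, hI, h1, h2⟩ := h
        obtain ⟨a, rfl⟩ := hI.1
        exact ⟨_, hI, hr.trans h1 (hr.symm hu.2), h2⟩
      exact (hc.sameBlock_iff.1 h1).2
  · have hxy' : ¬ SameBlock (cyclicClasses G c) x' y' := fun h =>
      hxy (hr.trans hx (hr.trans (hc.sameBlock_iff.1 h).1 (hr.symm hy)))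
    rw [rev_arc_of_not_sameBlock hxy']
    exact (hc.arc_iff hG hB hxy hx hy).1

theorem Coded.isInterval (hc : Coded G H c) (hG : G.ArcConnected)
    (hB : ¬ Linked (Col c 2) Set.univ) (a : V) :
    (rev (cyclicClasses G c) H).IsInterval (blueClass c a) := by
  have hr := @Reach.equivalence _ (Col c 2) Set.univ (hc.col_symm 2)
  rw [isInterval_iff]
  intro x hx y hy z hz
  have h1 : ∀ {u}, u ∈ blueClass c a → ¬ Reach (Col c 2) Set.univ x u := fun hu h =>
    hx (hr.trans hu (hr.symm h))
  have h2 : ∀ {u}, u ∈ blueClass c a → ¬ SameBlock (cyclicClasses G c) x u := fun hu h =>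
    h1 hu (hc.sameBlock_iff.1 h).1
  have hyz := hr.trans (hr.symm hy) hz
  rw [rev_arc_of_not_sameBlock (h2 hy), rev_arc_of_not_sameBlock (h2 hz),
    rev_arc_of_not_sameBlock fun h => h2 hy h.symm,
    rev_arc_of_not_sameBlock fun h => h2 hz h.symm]
  exact ⟨(hc.arc_iff hG hB (h1 hy) .refl hyz).2,
    (hc.arc_iff hG hB (fun h => h1 hy (hr.symm h)) hyz .refl).2⟩

theorem Coded.dftOn_rev (hc : Coded G H c) (hG : G.ArcConnected)
    (hB : ¬ Linked (Col c 2) Set.univ) {C : Set V} (hC : C ∈ cyclicClasses G c) :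
    DFTOn (rev (cyclicClasses G c) H) C := by
  obtain ⟨⟨a, rfl⟩, ht, -⟩ := hC
  obtain ⟨w, hw⟩ := hc.exists_blueOver hG hB a
  exact .of_finite fun Y hY hYC =>
    ((hw.dftOn hc ht).mono hYC).of_isoOn (hc.isoOn_rev hG hB hY)

theorem Coded.blueClass_ne_univ (hc : Coded G H c) 
    (hB : ¬ Linked (Col c 2) Set.univ) (a : V) : blueClass c a ≠ Set.univ :=
  fun h => hB (linked_univ_of_reach (hc.col_symm 2) h)

theorem Coded.hemi_of_not_linked (hc : Coded G H c) (hG : G.ArcConnected) (h7 : G.HalfRecon 7)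
    (hrig : Rigid G) (hB : ¬ Linked (Col c 2) Set.univ) : Hemi G H := by
  have hr := @Reach.equivalence _ (Col c 2) Set.univ (hc.col_symm 2)
  have hK := h7 _ (LeHemi.of_isoOn 7 fun X hX => hc.isoOn_rev hG hB hX)
  refine hK.trans ?_
  have hrig' := hrig.of_hemi hK
  have hblock : ∀ {C u v}, C ∈ cyclicClasses G c → u ∈ C → v ∈ C →
      ((rev (cyclicClasses G c) H).dual.Arc u v ↔ H.Arc u v) := fun hC hu hv =>
    rev_arc_of_sameBlock ⟨_, hC, hv, hu⟩
  have hcls : ∀ {C a}, C ∈ cyclicClasses G c → a ∈ C → blueClass c a = C := by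
    intro C a hC ha
    obtain ⟨⟨b, rfl⟩, -⟩ := hC
    exact Set.ext fun v => ⟨fun h => hr.trans ha h, fun h => hr.trans (hr.symm ha) h⟩
  have hnot : ∀ {a u v}, blueClass c a ∉ cyclicClasses G c → u ∈ blueClass c a →
      ¬ SameBlock (cyclicClasses G c) u v := by
    rintro a u v ha hu ⟨I, hI, h1, h2⟩
    rw [← hcls hI h1] at hI
    refine ha ?_
    convert hI using 1
    exact Set.ext fun v => ⟨fun h => hr.trans (hr.symm hu) h, fun h => hr.trans hu h⟩
  have hout : ∀ {x y x' y'}, ¬ Reach (Col c 2) Set.univ x y → Reach (Col c 2) Set.univ x x' →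
      Reach (Col c 2) Set.univ y y' →
      ((rev (cyclicClasses G c) H).Arc x y ↔ H.Arc x' y') := by
    intro x y x' y' hxy hx hy
    rw [rev_arc_of_not_sameBlock fun h => hxy (hc.sameBlock_iff.1 h).1]
    exact (hc.arc_iff hG hB hxy hx hy).2
  set 𝓛 := cyclicClasses G c with h𝓛
  by_cases hall : ∀ C ∈ 𝓛, IsoOn (rev 𝓛 H) (rev 𝓛 H).dual C C
  · refine .inl (isoOn_univ_iff.1 (IsoOn.glue _ hr (fun x _ => ?_)
      fun x _ y _ x' _ y' _ hxy hx hy => hout hxy hx hy))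
    rw [Set.univ_inter]
    change IsoOn _ _ (blueClass c x) (blueClass c x)
    by_cases hC : blueClass c x ∈ 𝓛
    · exact (hall _ hC).trans (.of_eq fun u hu v hv => hblock hC hu hv)
    · exact .of_eq fun u hu v hv => rev_arc_of_not_sameBlock (hnot hC hu)
  · push Not at hall
    obtain ⟨I, hI, hId⟩ := hall
    have hspec : ∀ C ∈ 𝓛, ¬ IsoOn (rev 𝓛 H) (rev 𝓛 H).dual C C → Special (rev 𝓛 H) C := by
      intro C hC hCd
      refine ⟨?_, hc.dftOn_rev hG hB hC, hCd, ?_⟩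
      · obtain ⟨a, rfl⟩ := hC.1
        exact hc.isInterval hG hB a
      · obtain ⟨a, rfl⟩ := hC.1
        exact hc.blueClass_ne_univ hB a
    have hIs := hspec I hI hId
    have hall : ∀ C ∈ 𝓛, C ≠ I → IsoOn (rev 𝓛 H) (rev 𝓛 H).dual C C := fun C hC hCI =>
      by_contra fun h => hCI (hrig'.unique _ _ (hspec C hC h) hIs)
    have hK1 : Iso (rev {I} (rev 𝓛 H)) (rev 𝓛 H).dual := by
      refine OutIso.iso (I := I) (J := I) ((hrig'.outIso I hIs).congr fun x hx y => ?_)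
        (.of_eq fun u hu v hv => rev_arc_of_sameBlock (sameBlock_singleton.2 ⟨hu, hv⟩))
      rw [rev_arc_of_not_sameBlock fun h => hx (sameBlock_singleton.1 h).1,
        rev_arc_of_not_sameBlock fun h => hx (sameBlock_singleton.1 h).2]
      exact ⟨Iff.rfl, Iff.rfl⟩
    have hK2 : Iso (rev {I} (rev 𝓛 H)) H := by
      refine isoOn_univ_iff.1 (IsoOn.glue _ hr (fun x _ => ?_)
        fun x _ y _ x' _ y' _ hxy hx hy => ?_)
      · rw [Set.univ_inter]
        change IsoOn _ _ (blueClass c x) (blueClass c x)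
        by_cases hxI : x ∈ I
        · rw [hcls hI hxI]
          exact .of_eq fun u hu v hv =>
            (rev_arc_of_sameBlock (sameBlock_singleton.2 ⟨hu, hv⟩)).trans (hblock hI hu hv)
        · have hsame : ∀ u ∈ blueClass c x, u ∉ I := fun u hu huI => hxI <| by
            rw [← hcls hI huI]
            exact hr.symm hu
          have h1 : IsoOn (rev {I} (rev 𝓛 H)) (rev 𝓛 H) (blueClass c x) (blueClass c x) :=
            .of_eq fun u hu v hv =>
              rev_arc_of_not_sameBlock fun h => hsame u hu (sameBlock_singleton.1 h).1
          by_cases hC : blueClass c x ∈ 𝓛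
          · refine h1.trans ((hall _ hC ?_).trans (.of_eq fun u hu v hv => hblock hC hu hv))
            exact fun h => hxI (h ▸ (.refl : x ∈ blueClass c x))
          · exact h1.trans (.of_eq fun u hu v hv => rev_arc_of_not_sameBlock (hnot hC hu))
      · rw [← hout hxy hx hy]
        refine rev_arc_of_not_sameBlock fun h => hxy ?_
        have h' := sameBlock_singleton.1 h
        have h2 : y ∈ blueClass c x := hcls hI h'.1 ▸ h'.2
        exact h2
    exact Hemi.of_dual (.inl (hK1.symm.trans hK2))

end BlueClasses

theorem halfRecon_of_rigid {G : Dgraph V} (hG : G.ArcConnected) (h7 : G.HalfRecon 7)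
    (hrig : Rigid G) : G.HalfRecon 6 := by
  intro H hH
  have hc := hH.coded
  rcases hc.linked_or hG with hR | hB
  · by_cases hB : Linked (Col (code G H) 2) Set.univ
    · exact h7 H (LeHemi.of_isoOn 7 fun X hX => hc.isoOn_of_linked hR hB hX)
    · exact hc.hemi_of_not_linked hG h7 hrig hB
  · by_cases hR : Linked (Col (code G H) 1) Set.univ
    · exact h7 H (LeHemi.of_isoOn 7 fun X hX => hc.isoOn_of_linked hR hB hX)
    · have := hc.swap.hemi_of_not_linked hG h7 hrig (by rwa [hc.col_swap_two])
      exact this.dual_right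


section Block

variable {G K : Dgraph V} {I J : Set V}

/-- An interval inducing a diamond-free tournament with a 3-cycle. -/
structure Block (G : Dgraph V) (I : Set V) : Prop where
  interval : G.IsInterval I
  dft : DFTOn G I
  cycle : ∃ x ∈ I, ∃ y ∈ I, ∃ z ∈ I, G.Arc x y ∧ G.Arc y z ∧ G.Arc z x

theorem Block.dual (h : Block G I) : Block G.dual I := by
  obtain ⟨x, hx, y, hy, z, hz, h1, h2, h3⟩ := h.cycle
  exact ⟨h.interval.dual, h.dft.dual, x, hx, z, hz, y, hy, h3, h2, h1⟩

theorem Block.of_isoOn (h : Block G I) (hJ : K.IsInterval J) (hI : IsoOn G K I J) : Block K J := by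
  have hd := h.dft.of_isoOn hI
  obtain ⟨f, hf, hfK⟩ := hI
  obtain ⟨x, hx, y, hy, z, hz, h1, h2, h3⟩ := h.cycle
  exact ⟨hJ, hd, f x, hf.mapsTo hx, f y, hf.mapsTo hy, f z, hf.mapsTo hz,
    (hfK x hx y hy).1 h1, (hfK y hy z hz).1 h2, (hfK z hz x hx).1 h3⟩

theorem Block.image (e : V ≃ V) (he : ∀ x y, G.Arc x y ↔ K.Arc (e x) (e y))
    (h : Block G I) : Block K (e '' I) :=
  h.of_isoOn (h.interval.image e he) (isoOn_image e he)

theorem Block.no_split (h : Block G I) {S : Set V} (hS : S ⊆ I) (hne : S.Nonempty) {b : V}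
    (hb : b ∈ I) (hbS : b ∉ S) (hsplit : ∀ s ∈ S, ∀ t ∈ I, t ∉ S → G.Arc s t) : False := by
  obtain ⟨a, ha⟩ := hne
  obtain ⟨x, hx, y, hy, z, hz, h1, h2, h3⟩ := h.cycle
  have as : ∀ {u v}, u ∈ I → v ∈ I → G.Arc u v → ¬ G.Arc v u := fun {u v} hu hv huv hvu => by
    rcases h.dft.1 u hu v hv (fun h => G.irrefl v (h ▸ huv)) with h' | h'
    · exact h'.2 hvu
    · exact h'.2 huv
  have step : ∀ {u v}, u ∈ I → v ∈ I → G.Arc u v → v ∈ S → u ∈ S := fun {u v} hu hv huv hvS =>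
    by_contra fun huS => as hu hv huv (hsplit v hvS u hu huS)
  by_cases hxS : x ∈ S
  · have hzS := step hz hx h3 hxS
    have hyS := step hy hz h2 hzS
    exact (h.dft.2 x hx y hy z hz b hb h1 h2 h3).2
      ⟨hsplit x hxS b hb hbS, hsplit y hyS b hb hbS, hsplit z hzS b hb hbS⟩
  · have hyS : y ∉ S := fun h => hxS (step hx hy h1 h)
    have hzS : z ∉ S := fun h => hyS (step hy hz h2 h)
    exact (h.dft.2 x hx y hy z hz a (hS ha) h1 h2 h3).1
      ⟨hsplit a ha x hx hxS, hsplit a ha y hy hyS, hsplit a ha z hz hzS⟩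

theorem Block.subset_of_subset (hI : Block G I) (hJ : Block G J) (h : I ⊆ J) : J ⊆ I := by
  intro t ht
  by_contra htI
  obtain ⟨x, hx, y, hy, z, hz, h1, h2, h3⟩ := hI.cycle
  have key := hJ.dft.2 x (h hx) y (h hy) z (h hz) t ht h1 h2 h3
  rcases hI.interval t htI with h' | h' | h' | h'
  · exact key.1 ⟨(h' x hx).1, (h' y hy).1, (h' z hz).1⟩
  · exact key.2 ⟨(h' x hx).1, (h' y hy).1, (h' z hz).1⟩
  · exact key.1 ⟨(h' x hx).1, (h' y hy).1, (h' z hz).1⟩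
  · have := hJ.dft.1 t ht x (h hx) fun h => htI (h ▸ hx)
    have h'' := h' x hx
    unfold Dir at this
    tauto

theorem Block.no_overlap (hI : Block G I) (hJ : Block G J) {a b m : V} (ha : a ∈ I) (haJ : a ∉ J)
    (hb : b ∈ J) (hbI : b ∉ I) (hm : m ∈ I) (hmJ : m ∈ J) (ham : G.Arc a m) : False := by
  have h1 := isInterval_iff.1 hI.interval
  have h2 := isInterval_iff.1 hJ.interval
  have hab : G.Arc a b := (h2 a haJ m hmJ b hb).1.1 ham
  refine hI.no_split (S := I \ J) (fun x hx => hx.1) ⟨a, ha, haJ⟩ hm (fun h => h.2 hmJ) ?_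
  intro s hs t ht htS
  have htJ : t ∈ J := by_contra fun h => htS ⟨ht, h⟩
  exact (h2 s hs.2 b hb t htJ).1.1 ((h1 b hbI a ha s hs.1).2.1 hab)

theorem Block.eq_of_mem (hI : Block G I) (hJ : Block G J) {m : V} (hm : m ∈ I) (hmJ : m ∈ J) :
    I = J := by
  by_cases h1 : I ⊆ J
  · exact h1.antisymm (hI.subset_of_subset hJ h1)
  by_cases h2 : J ⊆ I
  · exact (hJ.subset_of_subset hI h2).antisymm h2
  obtain ⟨a, ha, haJ⟩ := Set.not_subset.1 h1
  obtain ⟨b, hb, hbI⟩ := Set.not_subset.1 h2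
  rcases hI.dft.1 a ha m hm (fun h => haJ (h ▸ hmJ)) with h | h
  · exact (hI.no_overlap hJ ha haJ hb hbI hm hmJ h.1).elim
  · exact (hI.dual.no_overlap hJ.dual ha haJ hb hbI hm hmJ h.1).elim

variable {𝓕 : Set (Set V)}

theorem sameBlock_iff_of_mem (h𝓕 : ∀ I ∈ 𝓕, Block G I) (hJ : Block G J) {x y : V} (hx : x ∈ J) :
    SameBlock 𝓕 x y ↔ J ∈ 𝓕 ∧ y ∈ J := by
  constructor
  · rintro ⟨I, hI, hxI, hyI⟩
    obtain rfl := (h𝓕 I hI).eq_of_mem hJ hxI hx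
    exact ⟨hI, hyI⟩
  · exact fun h => ⟨J, h.1, hx, h.2⟩

theorem isoOn_rev_of_notMem (h𝓕 : ∀ I ∈ 𝓕, Block G I) (hJ : Block G J) (h : J ∉ 𝓕) :
    IsoOn G (rev 𝓕 G) J J :=
  .of_eq fun _ hx _ _ => (rev_arc_of_not_sameBlock fun h' =>
    h ((sameBlock_iff_of_mem h𝓕 hJ hx).1 h').1).symm

theorem isoOn_rev_of_mem (h : J ∈ 𝓕) : IsoOn G.dual (rev 𝓕 G) J J :=
  .of_eq fun _ hx _ hy => (rev_arc_of_sameBlock ⟨J, h, hx, hy⟩).symm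

theorem Block.reversed (hJ : Block G J) (h𝓕 : ∀ I ∈ 𝓕, Block G I) : Block (rev 𝓕 G) J := by
  have hinterval : (Dgraph.rev 𝓕 G).IsInterval J := by
    have hinterval := isInterval_iff.1 hJ.interval
    rw [isInterval_iff]
    intro x hx y hy z hz
    have h1 : ∀ {u}, u ∈ J → ¬ SameBlock 𝓕 u x := fun hu h =>
      hx ((sameBlock_iff_of_mem h𝓕 hJ hu).1 h).2
    rw [rev_arc_of_not_sameBlock (h1 hy), rev_arc_of_not_sameBlock (h1 hz),
      rev_arc_of_not_sameBlock fun h => h1 hy h.symm,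
      rev_arc_of_not_sameBlock fun h => h1 hz h.symm]
    exact hinterval x hx y hy z hz
  by_cases h : J ∈ 𝓕
  · exact hJ.dual.of_isoOn hinterval (isoOn_rev_of_mem h)
  · exact hJ.of_isoOn hinterval (isoOn_rev_of_notMem h𝓕 hJ h)

theorem rev_rev : rev 𝓕 (rev 𝓕 G) = G := by
  have : ∀ x y, (rev 𝓕 (rev 𝓕 G)).Arc x y ↔ G.Arc x y := by
    intro x y
    by_cases h : SameBlock 𝓕 x y
    · rw [rev_arc_of_sameBlock h, rev_arc_of_sameBlock h.symm]
    · rw [rev_arc_of_not_sameBlock h, rev_arc_of_not_sameBlock h]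
  cases G
  simp only [rev, Dgraph.mk.injEq] at this ⊢
  funext x y
  exact propext (this x y)

theorem Block.of_rev (h𝓕 : ∀ I ∈ 𝓕, Block G I) (hJ : Block (Dgraph.rev 𝓕 G) J) : Block G J := by
  have := hJ.reversed fun I hI => (h𝓕 I hI).reversed h𝓕
  rwa [rev_rev] at this

theorem leHemi_rev (h𝓕 : ∀ I ∈ 𝓕, Block G I) : LeHemi 6 G (rev 𝓕 G) := by
  intro j _ hj X hX hXj
  by_cases hsub : ∃ I ∈ 𝓕, X ⊆ I
  · obtain ⟨I, hI, hXI⟩ := hsub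
    refine Or.inr (isoOn_iff_iso.1 (IsoOn.of_eq (G := G.dual) fun x hx y hy => ?_))
    exact (rev_arc_of_sameBlock ⟨I, hI, hXI hx, hXI hy⟩).symm
  · push Not at hsub
    refine .inl (isoOn_iff_iso.1 ?_)
    have hr : Equivalence fun x y => x = y ∨ SameBlock 𝓕 x y := by
      refine ⟨fun x => .inl rfl, fun h => h.imp Eq.symm SameBlock.symm, ?_⟩
      rintro x y z (rfl | h) (rfl | h')
      · exact .inl rfl
      · exact .inr h'
      · exact .inr h
      · obtain ⟨I, hI, hx, hy⟩ := h
        exact .inr ⟨I, hI, hx, ((sameBlock_iff_of_mem h𝓕 (h𝓕 I hI) hy).1 h').2⟩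
    refine IsoOn.glue _ hr (fun x hx => ?_) fun x _ y _ x' _ y' _ hxy hx hy => ?_
    · by_cases hxI : ∃ I ∈ 𝓕, x ∈ I
      · obtain ⟨I, hI, hxI⟩ := hxI
        have hset : X ∩ {y | x = y ∨ SameBlock 𝓕 x y} ⊆ I := by
          rintro y ⟨_, rfl | hy⟩
          · exact hxI
          · exact ((sameBlock_iff_of_mem h𝓕 (h𝓕 I hI) hxI).1 hy).2
        have hlt : (X ∩ {y | x = y ∨ SameBlock 𝓕 x y}).ncard < X.ncard := by
          refine Set.ncard_lt_ncard (Set.inter_subset_left.ssubset_of_ne fun h => ?_) hX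
          exact hsub I hI (h ▸ hset)
        refine (((h𝓕 I hI).dft.mono hset).isoOn_dual (hX.inter_of_left _) (by omega)).trans
          (.of_eq fun u hu v hv => ?_)
        exact (rev_arc_of_sameBlock ⟨I, hI, hset hu, hset hv⟩).symm
      · push Not at hxI
        have hset : ∀ y ∈ X ∩ {y | x = y ∨ SameBlock 𝓕 x y}, y = x := by
          rintro y ⟨_, rfl | ⟨I, hI, h, _⟩⟩
          · rfl
          · exact (hxI I hI h).elim
        refine .of_eq fun u hu v hv => ?_
        rw [hset u hu, hset v hv]
        exact iff_of_false (G.irrefl x) ((rev 𝓕 G).irrefl x)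
    · rw [rev_arc_of_not_sameBlock fun h => hxy (hr.trans hx (hr.trans (.inr h) (hr.symm hy)))]
      have h1 : G.Arc x y ↔ G.Arc x' y := by
        rcases hx with rfl | ⟨I, hI, h1, h2⟩
        · rfl
        · exact (isInterval_iff.1 (h𝓕 I hI).interval y
            (fun h => hxy (.inr ⟨I, hI, h1, h⟩)) x h1 x' h2).2
      have h2 : G.Arc x' y ↔ G.Arc x' y' := by
        rcases hy with rfl | ⟨I, hI, h1, h2⟩
        · rfl
        · refine (isInterval_iff.1 (h𝓕 I hI).interval x' (fun h => ?_) y h1 y' h2).1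
          exact hxy (hr.trans hx (.inr ⟨I, hI, h, h1⟩))
      exact h1.trans h2

end Block


section Twin

variable {G K : Dgraph V} {I J : Set V}

theorem IsInterval.union (hI : G.IsInterval I) (hJ : G.IsInterval J) {m : V} (hm : m ∈ I)
    (hmJ : m ∈ J) : G.IsInterval (I ∪ J) := by
  rw [isInterval_iff] at *
  intro x hx
  have h : ∀ y ∈ I ∪ J, (G.Arc x y ↔ G.Arc x m) ∧ (G.Arc y x ↔ G.Arc m x) := by
    rintro y (hy | hy)
    · exact hI x (fun h => hx (.inl h)) y hy m hm
    · exact hJ x (fun h => hx (.inr h)) y hy m hmJ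
  intro y hy z hz
  exact ⟨(h y hy).1.trans (h z hz).1.symm, (h y hy).2.trans (h z hz).2.symm⟩

theorem IsInterval.no_cycle_of_notMem (hI : G.IsInterval I) {x y z : V} (hz : z ∉ I) (hx : x ∈ I)
    (hy : y ∈ I) (hd : G.Dir y z) (hyz : G.Arc y z) (hzx : G.Arc z x) : False := by
  have h := (isInterval_iff.1 hI z hz x hx y hy).1
  unfold Dir at hd
  tauto

theorem IsInterval.chainOn_union (hI : G.IsInterval I) (hJ : G.IsInterval J) (hIc : ChainOn G I)
    (hJc : ChainOn G J) {m : V} (hm : m ∈ I) (hmJ : m ∈ J) : ChainOn G (I ∪ J) := by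
  have hdir : ∀ x ∈ I ∪ J, ∀ y ∈ I ∪ J, x ≠ y → G.Dir x y := by
    have h1 := isInterval_iff.1 hJ
    have key : ∀ x ∈ I, ∀ y ∈ J, x ≠ y → G.Dir x y := by
      intro x hx y hy hxy
      by_cases hxJ : x ∈ J
      · exact hJc.1 x hxJ y hy hxy
      · have h2 := hIc.1 x hx m hm fun h => hxJ (h ▸ hmJ)
        have h3 := h1 x hxJ y hy m hmJ
        unfold Dir at h2 ⊢
        rwa [h3.1, h3.2]
    rintro x (hx | hx) y (hy | hy) hxy
    · exact hIc.1 x hx y hy hxy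
    · exact key x hx y hy hxy
    · exact (key y hy x hx hxy.symm).symm
    · exact hJc.1 x hx y hy hxy
  refine ⟨hdir, fun x hx y hy z hz hxy hyz hzx => ?_⟩
  have ne : ∀ {u v}, G.Arc u v → u ≠ v := fun {u v} h huv => G.irrefl v (huv ▸ h)
  have dxy := hdir x hx y hy (ne hxy)
  have dyz := hdir y hy z hz (ne hyz)
  have dzx := hdir z hz x hx (ne hzx)
  have key : ∀ {L : Set V}, G.IsInterval L → ChainOn G L → (x ∈ L → y ∈ L → False) ∧
      (y ∈ L → z ∈ L → False) ∧ (z ∈ L → x ∈ L → False) := by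
    intro L hL hLc
    refine ⟨fun h1 h2 => ?_, fun h1 h2 => ?_, fun h1 h2 => ?_⟩
    · by_cases h3 : z ∈ L
      · exact hLc.2 x h1 y h2 z h3 hxy hyz hzx
      · exact hL.no_cycle_of_notMem h3 h1 h2 dyz hyz hzx
    · by_cases h3 : x ∈ L
      · exact hLc.2 x h3 y h1 z h2 hxy hyz hzx
      · exact hL.no_cycle_of_notMem h3 h1 h2 dzx hzx hxy
    · by_cases h3 : y ∈ L
      · exact hLc.2 x h2 y h3 z h1 hxy hyz hzx
      · exact hL.no_cycle_of_notMem h3 h1 h2 dxy hxy hyz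
  have h1 := key hI hIc
  have h2 := key hJ hJc
  rcases hx with hx | hx <;> rcases hy with hy | hy <;> rcases hz with hz | hz
  · exact h1.1 hx hy
  · exact h1.1 hx hy
  · exact h1.2.2 hz hx
  · exact h2.2.1 hy hz
  · exact h1.2.1 hy hz
  · exact h2.2.2 hz hx
  · exact h2.1 hx hy
  · exact h2.1 hx hy

/-- `x` and `y` lie in a common interval which is a chain. -/
def Twin (G : Dgraph V) (x y : V) : Prop :=
  ∃ A : Set V, G.IsInterval A ∧ ChainOn G A ∧ x ∈ A ∧ y ∈ A

theorem twin_equivalence (G : Dgraph V) : Equivalence (Twin G) where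
  refl x := by
    refine ⟨{x}, isInterval_iff.2 ?_, ⟨?_, ?_⟩, rfl, rfl⟩
    · rintro u _ _ rfl _ rfl
      exact ⟨Iff.rfl, Iff.rfl⟩
    · rintro _ rfl _ rfl h
      exact (h rfl).elim
    · rintro _ rfl _ rfl _ rfl h
      exact (G.irrefl _ h).elim
  symm := fun ⟨A, h1, h2, h3, h4⟩ => ⟨A, h1, h2, h4, h3⟩
  trans := fun ⟨A, h1, h2, h3, h4⟩ ⟨B, h1', h2', h3', h4'⟩ =>
    ⟨A ∪ B, h1.union h1' h4 h3', h1.chainOn_union h1' h2 h2' h4 h3', .inl h3, .inr h4'⟩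

theorem isInterval_twin (x : V) : G.IsInterval {y | Twin G x y} := by
  have hr := twin_equivalence G
  rw [isInterval_iff]
  intro u hu y hy z hz
  obtain ⟨A, h1, h2, h3, h4⟩ := hr.trans (hr.symm hy) hz
  refine isInterval_iff.1 h1 u (fun h => hu ?_) y h3 z h4
  exact hr.trans hy ⟨A, h1, h2, h3, h⟩

theorem chainOn_twin (x : V) : ChainOn G {y | Twin G x y} := by
  have hr := twin_equivalence G
  refine ⟨fun y hy z hz hyz => ?_, fun y hy z hz t ht h1 h2 h3 => ?_⟩
  · obtain ⟨A, _, h2, h3, h4⟩ := hr.trans (hr.symm hy) hz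
    exact h2.1 y h3 z h4 hyz
  · obtain ⟨A, a1, a2, a3, a4⟩ := hr.trans (hr.symm hy) hz
    obtain ⟨B, b1, b2, b3, b4⟩ := hr.trans (hr.symm hz) ht
    exact (a1.chainOn_union b1 a2 b2 a4 b3).2 y (.inl a3) z (.inl a4) t (.inr b4) h1 h2 h3

theorem Twin.map (e : V ≃ V)
    (he : ∀ x y, G.Arc x y ↔ K.Arc (e x) (e y)) {x y : V} (h : Twin G x y) :
    Twin K (e x) (e y) := by
  obtain ⟨A, h1, h2, h3, h4⟩ := h
  refine ⟨e '' A, h1.image e he, ⟨?_, ?_⟩, ⟨x, h3, rfl⟩, ⟨y, h4, rfl⟩⟩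
  · rintro _ ⟨u, hu, rfl⟩ _ ⟨v, hv, rfl⟩ huv
    have := h2.1 u hu v hv fun h => huv (congrArg e h)
    simpa only [Dir, he] using this
  · rintro _ ⟨u, hu, rfl⟩ _ ⟨v, hv, rfl⟩ _ ⟨w, hw, rfl⟩
    simp only [← he]
    exact h2.2 u hu v hv w hw

theorem Twin.dual {x y : V} (h : Twin G x y) : Twin G.dual x y := by
  obtain ⟨A, h1, h2, h3⟩ := h
  exact ⟨A, h1.dual, h2.dual, h3⟩

/-- `K` is obtained from `G` by replacing chains by chains on the twin classes. -/
structure Reordering (G K : Dgraph V) : Prop where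
  arc_iff : ∀ x y, ¬ Twin G x y → (G.Arc x y ↔ K.Arc x y)
  chainOn : ∀ x, ChainOn K {y | Twin G x y}

theorem Reordering.arc_iff_of_twin (h : Reordering G K) {x y z : V} (hxy : ¬ Twin G x y)
    (hyz : Twin G y z) : (K.Arc x y ↔ K.Arc x z) ∧ (K.Arc y x ↔ K.Arc z x) := by
  have hr := twin_equivalence G
  have hxz : ¬ Twin G x z := fun h => hxy (hr.trans h (hr.symm hyz))
  have := isInterval_iff.1 (isInterval_twin (G := G) y) x (fun h => hxy (hr.symm h)) y (hr.refl y)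
    z hyz
  rw [← h.arc_iff _ _ hxy, ← h.arc_iff _ _ hxz, ← h.arc_iff _ _ fun h => hxy (hr.symm h),
    ← h.arc_iff _ _ fun h => hxz (hr.symm h)]
  exact this

theorem Reordering.twin (h : Reordering G K) {x y : V} (hxy : Twin G x y) : Twin K x y := by
  have hr := twin_equivalence G
  refine ⟨{y | Twin G x y}, isInterval_iff.2 ?_, h.chainOn x, hr.refl x, hxy⟩
  intro u hu y hy z hz
  exact h.arc_iff_of_twin (fun h => hu (hr.trans hy (hr.symm h))) (hr.trans (hr.symm hy) hz)

theorem Reordering.twin_iff (h : Reordering G K) {x y : V} : Twin K x y ↔ Twin G x y := by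
  refine ⟨fun hxy => ?_, h.twin⟩
  have hr := twin_equivalence G
  have hK := twin_equivalence K
  have hinterval := isInterval_iff.1 (isInterval_twin (G := K) x)
  have hch := chainOn_twin (G := K) x
  refine ⟨{y | Twin K x y}, isInterval_iff.2 ?_, ⟨?_, ?_⟩, hK.refl x, hxy⟩
  · intro u hu y hy z hz
    have h1 : ∀ {v}, Twin K x v → ¬ Twin G u v := fun hv h' =>
      hu (hK.trans hv (hK.symm (h.twin h')))
    rw [h.arc_iff _ _ (h1 hy), h.arc_iff _ _ (h1 hz), h.arc_iff _ _ fun h' => h1 hy (hr.symm h'),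
      h.arc_iff _ _ fun h' => h1 hz (hr.symm h')]
    exact hinterval u hu y hy z hz
  · intro u hu v hv huv
    by_cases hT : Twin G u v
    · exact (chainOn_twin u).1 u (hr.refl u) v hT huv
    · have := hch.1 u hu v hv huv
      rwa [Dir, ← h.arc_iff _ _ hT, ← h.arc_iff _ _ fun h' => hT (hr.symm h')] at this
  · have key : ∀ {u v w}, Twin K x v → Twin K x w → Twin G u v → G.Arc u v → G.Arc v w →
        G.Arc w u → False := by
      intro u v w hv hw hT huv hvw hwu
      by_cases hTw : Twin G u w
      · exact (chainOn_twin u).2 u (hr.refl u) v hT w hTw huv hvw hwu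
      · have hTvw : ¬ Twin G v w := fun h => hTw (hr.trans hT h)
        refine (isInterval_twin u).no_cycle_of_notMem hTw (hr.refl u) hT ?_ hvw hwu
        have := hch.1 v hv w hw fun h => hTvw (h ▸ hr.refl v)
        rwa [Dir, ← h.arc_iff _ _ hTvw, ← h.arc_iff _ _ fun h' => hTvw (hr.symm h')] at this
    intro u hu v hv w hw huv hvw hwu
    by_cases h1 : Twin G u v
    · exact key hv hw h1 huv hvw hwu
    by_cases h2 : Twin G v w
    · exact key hw hu h2 hvw hwu huv
    by_cases h3 : Twin G w u
    · exact key hu hv h3 hwu huv hvw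
    exact hch.2 u hu v hv w hw ((h.arc_iff _ _ h1).1 huv) ((h.arc_iff _ _ h2).1 hvw)
      ((h.arc_iff _ _ h3).1 hwu)

theorem Reordering.isoOn (h : Reordering G K) {X : Set V} (hX : X.Finite) : IsoOn G K X X := by
  have hr := twin_equivalence G
  refine IsoOn.glue _ hr (fun x hx => ?_) fun x _ y _ x' _ y' _ hxy hx hy => ?_
  · exact ChainOn.isoOn (hX.inter_of_left _) (hX.inter_of_left _) rfl
      ((chainOn_twin x).mono Set.inter_subset_right) ((h.chainOn x).mono Set.inter_subset_right)
  · rw [h.arc_iff x y hxy, (h.arc_iff_of_twin hxy hy).1]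
    exact (h.arc_iff_of_twin (fun h => hxy (hr.symm (hr.trans hy h))) hx).2

end Twin


section InfiniteChain

theorem exists_chainOn_of_equiv {K : Set V} {α : Type*} [LinearOrder α] (e : K ≃ α) :
    ∃ D : Dgraph V, ChainOn D K ∧ ∀ x y : K, D.Arc x y ↔ e x < e y := by
  let D : Dgraph V := ⟨fun x y => ∃ hx hy, e ⟨x, hx⟩ < e ⟨y, hy⟩, fun x ⟨_, _, h⟩ => lt_irrefl _ h⟩
  have hD : ∀ x y : K, D.Arc x y ↔ e x < e y := fun x y =>
    ⟨fun ⟨_, _, h⟩ => h, fun h => ⟨x.2, y.2, h⟩⟩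
  refine ⟨D, ⟨fun x hx y hy hxy => ?_, fun x hx y hy z hz => ?_⟩, hD⟩
  · have h1 := hD ⟨x, hx⟩ ⟨y, hy⟩
    have h2 := hD ⟨y, hy⟩ ⟨x, hx⟩
    have h3 : e ⟨x, hx⟩ ≠ e ⟨y, hy⟩ := fun h => hxy (congrArg Subtype.val (e.injective h))
    simp only at h1 h2
    rw [Dir, h1, h2]
    rcases lt_or_gt_of_ne h3 with h | h
    · exact .inl ⟨h, h.not_gt⟩
    · exact .inr ⟨h, h.not_gt⟩
  · rw [hD ⟨x, hx⟩ ⟨y, hy⟩, hD ⟨y, hy⟩ ⟨z, hz⟩, hD ⟨z, hz⟩ ⟨x, hx⟩]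
    exact fun h1 h2 h3 => lt_irrefl _ (h1.trans (h2.trans h3))

theorem exists_chainOn_noMax {K : Set V} (hK : K.Infinite) :
    ∃ D : Dgraph V, ChainOn D K ∧ ∀ x ∈ K, ∃ y ∈ K, D.Arc x y := by
  have := hK.to_subtype
  let _ : LinearOrder K := IsWellOrder.linearOrder WellOrderingRel
  have h1 : Cardinal.mk (K ×ₗ ℕ) = Cardinal.mk K := by
    change Cardinal.mk (K × ℕ) = _
    simp
  obtain ⟨e⟩ := Cardinal.eq.1 h1.symm
  obtain ⟨D, hD, hDe⟩ := exists_chainOn_of_equiv e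
  refine ⟨D, hD, fun x hx => ?_⟩
  obtain ⟨y, hy⟩ := exists_gt (e ⟨x, hx⟩)
  refine ⟨e.symm y, (e.symm y).2, (hDe ⟨x, hx⟩ _).2 ?_⟩
  simpa using hy

theorem exists_chainOn_bounded {K : Set V} (hK : K.Infinite) :
    ∃ D : Dgraph V, ChainOn D K ∧ (∃ m ∈ K, ∀ x ∈ K, ¬ D.Arc x m) ∧
      ∃ M ∈ K, ∀ x ∈ K, ¬ D.Arc M x := by
  have := hK.to_subtype
  let _ : LinearOrder K := IsWellOrder.linearOrder WellOrderingRel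
  have h1 : Cardinal.mk (WithBot (WithTop K)) = Cardinal.mk K := by
    change Cardinal.mk (Option (Option K)) = _
    simp
  obtain ⟨e⟩ := Cardinal.eq.1 h1.symm
  obtain ⟨D, hD, hDe⟩ := exists_chainOn_of_equiv e
  refine ⟨D, hD, ⟨e.symm ⊥, (e.symm ⊥).2, fun x hx h => ?_⟩,
    e.symm ⊤, (e.symm ⊤).2, fun x hx h => ?_⟩
  · have := (hDe ⟨x, hx⟩ _).1 h
    simp at this
  · have := (hDe _ ⟨x, hx⟩).1 h
    simp at this

variable {G : Dgraph V}

theorem exists_reordering (P : Set V → Dgraph V → Prop)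
    (hP : ∀ K : Set V, K.Infinite → ∃ D, ChainOn D K ∧ P K D)
    (hloc : ∀ (K : Set V) (D D' : Dgraph V), (∀ x ∈ K, ∀ y ∈ K, D.Arc x y ↔ D'.Arc x y) →
      P K D → P K D') :
    ∃ H, Reordering G H ∧ ∀ x, {y | Twin G x y}.Infinite → P {y | Twin G x y} H := by
  classical
  have hr := twin_equivalence G
  have hex : ∀ K : Set V, ∃ D : Dgraph V, ((∃ x, K = {y | Twin G x y}) → ChainOn D K) ∧
      (K.Infinite → P K D) := by
    intro K
    by_cases hK : K.Infinite
    · obtain ⟨D, h1, h2⟩ := hP K hK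
      exact ⟨D, fun _ => h1, fun _ => h2⟩
    · exact ⟨G, fun ⟨x, hx⟩ => hx ▸ chainOn_twin x, fun h => (hK h).elim⟩
  choose D hD1 hD2 using hex
  let H : Dgraph V := ⟨fun x y => if Twin G x y then (D {z | Twin G x z}).Arc x y else G.Arc x y,
    fun x h => by
      rw [if_pos (hr.refl x)] at h
      exact (D _).irrefl x h⟩
  have hH : ∀ x, ∀ y ∈ {y | Twin G x y}, ∀ z ∈ {y | Twin G x y},
      (D {y | Twin G x y}).Arc y z ↔ H.Arc y z := by
    intro x y hy z hz
    have h1 : {u | Twin G y u} = {u | Twin G x u} :=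
      Set.ext fun u => ⟨fun h => hr.trans hy h, fun h => hr.trans (hr.symm hy) h⟩
    change _ ↔ ite _ _ _
    rw [if_pos (hr.trans (hr.symm hy) hz), h1]
  refine ⟨H, ⟨fun x y hxy => ?_, fun x => ?_⟩, fun x hx => hloc _ _ _ (hH x) (hD2 _ hx)⟩
  · change _ ↔ ite _ _ _
    rw [if_neg hxy]
  · have h1 := hD1 {y | Twin G x y} ⟨x, rfl⟩
    refine ⟨fun y hy z hz hyz => ?_, fun y hy z hz t ht => ?_⟩
    · have := h1.1 y hy z hz hyz
      rwa [Dir, hH x y hy z hz, hH x z hz y hy] at this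
    · have := h1.2 y hy z hz t ht
      rwa [hH x y hy z hz, hH x z hz t ht, hH x t ht y hy] at this

theorem HalfRecon.finite_of_chainOn {k : ℕ} (h : G.HalfRecon k) {I : Set V}
    (hI : G.IsInterval I) (hc : ChainOn G I) : I.Finite := by
  by_contra hinf
  obtain ⟨x, hx⟩ := Set.Infinite.nonempty hinf
  have hinf : {y | Twin G x y}.Infinite :=
    Set.Infinite.mono (fun y hy => ⟨I, hI, hc, hx, hy⟩) hinf
  obtain ⟨H₁, h1, hH1⟩ := exists_reordering (G := G)
    (fun K D => ∀ x ∈ K, ∃ y ∈ K, D.Arc x y) (fun K hK => exists_chainOn_noMax hK)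
    (fun K D D' hDD' h x hx => by
      obtain ⟨y, hy, hxy⟩ := h x hx
      exact ⟨y, hy, (hDD' x hx y hy).1 hxy⟩)
  obtain ⟨H₂, h2, hH2⟩ := exists_reordering (G := G)
    (fun K D => (∃ m ∈ K, ∀ x ∈ K, ¬ D.Arc x m) ∧ ∃ M ∈ K, ∀ x ∈ K, ¬ D.Arc M x)
    (fun K hK => exists_chainOn_bounded hK)
    (fun K D D' hDD' ⟨⟨m, hm, hm'⟩, M, hM, hM'⟩ =>
      ⟨⟨m, hm, fun x hx h => hm' x hx ((hDD' x hx m hm).2 h)⟩,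
        M, hM, fun x hx h => hM' x hx ((hDD' M hM x hx).2 h)⟩)
  have hr := twin_equivalence G
  have key : ∀ e : V ≃ V, (∀ u v, Twin H₁ u v ↔ Twin H₂ (e u) (e v)) →
      ∀ m, Twin G (e x) m → ∃ y, Twin G (e x) (e y) ∧ H₁.Arc (e.symm m) y := by
    intro e he m hm
    have hm' : Twin G x (e.symm m) := by
      rw [← h1.twin_iff, he, h2.twin_iff]
      simpa using hm
    obtain ⟨y, hy, hmy⟩ := hH1 x hinf _ hm'
    refine ⟨y, ?_, hmy⟩
    rw [← h2.twin_iff, ← he, h1.twin_iff]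
    exact hy
  have hinf' : ∀ e : V ≃ V, (∀ u v, Twin H₁ u v ↔ Twin H₂ (e u) (e v)) →
      {y | Twin G (e x) y}.Infinite := by
    intro e he
    refine (hinf.image e.injective.injOn).mono ?_
    rintro _ ⟨y, hy, rfl⟩
    change Twin G _ _
    rw [← h2.twin_iff, ← he, h1.twin_iff]
    exact hy
  have hmap : ∀ {A B : Dgraph V} (e : V ≃ V), (∀ u v, A.Arc u v ↔ B.Arc (e u) (e v)) →
      ∀ u v, Twin A u v ↔ Twin B (e u) (e v) := by
    intro A B e he u v
    refine ⟨fun h => h.map e he, fun h => ?_⟩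
    have := h.map (K := A) e.symm fun u v => by simp [he]
    simpa using this
  have hH : Hemi H₁ H₂ :=
    (h H₁ (LeHemi.of_isoOn k fun X hX => h1.isoOn hX)).symm.trans
      (h H₂ (LeHemi.of_isoOn k fun X hX => h2.isoOn hX))
  rcases hH with ⟨e, he⟩ | ⟨e, he⟩
  · have ht := hmap e he
    obtain ⟨-, M, hM, hM'⟩ := hH2 (e x) (hinf' e ht)
    obtain ⟨y, hy, hMy⟩ := key e ht M hM
    refine hM' (e y) hy ?_
    simpa using (he _ _).1 hMy
  · have ht : ∀ u v, Twin H₁ u v ↔ Twin H₂ (e u) (e v) := fun u v =>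
      (Iff.intro Twin.dual Twin.dual).trans (hmap e he u v)
    obtain ⟨⟨m, hm, hm'⟩, -⟩ := hH2 (e x) (hinf' e ht)
    obtain ⟨y, hy, hmy⟩ := key e ht m hm
    refine hm' (e y) hy ?_
    simpa using (he y (e.symm m)).1 hmy

theorem Special.block {k : ℕ} (h : G.HalfRecon k) {I : Set V} (hI : Special G I) : Block G I := by
  refine ⟨hI.interval, hI.dft, by_contra fun hcyc => ?_⟩
  have hch : ChainOn G I := ⟨hI.dft.1, fun x hx y hy z hz h1 h2 h3 =>
    hcyc ⟨x, hx, y, hy, z, hz, h1, h2, h3⟩⟩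
  have hfin := h.finite_of_chainOn hI.interval hch
  exact hI.not_selfDual (hch.isoOn hfin hfin rfl hch.dual)

end InfiniteChain

section Backward

variable {G : Dgraph V} {I J : Set V}

theorem Block.eq_of_halfRecon (h : G.HalfRecon 6) (hI : Block G I) (hd : ¬ IsoOn G G.dual I I)
    (hJ : Block G J) (hIJ : IsoOn G G I J ∨ IsoOn G.dual G I J) : J = I := by
  by_contra hne
  let 𝓐 : Set (Set V) := {A | Block G A ∧ IsoOn G.dual G I A}
  have hA : ∀ A ∈ 𝓐, Block G A := fun A hA => hA.1
  have hB : ∀ A ∈ insert I 𝓐, Block G A := by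
    rintro A (rfl | hA')
    · exact hI
    · exact hA A hA'
  have h1 : ∀ {A}, Block (rev 𝓐 G) A → (IsoOn (rev 𝓐 G) G A I ∨ IsoOn (rev 𝓐 G) G.dual A I) →
      IsoOn (rev 𝓐 G) G A I := by
    intro A hAb hAI
    have hAb' := hAb.of_rev hA
    by_cases hmem : A ∈ 𝓐
    · exact (isoOn_rev_of_mem hmem).symm.trans hmem.2.dual.symm
    · have h2 := isoOn_rev_of_notMem hA hAb' hmem
      rcases hAI with h3 | h3
      · exact h3
      · exact (hmem ⟨hAb', (h2.trans h3).symm⟩).elim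
  have h2 : IsoOn (rev (insert I 𝓐) G) G.dual I I := (isoOn_rev_of_mem (Set.mem_insert _ _)).symm
  have h3 : IsoOn (rev (insert I 𝓐) G) G J I := by
    by_cases hmem : J ∈ 𝓐
    · exact (isoOn_rev_of_mem (Set.mem_insert_of_mem I hmem)).symm.trans hmem.2.dual.symm
    · have hnot : J ∉ insert I 𝓐 := by
        rintro (h | h)
        · exact hne h
        · exact hmem h
      refine (isoOn_rev_of_notMem hB hJ hnot).symm.trans ?_
      exact hIJ.elim IsoOn.symm fun h => (hmem ⟨hJ, h⟩).elim
  have hH : Hemi (rev (insert I 𝓐) G) (rev 𝓐 G) :=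
    (h _ (leHemi_rev hB)).symm.trans (h _ (leHemi_rev hA))
  rcases hH with ⟨e, he⟩ | ⟨e, he⟩
  · have h4 := (isoOn_image (I := I) e he).symm.trans h2
    exact hd ((h1 ((hI.reversed hB).image e he) (.inr h4)).symm.trans h4)
  · have h4 := (isoOn_image (I := J) e he).symm.trans h3.dual
    have h5 := h1 ((hJ.reversed hB).dual.image e he) (.inr h4)
    exact hd (h5.symm.trans h4)

theorem Special.eq_of_halfRecon (h : G.HalfRecon 6) (hI : Special G I) (hJ : Special G J) :
    I = J := by
  have hIb := hI.block h
  have hJb := hJ.block h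
  have h𝓕 : ∀ A ∈ ({I} : Set (Set V)), Block G A := by
    rintro _ rfl
    exact hIb
  by_contra hne
  have h1 : IsoOn G.dual (rev {I} G) I I := isoOn_rev_of_mem rfl
  have h2 : IsoOn G (rev {I} G) J J := isoOn_rev_of_notMem h𝓕 hJb fun h => hne h.symm
  have hH := (h _ (leHemi_rev h𝓕)).symm
  rcases hH with ⟨e, he⟩ | ⟨e, he⟩
  · have h3 := h1.trans (isoOn_image (I := I) e he)
    have h4 := hIb.eq_of_halfRecon h hI.not_selfDual ((hIb.reversed h𝓕).image e he) (.inr h3)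
    rw [h4] at h3
    exact hI.not_selfDual h3.symm
  · have h3 := h2.dual.trans (isoOn_image (I := J) e he)
    have h4 := hJb.eq_of_halfRecon h hJ.not_selfDual ((hJb.reversed h𝓕).dual.image e he) (.inr h3)
    rw [h4] at h3
    exact hJ.not_selfDual h3.symm

theorem Special.outIso_of_halfRecon (h : G.HalfRecon 6) (hI : Special G I) :
    OutIso G G.dual I I := by
  have hIb := hI.block h
  have h𝓕 : ∀ A ∈ ({I} : Set (Set V)), Block G A := by
    rintro _ rfl
    exact hIb
  have h1 : IsoOn G.dual (rev {I} G) I I := isoOn_rev_of_mem rfl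
  have hs : Special (rev {I} G) I := by
    refine ⟨(hIb.reversed h𝓕).interval, (hIb.reversed h𝓕).dft, fun h => hI.not_selfDual ?_, hI.ne_univ⟩
    exact ((h1.trans h).trans h1.dual.symm).symm
  have hH := (h _ (leHemi_rev h𝓕)).symm
  rcases hH with ⟨e, he⟩ | ⟨e, he⟩
  · have h2 := (hs.image e he).eq_of_halfRecon h hI
    have h3 := h1.trans (isoOn_image (I := I) e he)
    rw [h2] at h3
    exact (hI.not_selfDual h3.symm).elim
  · have h2 := (hs.dual.image e he).eq_of_halfRecon h hI
    have h3 : OutIso (rev {I} G).dual G I I := .of_equiv e he hI.interval h2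
    refine h3.dual.congr fun x hx y => ?_
    change ((rev {I} G).Arc x y ↔ _) ∧ ((rev {I} G).Arc y x ↔ _)
    rw [rev_arc_of_not_sameBlock fun h => hx (sameBlock_singleton.1 h).1,
      rev_arc_of_not_sameBlock fun h => hx (sameBlock_singleton.1 h).2]
    exact ⟨Iff.rfl, Iff.rfl⟩

theorem HalfRecon.rigid (h : G.HalfRecon 6) : Rigid G :=
  ⟨fun _ _ hI hJ => hI.eq_of_halfRecon h hJ, fun _ hI => hI.outIso_of_halfRecon h⟩

theorem rigid_iff (hG : G.ArcConnected) : Rigid G ↔ ¬ (G.CondL1 ∨ G.CondL2) := by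
  constructor
  · rintro h (⟨I, J, hne, hI, hJ⟩ | ⟨I, hI, -, hI'⟩)
    · rw [l12Int_iff hG] at hI hJ
      exact hne (h.unique I J hI hJ)
    · rw [l12Int_iff hG] at hI
      exact hI' ((contractIsoFix_iff hI.interval hI.interval.dual hI.nonempty).2 (h.outIso I hI))
  · intro h
    push Not at h
    have huniq : ∀ I J, Special G I → Special G J → I = J := fun I J hI hJ => by_contra fun hne =>
      h.1 ⟨I, J, hne, (l12Int_iff hG).2 hI, (l12Int_iff hG).2 hJ⟩
    refine ⟨huniq, fun I hI => by_contra fun hout => h.2 ⟨I, (l12Int_iff hG).2 hI, ?_, ?_⟩⟩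
    · exact fun J hJ => huniq J I ((l12Int_iff hG).1 hJ) hI
    · rwa [contractIsoFix_iff hI.interval hI.interval.dual hI.nonempty]

end Backward

end Dgraph

/-- An arc-connected (≤7)-half-reconstructible digraph is not
(≤6)-half-reconstructible iff it satisfies L1 or L2. -/
theorem arcConnected_le_six_half_reconstructible_characterization {V : Type u}
    (G : Dgraph V) (hconn : G.ArcConnected) (h7 : G.HalfRecon 7) :
    ¬ G.HalfRecon 6 ↔ (G.CondL1 ∨ G.CondL2) := by
  rw [← not_iff_not, not_not, ← rigid_iff hconn]
  exact ⟨HalfRecon.rigid, halfRecon_of_rigid hconn h7⟩
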